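/- Let Γ₁ and Γ₂ be rectifiable Jordan curves bounding disjoint domains Ω₁, Ω₂, with arc-length measures s₁, s₂ satisfying s_k(Γ₁ ∩ Γ₂) = 0 and s_k(σ(T) ∩ Γ_k) = 0, and let h_k ∈ E¹(Ω_k) satisfy ess sup_{z∈Γ_k} |h_k(z)| ‖(zI−T)^{-1}‖ < ∞ for k = 1, 2. Define A_k = (1/2πi) ∫_{Γ_k} h_k(z)(zI−T)^{-1} dz. Then A₁, A₂ ∈ {T}'' and A₁A₂ = A₂A₁ = 0. -/

import Mathlib

open scoped Real
open MeasureTheory Filter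

variable {H : Type*} [NormedAddCommGroup H] [NormedSpace ℂ H] [CompleteSpace H]

/-- The commutant of an operator `T`. -/
def commutant (T : H →L[ℂ] H) : Set (H →L[ℂ] H) := {A | A * T = T * A}

/-- The double commutant of an operator `T`. -/
def bicommutant (T : H →L[ℂ] H) : Set (H →L[ℂ] H) :=
  {A | ∀ B ∈ commutant T, A * B = B * A}

/-- A (closed) subspace invariant under every operator commuting with `T`. -/
def IsHyperinvariant (T : H →L[ℂ] H) (M : Submodule ℂ H) : Prop :=
  IsClosed (M : Set H) ∧ ∀ A ∈ commutant T, ∀ x ∈ M, A x ∈ M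


open scoped Real
open MeasureTheory Filter

lemma pt_exp_const {X : Type*} [TopologicalSpace X] {S : Set X} (hS : IsPreconnected S)
    {f g : X → ℂ} (hf : ContinuousOn f S) (hg : ContinuousOn g S)
    (h : ∀ x ∈ S, Complex.exp (f x) = Complex.exp (g x)) :
    ∃ n : ℤ, ∀ x ∈ S, f x = g x + n * (2 * π * Complex.I) := by
  rcases S.eq_empty_or_nonempty with rfl | ⟨x₀, hx₀⟩
  · exact ⟨0, by simp⟩
  have hpi : (2 * π * Complex.I : ℂ) ≠ 0 := Complex.two_pi_I_ne_zero
  have key : ∀ x ∈ S, ∃ n : ℤ, (f x - g x) / (2 * π * Complex.I) = n := by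
    intro x hx
    obtain ⟨n, hn⟩ := Complex.exp_eq_exp_iff_exists_int.1 (h x hx)
    refine ⟨n, ?_⟩
    rw [hn]; field_simp; ring
  have : DiscreteTopology (Set.range ((↑) : ℤ → ℂ)) := by
    have := (Int.isClosedEmbedding_coe_real)
    have h2 : Topology.IsEmbedding ((↑) : ℤ → ℂ) := by
      have h3 := Complex.isometry_ofReal.isEmbedding.comp this.isEmbedding
      convert h3 using 1
      ext x; simp
    exact h2.toHomeomorph.symm.isEmbedding.discreteTopology
  have hc : ContinuousOn (fun x => (f x - g x) / (2 * π * Complex.I)) S := by fun_prop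
  obtain ⟨n, hn⟩ := key x₀ hx₀
  refine ⟨n, fun x hx => ?_⟩
  have := hS.constant_of_mapsTo (T := Set.range ((↑) : ℤ → ℂ)) ⟨this⟩ hc
    (fun y hy => by obtain ⟨k, hk⟩ := key y hy; exact ⟨k, hk.symm⟩) hx hx₀
  rw [hn] at this
  rw [div_eq_iff hpi] at this
  linear_combination this

lemma pt_clog {X : Type*} [TopologicalSpace X] [LocallyPathConnectedSpace X] [ContractibleSpace X]
    {f : X → ℂ} (hf : Continuous f) (h0 : ∀ z, f z ≠ 0) :
    ∃ g : X → ℂ, Continuous g ∧ ∀ z, Complex.exp (g z) = f z := by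
  have x₀ : X := Classical.arbitrary X
  obtain ⟨g, ⟨-, hg⟩, -⟩ := Complex.isCoveringMapOn_exp.existsUnique_continuousMap_lifts
    ⟨f, hf⟩ (a₀ := x₀) (Complex.exp_log (h0 x₀)) (fun x => h0 x)
  exact ⟨g, g.continuous, fun z => congrFun hg z⟩

lemma pt_noPow {V : Set ℂ} (hVo : IsOpen V) (hVb : Bornology.IsBounded V) {a : ℂ} (ha : a ∈ V)
    {N : ℂ → ℂ} (hN : ContinuousOn N (closure V)) (hN0 : ∀ z ∈ closure V, N z ≠ 0)
    (m : ℤ) (hm : ∀ z ∈ frontier V, N z = (z - a) ^ m) : m = 0 := by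
  classical
  set Φ : ℂ → ℂ := V.piecewise N (fun z => (z - a) ^ m) with hΦ
  have hne : ∀ z, z ∉ V → z - a ≠ 0 := fun z hz h => hz (by rwa [sub_eq_zero.1 h])
  have hΦc : Continuous Φ := by
    refine continuous_piecewise hm hN ?_
    rw [hVo.isClosed_compl.closure_eq]
    intro z hz
    exact (ContinuousAt.zpow₀ (f := fun z : ℂ => z - a) (by fun_prop) m (Or.inl (hne z hz))).continuousWithinAt
  have hΦ0 : ∀ z, Φ z ≠ 0 := by
    intro z
    by_cases hz : z ∈ V
    · simpa [hΦ, hz] using hN0 z (subset_closure hz)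
    · simpa [hΦ, hz] using zpow_ne_zero m (hne z hz)
  obtain ⟨G, hG, hGe⟩ := pt_clog hΦc hΦ0
  obtain ⟨R, hR⟩ := hVb.subset_ball a
  have hRp : 0 < R := by
    have := hR ha
    simpa using this
  have hcirc : ∀ θ : ℝ, Complex.exp (G (a + R * Complex.exp (θ * Complex.I))) =
      Complex.exp (m * (Real.log R + θ * Complex.I)) := by
    intro θ
    rw [hGe]
    have hz : a + R * Complex.exp (θ * Complex.I) ∉ V := by
      intro h
      have := hR h
      simp [Complex.norm_exp_ofReal_mul_I, abs_of_pos hRp] at this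
    simp only [hΦ, hz, not_false_eq_true, Set.piecewise_eq_of_notMem]
    rw [Complex.exp_int_mul, Complex.exp_add, ← Complex.ofReal_exp, Real.exp_log hRp]
    simp
  obtain ⟨n, hn⟩ := pt_exp_const (S := (Set.univ : Set ℝ)) isPreconnected_univ
    (f := fun θ : ℝ => G (a + R * Complex.exp (θ * Complex.I)))
    (g := fun θ : ℝ => m * (Real.log R + θ * Complex.I)) (by fun_prop) (by fun_prop)
    (fun x _ => hcirc x)
  have h0 := hn 0 (Set.mem_univ _)
  have h1 := hn (2 * π) (Set.mem_univ _)
  have he : Complex.exp ((2 * π : ℝ) * Complex.I) = 1 := by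
    push_cast; exact Complex.exp_two_pi_mul_I
  simp only [he] at h1
  simp only [Complex.ofReal_zero, zero_mul, Complex.exp_zero] at h0
  rw [h1] at h0
  have : (m : ℂ) * (2 * π * Complex.I) = 0 := by push_cast at h0; linear_combination h0
  have hpi : (2 * π * Complex.I : ℂ) ≠ 0 := Complex.two_pi_I_ne_zero
  have := (mul_eq_zero.1 this).resolve_right hpi
  exact_mod_cast this

lemma pt_descend {γ : ℝ → ℂ} (hγ : ContinuousOn γ (Set.Icc 0 1)) {F : Set ℂ} (hF : IsClosed F)
    (hFs : F ⊆ γ '' Set.Icc 0 1)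
    {l : ℝ → ℂ} (hl : ContinuousOn l (Set.Icc 0 1 ∩ γ ⁻¹' F))
    (hr : ∀ s ∈ Set.Icc (0:ℝ) 1, ∀ t ∈ Set.Icc (0:ℝ) 1, γ s ∈ F → γ s = γ t → l s = l t) :
    ∃ g : ℂ → ℂ, Continuous g ∧ ∀ t ∈ Set.Icc (0:ℝ) 1, γ t ∈ F → g (γ t) = l t := by
  classical
  set τ : Set ℝ := Set.Icc 0 1 ∩ γ ⁻¹' F with hτ
  have hτc : IsCompact τ := by
    have : IsClosed τ := hγ.preimage_isClosed_of_isClosed isClosed_Icc hF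
    exact isCompact_Icc.of_isClosed_subset this Set.inter_subset_left
  have : CompactSpace τ := isCompact_iff_compactSpace.1 hτc
  let p : τ → F := fun t => ⟨γ t, t.2.2⟩
  have hp : Continuous p := by
    refine Continuous.subtype_mk ?_ _
    exact (hγ.mono Set.inter_subset_left).domRestrict
  have hps : Function.Surjective p := by
    rintro ⟨z, hz⟩
    obtain ⟨t, ht, rfl⟩ := hFs hz
    exact ⟨⟨t, ht, hz⟩, rfl⟩
  have hq : Topology.IsQuotientMap p := (hp.isClosedMap).isQuotientMap hp hps
  let g₀ : F → ℂ := fun z => l (hps z).choose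
  have hg₀ : ∀ t : τ, g₀ (p t) = l t := by
    intro t
    have h1 := (hps (p t)).choose_spec
    have h2 := (hps (p t)).choose.2
    exact hr _ h2.1 _ t.2.1 h2.2 (congrArg Subtype.val h1)
  have hg₀c : Continuous g₀ := by
    rw [hq.continuous_iff]
    have : g₀ ∘ p = fun t : τ => l t := funext hg₀
    rw [this]
    exact hl.domRestrict
  obtain ⟨g, hg⟩ := ContinuousMap.exists_restrict_eq hF (⟨g₀, hg₀c⟩ : C(F, ℂ))
  refine ⟨g, g.continuous, fun t ht htF => ?_⟩
  have := hg₀ ⟨t, ht, htF⟩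
  rw [← this]
  exact DFunLike.congr_fun hg ⟨γ t, htF⟩

open scoped Real
open MeasureTheory Filter

structure JDom (γ : ℝ → ℂ) (Ω : Set ℂ) : Prop where
  cont : ContinuousOn γ (Set.Icc 0 1)
  cl : γ 0 = γ 1
  inj : Set.InjOn γ (Set.Ico 0 1)
  rect : eVariationOn γ (Set.Icc 0 1) ≠ ⊤
  op : IsOpen Ω
  bd : Bornology.IsBounded Ω
  fr : frontier Ω = γ '' Set.Icc 0 1

lemma pt_inj_cases {γ : ℝ → ℂ} (cl : γ 0 = γ 1) (inj : Set.InjOn γ (Set.Ico 0 1)) {s t : ℝ}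
    (hs : s ∈ Set.Icc (0:ℝ) 1) (ht : t ∈ Set.Icc (0:ℝ) 1) (h : γ s = γ t) :
    s = t ∨ (s = 0 ∧ t = 1) ∨ (s = 1 ∧ t = 0) := by
  rcases eq_or_lt_of_le hs.2 with rfl | hs1
  · rcases eq_or_lt_of_le ht.2 with rfl | ht1
    · exact Or.inl rfl
    · right; right
      refine ⟨rfl, ?_⟩
      rw [← cl] at h
      exact (inj (by simp) ⟨ht.1, ht1⟩ h).symm
  · rcases eq_or_lt_of_le ht.2 with rfl | ht1
    · right; left
      rw [← cl] at h
      exact ⟨inj ⟨hs.1, hs1⟩ (by simp) h, rfl⟩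
    · exact Or.inl (inj ⟨hs.1, hs1⟩ ⟨ht.1, ht1⟩ h)

lemma pt_frontier_comp {U : Set ℂ} (hU : IsOpen U) (w : ℂ) :
    frontier (connectedComponentIn U w) ⊆ frontier U := by
  have hV : IsOpen (connectedComponentIn U w) := hU.connectedComponentIn
  intro x hx
  rw [hV.frontier_eq] at hx
  rw [hU.frontier_eq]
  refine ⟨closure_mono (connectedComponentIn_subset U w) hx.1, fun hxU => hx.2 ?_⟩
  have hW : IsOpen (connectedComponentIn U x) := hU.connectedComponentIn
  have hxW : x ∈ connectedComponentIn U x := mem_connectedComponentIn hxU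
  obtain ⟨y, hy1, hy2⟩ := mem_closure_iff.1 hx.1 _ hW hxW
  rw [connectedComponentIn_eq hy2, ← connectedComponentIn_eq hy1]
  exact hxW

/-- a continuous logarithm along a closed curve -/
lemma pt_curve_log {γ : ℝ → ℂ} (hc : ContinuousOn γ (Set.Icc 0 1)) (cl : γ 0 = γ 1) {a : ℂ}
    (ha : a ∉ γ '' Set.Icc 0 1) :
    ∃ (l : ℝ → ℂ) (k : ℤ), Continuous l ∧ (∀ t ∈ Set.Icc (0:ℝ) 1, Complex.exp (l t) = γ t - a) ∧
      l 1 = l 0 + k * (2 * π * Complex.I) := by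
  have h01 : (0:ℝ) ≤ 1 := zero_le_one
  obtain ⟨l, hl, he⟩ := pt_clog (X := ℝ)
    (f := fun t => Set.IccExtend h01 (Set.domRestrict (Set.Icc 0 1) γ) t - a)
    (by
      have : Continuous (Set.IccExtend h01 (Set.domRestrict (Set.Icc 0 1) γ)) :=
        hc.domRestrict.Icc_extend'
      fun_prop)
    (fun t h => ha ⟨_, (Set.projIcc 0 1 h01 t).2, sub_eq_zero.1 h⟩)
  have he' : ∀ t ∈ Set.Icc (0:ℝ) 1, Complex.exp (l t) = γ t - a := by
    intro t ht
    rw [he, Set.IccExtend_of_mem h01 _ ht]; rfl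
  have : Complex.exp (l 1) = Complex.exp (l 0) := by
    rw [he' 1 (by simp), he' 0 (by simp), cl]
  obtain ⟨k, hk⟩ := Complex.exp_eq_exp_iff_exists_int.1 this
  exact ⟨l, k, hl, he', hk⟩

lemma pt_A3 {γ : ℝ → ℂ} (hc : ContinuousOn γ (Set.Icc 0 1)) (cl : γ 0 = γ 1)
    (inj : Set.InjOn γ (Set.Ico 0 1)) {V₁ V₂ : Set ℂ} (o1 : IsOpen V₁) (o2 : IsOpen V₂)
    (b1 : Bornology.IsBounded V₁) (b2 : Bornology.IsBounded V₂) {a₁ a₂ : ℂ} (h1 : a₁ ∈ V₁)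
    (h2 : a₂ ∈ V₂) (hd : Disjoint V₁ V₂) (f1 : frontier V₁ ⊆ γ '' Set.Icc 0 1)
    (f2 : frontier V₂ ⊆ γ '' Set.Icc 0 1) (n1 : a₁ ∉ γ '' Set.Icc 0 1)
    (n2 : a₂ ∉ γ '' Set.Icc 0 1) : False := by
  obtain ⟨l₁, k₁, c1, e1, p1⟩ := pt_curve_log hc cl n1
  obtain ⟨l₂, k₂, c2, e2, p2⟩ := pt_curve_log hc cl n2
  have hΓ : IsClosed (γ '' Set.Icc 0 1) := (isCompact_Icc.image_of_continuousOn hc).isClosed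
  have desc : ∀ l : ℝ → ℂ, Continuous l → l 1 = l 0 →
      ∃ g : ℂ → ℂ, Continuous g ∧ ∀ t ∈ Set.Icc (0:ℝ) 1, g (γ t) = l t := by
    intro l hl h
    obtain ⟨g, hg, hh⟩ := pt_descend hc hΓ subset_rfl (l := l) hl.continuousOn (by
      intro s hs t ht _ hst
      rcases pt_inj_cases cl inj hs ht hst with rfl | ⟨rfl, rfl⟩ | ⟨rfl, rfl⟩
      · rfl
      · exact h.symm
      · exact h)
    exact ⟨g, hg, fun t ht => hh t ht ⟨t, ht, rfl⟩⟩
  have m1 : a₂ ∉ closure V₁ := fun h => by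
    obtain ⟨y, hy1, hy2⟩ := mem_closure_iff.1 h _ o2 h2
    exact Set.disjoint_left.1 hd hy2 hy1
  have m2 : a₁ ∉ closure V₂ := fun h => by
    obtain ⟨y, hy1, hy2⟩ := mem_closure_iff.1 h _ o1 h1
    exact Set.disjoint_left.1 hd hy1 hy2
  obtain ⟨G, hG, hGe⟩ := desc (fun t => k₂ * l₁ t - k₁ * l₂ t) (by fun_prop) (by
    simp only [p1, p2]; ring)
  have hexp : ∀ z ∈ γ '' Set.Icc 0 1, Complex.exp (G z) = (z - a₁) ^ k₂ * (z - a₂) ^ (-k₁) := by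
    rintro _ ⟨t, ht, rfl⟩
    rw [hGe t ht, Complex.exp_sub, Complex.exp_int_mul, Complex.exp_int_mul, e1 t ht, e2 t ht,
      zpow_neg]
    rfl
  have ne1 : ∀ z ∈ γ '' Set.Icc 0 1, z - a₁ ≠ 0 := fun z hz h => n1 (by rwa [← sub_eq_zero.1 h])
  have ne2 : ∀ z ∈ γ '' Set.Icc 0 1, z - a₂ ≠ 0 := fun z hz h => n2 (by rwa [← sub_eq_zero.1 h])
  have hz1 : ∀ z ∈ closure V₁, z - a₂ ≠ 0 := fun z hz h => m1 (by rwa [← sub_eq_zero.1 h])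
  have hz2 : ∀ z ∈ closure V₂, z - a₁ ≠ 0 := fun z hz h => m2 (by rwa [← sub_eq_zero.1 h])
  have hk1 : -k₁ = 0 := by
    refine pt_noPow o2 b2 h2 (N := fun z => Complex.exp (G z) * (z - a₁) ^ (-k₂)) ?_ ?_ (-k₁) ?_
    · intro z hz
      have := ContinuousAt.zpow₀ (f := fun z : ℂ => z - a₁) (a := z) (by fun_prop) (-k₂)
        (Or.inl (hz2 z hz))
      exact ((Complex.continuous_exp.comp hG).continuousAt.mul this).continuousWithinAt
    · intro z hz
      exact mul_ne_zero (Complex.exp_ne_zero _) (zpow_ne_zero _ (hz2 z hz))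
    · intro z hz
      have := ne1 z (f2 hz)
      rw [hexp z (f2 hz), zpow_neg (z - a₁)]
      field_simp
  have hk1' : k₁ = 0 := by omega
  obtain ⟨G', hG', hGe'⟩ := desc l₁ c1 (by simp [p1, hk1'])
  have : (1:ℤ) = 0 := by
    refine pt_noPow o1 b1 h1 (N := fun z => Complex.exp (G' z)) ?_ ?_ 1 ?_
    · fun_prop
    · intro z hz; exact Complex.exp_ne_zero _
    · intro z hz
      obtain ⟨t, ht, rfl⟩ := f1 hz
      simp [hGe' t ht, e1 t ht]
  omega

namespace JDom
variable {γ : ℝ → ℂ} {Ω : Set ℂ} (J : JDom γ Ω)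
include J

lemma isCompact_Γ : IsCompact (γ '' Set.Icc 0 1) := isCompact_Icc.image_of_continuousOn J.cont
lemma nonempty : Ω.Nonempty := by
  rw [Set.nonempty_iff_ne_empty]
  rintro rfl
  have := J.fr
  have h0 : γ 0 ∈ γ '' Set.Icc 0 1 := ⟨0, by simp, rfl⟩
  simp [← this] at h0
lemma disj {z : ℂ} (hz : z ∈ Ω) : z ∉ γ '' Set.Icc 0 1 := by
  rw [← J.fr, J.op.frontier_eq]; exact fun h => h.2 hz
lemma closure_eq : closure Ω = Ω ∪ γ '' Set.Icc 0 1 := by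
  rw [← J.fr, closure_eq_self_union_frontier]
lemma isCompact_cl : IsCompact (closure Ω) := J.bd.isCompact_closure
lemma Γ_sub : γ '' Set.Icc 0 1 ⊆ closure Ω := by rw [← J.fr]; exact frontier_subset_closure

lemma unbdd {w : ℂ} (hw : w ∈ (closure Ω)ᶜ) :
    ¬ Bornology.IsBounded (connectedComponentIn (closure Ω)ᶜ w) := by
  intro hb
  obtain ⟨a, ha⟩ := J.nonempty
  have ho : IsOpen (closure Ω)ᶜ := isClosed_closure.isOpen_compl
  refine pt_A3 J.cont J.cl J.inj J.op ho.connectedComponentIn J.bd hb ha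
    (mem_connectedComponentIn hw) ?_ J.fr.subset ?_ (J.disj ha) ?_
  · exact (Set.disjoint_left (s := Ω) (t := (closure Ω)ᶜ).2 fun x hx hx' => hx' (subset_closure hx)).mono_right
      (connectedComponentIn_subset _ _)
  · refine (pt_frontier_comp ho w).trans ?_
    rw [frontier_compl, ← J.fr]
    exact frontier_closure_subset
  · exact fun h => hw (J.Γ_sub h)

lemma preconn : IsPreconnected Ω := by
  refine isPreconnected_of_forall_pair fun a ha b hb => ?_
  by_cases h : b ∈ connectedComponentIn Ω a
  · exact ⟨_, connectedComponentIn_subset _ _, mem_connectedComponentIn ha, h,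
      isPreconnected_connectedComponentIn⟩
  exfalso
  refine pt_A3 J.cont J.cl J.inj (J.op.connectedComponentIn (x := a))
    (J.op.connectedComponentIn (x := b))
    (J.bd.subset (connectedComponentIn_subset _ _)) (J.bd.subset (connectedComponentIn_subset _ _))
    (mem_connectedComponentIn ha) (mem_connectedComponentIn hb) ?_
    ((pt_frontier_comp J.op a).trans J.fr.subset) ((pt_frontier_comp J.op b).trans J.fr.subset)
    (J.disj ha) (J.disj hb)
  rw [Set.disjoint_left]
  intro x hx hx'
  apply h
  rw [connectedComponentIn_eq hx, ← connectedComponentIn_eq hx']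
  exact mem_connectedComponentIn hb

lemma Γ_sub_ext : γ '' Set.Icc 0 1 ⊆ closure (closure Ω)ᶜ := by
  rintro z0 ⟨t0, ht0, hz0⟩
  wlog ht1 : t0 < 1 generalizing t0
  · have : t0 = 1 := le_antisymm ht0.2 (not_lt.1 ht1)
    subst this
    exact this 0 (by simp) (by rw [J.cl]; exact hz0) (by norm_num)
  by_contra hcon
  have hW : z0 ∈ interior (closure Ω) := by
    rw [closure_compl] at hcon
    simpa using hcon
  set W := interior (closure Ω) with hWd
  have hWb : Bornology.IsBounded W := J.bd.closure.subset interior_subset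
  have hfr : frontier W ⊆ γ '' Set.Icc 0 1 := by
    rw [← J.fr]
    exact frontier_interior_subset.trans frontier_closure_subset
  have hz0f : z0 ∉ frontier W := by
    rw [isOpen_interior.frontier_eq]; exact fun h => h.2 hW
  obtain ⟨a, ha⟩ := J.nonempty
  have haW : a ∈ W := interior_maximal subset_closure J.op ha
  obtain ⟨l, k, hl, he, hk⟩ := pt_curve_log J.cont J.cl (J.disj ha)
  classical
  obtain ⟨G, hG, hGe⟩ := pt_descend J.cont (F := frontier W) isClosed_frontier hfr
    (l := fun t => l t - if t0 < t then k * (2 * π * Complex.I) else 0) (by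
      refine hl.continuousOn.sub ?_
      intro t ht
      have htt : t ≠ t0 := by
        rintro rfl
        exact hz0f (hz0 ▸ ht.2)
      refine ContinuousAt.continuousWithinAt ?_
      rcases lt_or_gt_of_ne htt with h | h
      · refine (continuousAt_const (y := (0:ℂ))).congr ?_
        filter_upwards [eventually_lt_nhds h] with x hx
        rw [if_neg (not_lt.2 hx.le)]
      · refine (continuousAt_const (y := (k * (2 * π * Complex.I) : ℂ))).congr ?_
        filter_upwards [eventually_gt_nhds h] with x hx
        rw [if_pos hx]) (by
      intro s hs t ht _ hst
      have h0 : ¬ t0 < 0 := not_lt.2 ht0.1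
      rcases pt_inj_cases J.cl J.inj hs ht hst with rfl | ⟨rfl, rfl⟩ | ⟨rfl, rfl⟩
      · rfl
      · simp [h0, ht1, hk]
      · simp [h0, ht1, hk])
  have : (1:ℤ) = 0 := by
    refine pt_noPow isOpen_interior hWb haW (N := fun z => Complex.exp (G z)) ?_ ?_ 1 ?_
    · fun_prop
    · intro z hz; exact Complex.exp_ne_zero _
    · intro z hz
      obtain ⟨t, ht, rfl⟩ := hfr hz
      rw [hGe t ht hz, zpow_one, ← he t ht, Complex.exp_eq_exp_iff_exists_int]
      refine ⟨if t0 < t then -k else 0, ?_⟩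
      split_ifs <;> push_cast <;> ring
  omega

end JDom

open scoped Real
open MeasureTheory Filter

lemma pt_ftc {β : ℝ → ℂ} {K : NNReal} (hβ : LipschitzWith K β) (a b : ℝ) :
    ∫ t in a..b, deriv β t = β b - β a := by
  have hd : ∀ᵐ t, DifferentiableAt ℝ β t := hβ.ae_differentiableAt_real
  have hint : IntervalIntegrable (deriv β) volume a b := by
    refine (intervalIntegrable_const (c := (K : ℝ))).mono_fun
      (aestronglyMeasurable_deriv β _) (Eventually.of_forall fun t => ?_)
    simpa using norm_deriv_le_of_lipschitz hβ
  have hre : LipschitzWith K (fun t => (β t).re) := by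
    have := (Complex.reCLM.lipschitz.comp hβ)
    refine LipschitzWith.of_dist_le_mul fun x y => ?_
    rw [Real.dist_eq, ← Complex.sub_re]
    exact (Complex.abs_re_le_norm _).trans ((dist_eq_norm (β x) (β y)) ▸ hβ.dist_le_mul x y)
  have him : LipschitzWith K (fun t => (β t).im) := by
    refine LipschitzWith.of_dist_le_mul fun x y => ?_
    rw [Real.dist_eq, ← Complex.sub_im]
    exact (Complex.abs_im_le_norm _).trans ((dist_eq_norm (β x) (β y)) ▸ hβ.dist_le_mul x y)
  have h1 := (hre.lipschitzOnWith (s := Set.uIcc a b)).absolutelyContinuousOnInterval.integral_deriv_eq_sub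
  have h2 := (him.lipschitzOnWith (s := Set.uIcc a b)).absolutelyContinuousOnInterval.integral_deriv_eq_sub
  have e1 : ∀ᵐ t, deriv (fun t => (β t).re) t = (deriv β t).re := by
    filter_upwards [hd] with t ht
    exact ((Complex.reCLM.hasFDerivAt (x := β t)).comp_hasDerivAt t ht.hasDerivAt).deriv
  have e2 : ∀ᵐ t, deriv (fun t => (β t).im) t = (deriv β t).im := by
    filter_upwards [hd] with t ht
    exact ((Complex.imCLM.hasFDerivAt (x := β t)).comp_hasDerivAt t ht.hasDerivAt).deriv
  apply Complex.ext
  · have := Complex.reCLM.intervalIntegral_comp_comm hint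
    simp only [Complex.reCLM_apply] at this
    rw [Complex.sub_re, ← h1, ← this]
    exact intervalIntegral.integral_congr_ae (e1.mono fun t ht _ => ht.symm)
  · have := Complex.imCLM.intervalIntegral_comp_comm hint
    simp only [Complex.imCLM_apply] at this
    rw [Complex.sub_im, ← h2, ← this]
    exact intervalIntegral.integral_congr_ae (e2.mono fun t ht _ => ht.symm)

lemma JDom.arc {γ : ℝ → ℂ} {Ω : Set ℂ} (J : JDom γ Ω) :
    ∃ (L : ℝ) (β : ℝ → ℂ), 0 ≤ L ∧ LipschitzWith 1 β ∧ β '' Set.Icc 0 L = γ '' Set.Icc 0 1 ∧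
      β 0 = β L ∧ Set.InjOn β (Set.Ico 0 L) ∧
      ∀ᵐ s ∂(volume.restrict (Set.Ioc 0 L)), ‖deriv β s‖ = 1 := by
  set S : Set ℝ := Set.Icc 0 1 with hS
  have hbv : BoundedVariationOn γ S := J.rect
  have hlb : LocallyBoundedVariationOn γ S := hbv.locallyBoundedVariationOn
  have h0S : (0:ℝ) ∈ S := by simp [hS]
  have h1S : (1:ℝ) ∈ S := by simp [hS]
  set v : ℝ → ℝ := variationOnFromTo γ S 0 with hv
  have vmono : MonotoneOn v S := variationOnFromTo.monotoneOn hlb h0S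
  have v0 : v 0 = 0 := variationOnFromTo.self _ _ _
  set L := v 1 with hL
  have hL0 : 0 ≤ L := by rw [← v0]; exact vmono h0S h1S zero_le_one
  have vcont : ContinuousOn v S := by
    intro t ht
    have hl := variationOnFromTo.tendsto_left (l := γ t) h0S ht hlb
      ((J.cont t ht).mono_left (nhdsWithin_mono _ Set.inter_subset_left))
    have hr := variationOnFromTo.tendsto_right (l := γ t) h0S ht hlb
      ((J.cont t ht).mono_left (nhdsWithin_mono _ Set.inter_subset_left))
    simp only [dist_self, sub_zero, add_zero] at hl hr
    have hu : S ⊆ (S ∩ Set.Iio t ∪ S ∩ Set.Ioi t) ∪ {t} := by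
      intro x hx
      rcases lt_trichotomy x t with h | h | h
      · exact Or.inl (Or.inl ⟨hx, h⟩)
      · exact Or.inr h
      · exact Or.inl (Or.inr ⟨hx, h⟩)
    refine ContinuousWithinAt.mono ?_ hu
    exact (ContinuousWithinAt.union (ContinuousWithinAt.union hl hr) continuousWithinAt_singleton)
  have himg : v '' S = Set.Icc 0 L := by
    apply Set.Subset.antisymm
    · rintro _ ⟨t, ht, rfl⟩
      exact ⟨v0 ▸ vmono h0S ht ht.1, vmono ht h1S ht.2⟩
    · have := intermediate_value_Icc (zero_le_one (α := ℝ)) vcont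
      rwa [v0] at this
  have hdist : ∀ s ∈ S, ∀ t ∈ S, s ≤ t → dist (γ s) (γ t) ≤ v t - v s := by
    intro s hs t ht hst
    rw [hv, variationOnFromTo.sub_right hlb h0S ht hs, variationOnFromTo.eq_of_le _ _ hst,
      dist_edist]
    refine ENNReal.toReal_mono (hlb s t hs ht) ?_
    exact eVariationOn.edist_le _ ⟨hs, le_rfl, hst⟩ ⟨ht, hst, le_rfl⟩
  obtain ⟨w, hw⟩ : ∃ w : ℝ → ℝ, ∀ s ∈ Set.Icc 0 L, w s ∈ S ∧ v (w s) = s := by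
    have : ∀ s, ∃ t, s ∈ Set.Icc 0 L → t ∈ S ∧ v t = s := by
      intro s
      by_cases h : s ∈ Set.Icc 0 L
      · rw [← himg] at h
        obtain ⟨t, ht, h⟩ := h
        exact ⟨t, fun _ => ⟨ht, h⟩⟩
      · exact ⟨0, fun h' => absurd h' h⟩
    choose w hw using this
    exact ⟨w, fun s hs => hw s hs⟩
  set β : ℝ → ℂ := fun s => γ (w (Set.projIcc 0 L hL0 s)) with hβ
  have hβv : ∀ t ∈ S, β (v t) = γ t := by
    intro t ht
    have hm : v t ∈ Set.Icc 0 L := himg ▸ ⟨t, ht, rfl⟩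
    simp only [hβ, Set.projIcc_of_mem hL0 hm]
    obtain ⟨h1, h2⟩ := hw _ hm
    apply dist_le_zero.1
    rcases le_total (w (v t)) t with h | h
    · have := hdist _ h1 _ ht h; rw [h2, sub_self] at this; exact this
    · have := hdist _ ht _ h1 h; rw [h2, sub_self] at this; rw [dist_comm]; exact this
  have hlip : LipschitzWith 1 β := by
    have key : ∀ x y : ℝ, x ≤ y → dist (β x) (β y) ≤ dist x y := by
      intro x y hxy
      set p := Set.projIcc 0 L hL0 x
      set q := Set.projIcc 0 L hL0 y
      have hpq : p ≤ q := Set.monotone_projIcc hL0 hxy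
      obtain ⟨p1, p2⟩ := hw p p.2
      obtain ⟨q1, q2⟩ := hw q q.2
      have hd : dist (p:ℝ) q ≤ dist x y := by
        have := (LipschitzWith.projIcc hL0).dist_le_mul x y
        rw [NNReal.coe_one, one_mul] at this
        exact this
      change dist (γ (w p)) (γ (w q)) ≤ _
      rcases le_or_gt (w p) (w q) with h | h
      · refine (hdist _ p1 _ q1 h).trans ?_
        rw [p2, q2]
        refine le_trans ?_ hd
        rw [dist_comm, Real.dist_eq]; exact le_abs_self _
      · have hm := vmono q1 p1 h.le
        rw [dist_comm]
        refine (hdist _ q1 _ p1 h.le).trans ?_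
        rw [p2, q2] at *
        have : (p:ℝ) ≤ q := hpq
        linarith [dist_nonneg (x := x) (y := y)]
    refine LipschitzWith.of_dist_le_mul fun x y => ?_
    rw [NNReal.coe_one, one_mul]
    rcases le_total x y with h | h
    · exact key x y h
    · rw [dist_comm, dist_comm x]; exact key y x h
  have hdb : ∀ s, ‖deriv β s‖ ≤ 1 := fun s => by
    simpa using norm_deriv_le_of_lipschitz (x₀ := s) hlip
  have hint : ∀ a b : ℝ, IntervalIntegrable (fun s => ‖deriv β s‖) volume a b := fun a b => by
    refine (intervalIntegrable_const (c := (1 : ℝ))).mono_fun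
      (aestronglyMeasurable_deriv β _).norm (Eventually.of_forall fun t => ?_)
    simpa using hdb t
  refine ⟨L, β, hL0, hlip, ?_, ?_, ?_, ?_⟩
  · rw [← himg, Set.image_image]
    exact Set.image_congr hβv
  · have a := hβv 0 h0S
    have b := hβv 1 h1S
    rw [v0] at a
    rw [a, b, J.cl]
  · intro x hx y hy hxy
    obtain ⟨s, hs, rfl⟩ : x ∈ v '' S := himg ▸ ⟨hx.1, hx.2.le⟩
    obtain ⟨t, ht, rfl⟩ : y ∈ v '' S := himg ▸ ⟨hy.1, hy.2.le⟩
    rw [hβv s hs, hβv t ht] at hxy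
    have hs1 : s < 1 := lt_of_le_of_ne hs.2 (by rintro rfl; exact lt_irrefl _ hx.2)
    have ht1 : t < 1 := lt_of_le_of_ne ht.2 (by rintro rfl; exact lt_irrefl _ hy.2)
    rw [J.inj ⟨hs.1, hs1⟩ ⟨ht.1, ht1⟩ hxy]
  · set Ψ : ℝ → ℝ := fun t => ∫ s in (0:ℝ)..(v t), ‖deriv β s‖ with hΨ
    have hΨd : ∀ s t, Ψ t - Ψ s = ∫ x in (v s)..(v t), ‖deriv β x‖ := fun s t => by
      simp only [hΨ]
      rw [intervalIntegral.integral_interval_sub_left (hint _ _) (hint _ _)]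
    have hle : eVariationOn γ S ≤ eVariationOn Ψ S := by
      refine iSup_mono fun p => Finset.sum_le_sum fun i _ => ?_
      have hi := p.2.2.2 i
      have hi1 := p.2.2.2 (i+1)
      have hm := p.2.2.1 (Nat.le_succ i)
      have hvm := vmono hi hi1 hm
      rw [edist_dist, edist_dist]
      apply ENNReal.ofReal_le_ofReal
      rw [Real.dist_eq, hΨd, dist_eq_norm, ← hβv _ hi, ← hβv _ hi1, ← pt_ftc hlip]
      exact (intervalIntegral.norm_integral_le_integral_norm hvm).trans (le_abs_self _)
    have hΨm : MonotoneOn Ψ S := by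
      intro s hs t ht hst
      have := hΨd s t
      have h2 : 0 ≤ ∫ x in (v s)..(v t), ‖deriv β x‖ :=
        intervalIntegral.integral_nonneg (vmono hs ht hst) fun _ _ => norm_nonneg _
      linarith
    have hΨ2 := (hΨm.eVariationOn_eq h0S h1S).le
    rw [Set.inter_eq_left.2 (hS ▸ subset_rfl)] at hΨ2
    have hΨ3 := hle.trans hΨ2
    have hLv : L = (eVariationOn γ S).toReal := by
      rw [hL, hv, variationOnFromTo.eq_of_le _ _ zero_le_one, Set.inter_eq_left.2 (hS ▸ subset_rfl)]
    have hL2 : L ≤ Ψ 1 - Ψ 0 := by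
      rw [hLv]
      exact ENNReal.toReal_le_of_le_ofReal (sub_nonneg.2 (hΨm h0S h1S zero_le_one)) hΨ3
    rw [hΨd, v0, ← hL] at hL2
    have hz : ∫ x in (0:ℝ)..L, (1 - ‖deriv β x‖) = 0 := by
      rw [intervalIntegral.integral_sub intervalIntegrable_const (hint _ _)]
      have h5 : ∫ x in (0:ℝ)..L, ‖deriv β x‖ ≤ ∫ x in (0:ℝ)..L, (1:ℝ) :=
        intervalIntegral.integral_mono hL0 (hint _ _) intervalIntegrable_const hdb
      simp at h5 ⊢
      linarith
    rw [intervalIntegral.integral_of_le hL0] at hz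
    have hi : IntegrableOn (fun x => 1 - ‖deriv β x‖) (Set.Ioc 0 L) volume :=
      (intervalIntegrable_iff_integrableOn_Ioc_of_le hL0).1 (intervalIntegrable_const.sub (hint _ _))
    have := (setIntegral_eq_zero_iff_of_nonneg_ae (Eventually.of_forall fun x => by simpa using hdb x) hi).1 hz
    filter_upwards [this] with x hx
    simp at hx; linarith

lemma JDom.vol_zero {γ : ℝ → ℂ} {Ω : Set ℂ} (J : JDom γ Ω) : volume (γ '' Set.Icc 0 1) = 0 := by
  obtain ⟨L, β, hL, hlip, himg, -⟩ := J.arc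
  rw [← himg]
  have h1 : dimH (β '' Set.Icc 0 L) ≤ 1 := by
    refine (hlip.dimH_image_le _).trans ?_
    refine (dimH_mono (Set.subset_univ _)).trans ?_
    rw [Real.dimH_univ]
  have h2 : μH[((2 : NNReal):ℝ)] (β '' Set.Icc 0 L) = 0 :=
    hausdorffMeasure_of_dimH_lt (h1.trans_lt (by norm_num))
  have h3 : (volume : Measure ℂ) ≪ μH[2] := by
    have : Measure.IsAddHaarMeasure (μH[Module.finrank ℝ ℂ] : Measure ℂ) := inferInstance
    rw [Complex.finrank_real_complex] at this
    have := Measure.absolutelyContinuous_isAddHaarMeasure (volume : Measure ℂ) (μH[(2:ℕ)])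
    simpa using this
  exact h3 (by simpa using h2)

open scoped Real
open MeasureTheory Filter

section cauchy
variable {α : Type*} [MeasurableSpace α] {m : Measure α} {c g : α → ℂ} {K : Set ℂ}

lemma pt_inv_bound (hK : IsClosed K) {w : ℂ} (hw : w ∉ K) :
    ∃ δ > 0, ∀ z ∈ K, ∀ w' ∈ Metric.ball w δ, δ ≤ ‖z - w'‖ := by
  obtain ⟨ε, hε, h⟩ := Metric.isOpen_iff.1 hK.isOpen_compl w hw
  refine ⟨ε / 2, by positivity, fun z hz w' hw' => ?_⟩
  by_contra hcon
  push Not at hcon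
  refine h (?_ : z ∈ _) hz
  rw [Metric.mem_ball] at *
  calc dist z w ≤ dist z w' + dist w' w := dist_triangle _ _ _
    _ < ε / 2 + ε / 2 := by rw [dist_eq_norm z w']; gcongr
    _ = ε := by ring

lemma pt_inv_meas (hc : AEStronglyMeasurable c m) (w : ℂ) :
    AEStronglyMeasurable (fun x => (c x - w)⁻¹) m := by
  have : Measurable (fun z : ℂ => (z - w)⁻¹) := by fun_prop
  exact (this.comp_aemeasurable hc.aemeasurable).aestronglyMeasurable

variable {F : Type*} [NormedAddCommGroup F] [NormedSpace ℂ F] {ν : α → F}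

lemma pt_inv_integrable (hc : AEStronglyMeasurable c m) (hν : Integrable ν m) (hK : IsClosed K)
    (hcK : ∀ᵐ x ∂m, c x ∈ K) {w : ℂ} (hw : w ∉ K) :
    Integrable (fun x => (c x - w)⁻¹ • ν x) m := by
  obtain ⟨δ, hδ, h⟩ := pt_inv_bound hK hw
  refine hν.bdd_smul δ⁻¹ (pt_inv_meas hc w) ?_
  filter_upwards [hcK] with x hx
  rw [norm_inv]
  exact inv_anti₀ hδ (h _ hx w (Metric.mem_ball_self hδ))

lemma pt_inv_hasDeriv [CompleteSpace F] (hc : AEStronglyMeasurable c m) (hν : Integrable ν m) (hK : IsClosed K)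
    (hcK : ∀ᵐ x ∂m, c x ∈ K) {w : ℂ} (hw : w ∉ K) :
    HasDerivAt (fun w => ∫ x, (c x - w)⁻¹ • ν x ∂m)
      (∫ x, ((c x - w)⁻¹ ^ 2) • ν x ∂m) w := by
  obtain ⟨δ, hδ, h⟩ := pt_inv_bound hK hw
  have := hasDerivAt_integral_of_dominated_loc_of_deriv_le (μ := m) (𝕜 := ℂ)
    (F := fun w x => (c x - w)⁻¹ • ν x) (F' := fun w x => ((c x - w)⁻¹ ^ 2) • ν x) (x₀ := w)
    (s := Metric.ball w δ) (bound := fun x => (δ⁻¹) ^ 2 * ‖ν x‖) (Metric.ball_mem_nhds _ hδ)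
    (Eventually.of_forall fun w' => (pt_inv_meas hc w').smul hν.1)
    (pt_inv_integrable hc hν hK hcK hw)
    (((pt_inv_meas hc w).pow 2).smul hν.1) ?_ (hν.norm.const_mul _) ?_
  · exact this.2
  · filter_upwards [hcK] with x hx w' hw'
    rw [norm_smul, norm_pow, norm_inv]
    have := inv_anti₀ hδ (h _ hx w' hw')
    gcongr
  · filter_upwards [hcK] with x hx w' hw'
    have hne : c x - w' ≠ 0 := by
      have := h _ hx w' hw'
      intro h0; rw [h0, norm_zero] at this; linarith
    have h1 : HasDerivAt (fun w => c x - w) (-1) w' := by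
      simpa using (hasDerivAt_id w').const_sub (c x)
    have h2 := (h1.inv hne).smul_const (ν x)
    have h3 : (c x - w')⁻¹ ^ 2 = - -1 / (c x - w') ^ 2 := by field_simp
    simp only [h3]
    exact h2

lemma pt_cauchy_ext {γ : ℝ → ℂ} {Ω : Set ℂ} (J : JDom γ Ω)
    (hc : AEStronglyMeasurable c m) (hg : Integrable g m) (hcΓ : ∀ᵐ x ∂m, c x ∈ γ '' Set.Icc 0 1)
    (hmom : ∀ n : ℕ, ∫ x, c x ^ n * g x ∂m = 0) {w : ℂ} (hw : w ∉ closure Ω) :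
    ∫ x, (c x - w)⁻¹ * g x ∂m = 0 := by
  set Γ := γ '' Set.Icc 0 1 with hΓ
  have hK : IsClosed Γ := J.isCompact_Γ.isClosed
  obtain ⟨R, hR⟩ := J.isCompact_Γ.isBounded.exists_norm_le
  have hR0 : 0 ≤ R := (norm_nonneg _).trans (hR (γ 0) ⟨0, by simp, rfl⟩)
  have hpow : ∀ n : ℕ, AEStronglyMeasurable (fun x => c x ^ n) m := fun n => hc.pow n
  have hpb : ∀ n : ℕ, ∀ᵐ x ∂m, ‖c x ^ n‖ ≤ R ^ n := fun n => by
    filter_upwards [hcΓ] with x hx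
    rw [norm_pow]; gcongr; exact hR _ hx
  have hpi : ∀ n : ℕ, Integrable (fun x => c x ^ n * g x) m := fun n =>
    hg.bdd_mul (hpow n) (hpb n)
  set Φ : ℂ → ℂ := fun w => ∫ x, (c x - w)⁻¹ • g x ∂m with hΦ
  have hd : ∀ w, w ∉ Γ → DifferentiableAt ℂ Φ w := fun w hw =>
    (pt_inv_hasDeriv hc hg hK hcΓ hw).differentiableAt
  have hbig : ∀ w : ℂ, R < ‖w‖ → Φ w = 0 := by
    intro w hwR
    have hwΓ : w ∉ Γ := fun h => absurd (hR w h) (not_le.2 hwR)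
    have hw0 : w ≠ 0 := by rintro rfl; simp at hwR; linarith
    have hgi : Integrable (fun x => (c x - w)⁻¹ • g x) m := pt_inv_integrable hc hg hK hcΓ hwΓ
    have hii : ∀ n : ℕ, Integrable (fun x => c x ^ n * ((c x - w)⁻¹ • g x)) m := fun n =>
      hgi.bdd_mul (hpow n) (hpb n)
    have hrec : ∀ n : ℕ, ∫ x, c x ^ n * ((c x - w)⁻¹ • g x) ∂m = w ^ n * Φ w := by
      intro n
      induction n with
      | zero => simp [hΦ]
      | succ n ih =>
        have : ∫ x, c x ^ (n+1) * ((c x - w)⁻¹ • g x) ∂m =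
            ∫ x, (c x ^ n * g x + w * (c x ^ n * ((c x - w)⁻¹ • g x))) ∂m := by
          refine integral_congr_ae ?_
          filter_upwards [hcΓ] with x hx
          have : c x - w ≠ 0 := fun h => hwΓ (by rwa [← sub_eq_zero.1 h])
          simp only [smul_eq_mul]
          field_simp
          ring
        rw [this, integral_add (hpi n) ((hii n).const_mul w), hmom, zero_add, integral_const_mul, ih]
        ring
    have hle : ∀ n : ℕ, ‖Φ w‖ ≤ (R / ‖w‖) ^ n * ∫ x, ‖(c x - w)⁻¹ • g x‖ ∂m := by
      intro n
      have h1 : ‖w ^ n * Φ w‖ ≤ R ^ n * ∫ x, ‖(c x - w)⁻¹ • g x‖ ∂m := by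
        rw [← hrec, ← integral_const_mul]
        refine norm_integral_le_of_norm_le (hgi.norm.const_mul _) ?_
        filter_upwards [hpb n] with x hx
        rw [norm_mul]; gcongr
      rw [norm_mul, norm_pow] at h1
      rw [div_pow, div_mul_eq_mul_div, le_div_iff₀ (by positivity)]
      linarith
    have hlim : Tendsto (fun n : ℕ => (R / ‖w‖) ^ n * ∫ x, ‖(c x - w)⁻¹ • g x‖ ∂m) atTop
        (nhds (0 * ∫ x, ‖(c x - w)⁻¹ • g x‖ ∂m)) := by
      refine Tendsto.mul_const _ (tendsto_pow_atTop_nhds_zero_of_lt_one (by positivity) ?_)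
      rw [div_lt_one (by positivity)]; exact hwR
    rw [zero_mul] at hlim
    exact norm_le_zero_iff.1 (ge_of_tendsto' hlim hle)
  set U := connectedComponentIn (closure Ω)ᶜ w with hU
  have hUo : IsOpen U := (isClosed_closure.isOpen_compl).connectedComponentIn
  have hUs : U ⊆ (closure Ω)ᶜ := connectedComponentIn_subset _ _
  have hUn := J.unbdd hw
  obtain ⟨w1, hw1U, hw1⟩ : ∃ w1 ∈ U, R < ‖w1‖ := by
    by_contra hcon
    push Not at hcon
    exact hUn (isBounded_iff_forall_norm_le.2 ⟨R, hcon⟩)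
  have han : AnalyticOnNhd ℂ Φ U := by
    refine DifferentiableOn.analyticOnNhd (fun z hz => ?_) hUo
    exact (hd z (fun h => hUs hz (J.Γ_sub h))).differentiableWithinAt
  have := han.eqOn_zero_of_preconnected_of_eventuallyEq_zero isPreconnected_connectedComponentIn
    hw1U (by
      filter_upwards [(isOpen_lt continuous_const continuous_norm).mem_nhds hw1] with z hz
      exact hbig z hz)
  exact this (mem_connectedComponentIn hw)

lemma pt_entire {R : ℝ} (hc : AEStronglyMeasurable c m) (hg : Integrable g m)
    (hR : ∀ᵐ x ∂m, ‖c x‖ ≤ R)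
    (hmom : ∀ n : ℕ, ∫ x, c x ^ n * g x ∂m = 0) {f : ℂ → ℂ} (hf : Differentiable ℂ f) :
    ∫ x, f (c x) * g x ∂m = 0 := by
  wlog hR0 : 0 ≤ R generalizing R
  · exact this (R := max R 0) (hR.mono fun x h => h.trans (le_max_left _ _)) (le_max_right _ _)
  set a : ℕ → ℂ := fun n => (n.factorial : ℂ)⁻¹ * iteratedDeriv n f 0 with ha
  have hs : ∀ z, HasSum (fun n => a n * z ^ n) (f z) := by
    intro z
    have := Complex.hasSum_taylorSeries_of_entire hf 0 z
    simp only [sub_zero, smul_eq_mul] at this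
    refine this.congr_fun ?_ |> fun h => h
    intro n; simp only [ha]; ring
  have hsum : Summable (fun n => ‖a n‖ * R ^ n) := by
    have := (hs (R:ℂ)).summable.norm
    simpa [abs_of_nonneg hR0] using this
  have hpi : ∀ n : ℕ, Integrable (fun x => c x ^ n * g x) m := fun n =>
    hg.bdd_mul (c := R ^ n) (hc.pow n) (by
      filter_upwards [hR] with x hx
      rw [norm_pow]; gcongr)
  have h1 := hasSum_integral_of_summable_integral_norm (μ := m)
    (F := fun n x => a n * (c x ^ n * g x)) (fun n => (hpi n).const_mul _) (by
      refine Summable.of_nonneg_of_le (fun n => integral_nonneg fun x => norm_nonneg _) (fun n => ?_)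
        (hsum.mul_right (∫ x, ‖g x‖ ∂m))
      rw [← integral_const_mul]
      refine integral_mono_ae ((hpi n).const_mul _).norm (hg.norm.const_mul _) ?_
      filter_upwards [hR] with x hx
      simp only [norm_mul, norm_pow]
      rw [← mul_assoc]
      gcongr)
  have h2 : ∀ x, ∑' n, a n * (c x ^ n * g x) = f (c x) * g x := by
    intro x
    have := (hs (c x)).mul_right (g x)
    simp only [mul_assoc] at this
    exact this.tsum_eq
  simp only [h2, integral_const_mul, hmom, mul_zero] at h1
  exact h1.unique hasSum_zero

lemma pt_entire_cauchy {R : ℝ} (hK : IsClosed K) (hcK : ∀ᵐ x ∂m, c x ∈ K)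
    (hc : AEStronglyMeasurable c m) (hg : Integrable g m)
    (hR : ∀ᵐ x ∂m, ‖c x‖ ≤ R)
    (hmom : ∀ n : ℕ, ∫ x, c x ^ n * g x ∂m = 0) {f : ℂ → ℂ} (hf : Differentiable ℂ f)
    {a : ℂ} (ha : a ∉ K) :
    ∫ x, (c x - a)⁻¹ * (f (c x) * g x) ∂m = f a * ∫ x, (c x - a)⁻¹ * g x ∂m := by
  have hds : Differentiable ℂ (dslope f a) := by
    rw [← differentiableOn_univ, Complex.differentiableOn_dslope univ_mem]
    exact hf.differentiableOn
  have hfb : ∃ C, ∀ z ∈ Metric.closedBall (0:ℂ) R, ‖dslope f a z‖ ≤ C :=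
    (isCompact_closedBall 0 R).exists_bound_of_continuousOn hds.continuous.continuousOn
  obtain ⟨C, hC⟩ := hfb
  have hi1 : Integrable (fun x => dslope f a (c x) * g x) m :=
    hg.bdd_mul (c := C) (hds.continuous.comp_aestronglyMeasurable hc) (by
      filter_upwards [hR] with x hx
      exact hC _ (by simpa using hx))
  have hi2 : Integrable (fun x => f a * ((c x - a)⁻¹ * g x)) m :=
    (pt_inv_integrable hc hg hK hcK ha).const_mul _
  have : ∫ x, (c x - a)⁻¹ * (f (c x) * g x) ∂m =
      ∫ x, (dslope f a (c x) * g x + f a * ((c x - a)⁻¹ * g x)) ∂m := by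
    refine integral_congr_ae ?_
    filter_upwards [hcK] with x hx
    have hne : c x ≠ a := fun h => ha (by rwa [← h])
    have hne' : c x - a ≠ 0 := sub_ne_zero.2 hne
    rw [dslope_of_ne f hne, slope_def_field]
    field_simp
    ring
  rw [this, integral_add hi1 hi2, pt_entire hc hg hR hmom hds, zero_add, integral_const_mul]

end cauchy

open scoped Real
open MeasureTheory Filter

noncomputable def dbar {F : Type*} [NormedAddCommGroup F] [NormedSpace ℂ F] (φ : ℂ → F) (z : ℂ) : F :=
  (2⁻¹ : ℂ) • (fderiv ℝ φ z 1 + Complex.I • fderiv ℝ φ z Complex.I)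

lemma pt_dbar_cont {φ : ℂ → ℂ} (hφ : ContDiff ℝ 1 φ) : Continuous (dbar φ) := by
  have h := hφ.continuous_fderiv one_ne_zero
  unfold dbar
  fun_prop

lemma pt_dbar_supp {φ : ℂ → ℂ} (hs : HasCompactSupport φ) : HasCompactSupport (dbar φ) := by
  have h := hs.fderiv (𝕜 := ℝ)
  refine h.mono ?_
  intro z hz h0
  apply hz
  have : fderiv ℝ φ z = 0 := by simpa using h0
  simp [dbar, this]

lemma pt_pompeiu0 {φ : ℂ → ℂ} (hφ : ContDiff ℝ 1 φ) (hs : HasCompactSupport φ) :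
    ∫ z : ℂ, z⁻¹ * dbar φ z = - π * φ 0 := by
  obtain ⟨R, hR0, hR⟩ : ∃ R > 0, ∀ z : ℂ, R ≤ ‖z‖ → φ z = 0 := by
    obtain ⟨R, h⟩ := hs.isCompact.isBounded.exists_norm_le
    refine ⟨max R 0 + 1, by positivity, fun z hz => ?_⟩
    by_contra hne
    have := h z (subset_tsupport _ hne)
    linarith [le_max_left R 0]
  have hR' : ∀ z : ℂ, R < ‖z‖ → fderiv ℝ φ z = 0 := by
    intro z hz
    have : φ =ᶠ[nhds z] fun _ => 0 := by
      filter_upwards [(isOpen_lt continuous_const continuous_norm).mem_nhds hz] with y hy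
      exact hR y (le_of_lt hy)
    rw [this.fderiv_eq]; simp
  have hD := hφ.continuous_fderiv one_ne_zero
  have hdiff : Differentiable ℝ φ := hφ.differentiable one_ne_zero
  set e : ℝ → ℂ := fun θ => Complex.exp (θ * Complex.I) with he
  have hec : Continuous e := by fun_prop
  have hen : ∀ θ, ‖e θ‖ = 1 := fun θ => Complex.norm_exp_ofReal_mul_I θ
  set A : ℝ × ℝ → ℂ := fun p => fderiv ℝ φ (p.1 * e p.2) (e p.2) with hA
  set B : ℝ × ℝ → ℂ := fun p => fderiv ℝ φ (p.1 * e p.2) (Complex.I * e p.2) with hB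
  have hAc : Continuous A := by
    have : Continuous fun p : ℝ × ℝ => fderiv ℝ φ (p.1 * e p.2) := by fun_prop
    exact this.clm_apply (by fun_prop)
  have hBc : Continuous B := by
    have : Continuous fun p : ℝ × ℝ => fderiv ℝ φ (p.1 * e p.2) := by fun_prop
    exact this.clm_apply (by fun_prop)
  have hint : ∀ f : ℝ × ℝ → ℂ, Continuous f → (∀ p : ℝ × ℝ, R < p.1 → f p = 0) →
      IntegrableOn f (Set.Ioi (0:ℝ) ×ˢ Set.Ioo (-π) π) (volume.prod volume) := by
    intro f hf h0
    have : IntegrableOn f (Set.Icc (0:ℝ) R ×ˢ Set.Icc (-π) π) (volume.prod volume) :=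
      hf.continuousOn.integrableOn_compact (isCompact_Icc.prod isCompact_Icc)
    refine this.of_forall_sdiff_eq_zero (by measurability) ?_
    rintro ⟨r, θ⟩ ⟨⟨h1, h2⟩, h3⟩
    apply h0
    by_contra hcon
    exact h3 ⟨⟨le_of_lt h1, not_lt.1 hcon⟩, ⟨h2.1.le, h2.2.le⟩⟩
  have hlt : ∀ p : ℝ × ℝ, R < p.1 → R < ‖(p.1 : ℂ) * e p.2‖ := by
    intro p hp
    rw [norm_mul, hen, mul_one, Complex.norm_real]
    exact hp.trans_le (le_abs_self _)
  have hAi := hint A hAc (fun p hp => by simp [hA, hR' _ (hlt p hp)])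
  have hBi := hint B hBc (fun p hp => by simp [hB, hR' _ (hlt p hp)])
  have hAr : ∀ θ, ∫ r in Set.Ioi (0:ℝ), A (r, θ) = - φ 0 := by
    intro θ
    have hd : ∀ r ∈ Set.Ici (0:ℝ), HasDerivAt (fun r : ℝ => φ (r * e θ)) (A (r, θ)) r := by
      intro r _
      have h1 : HasDerivAt (fun r : ℝ => (r : ℂ) * e θ) (e θ) r := by
        simpa using (Complex.ofRealCLM.hasDerivAt (x := r)).mul_const (e θ)
      exact (hdiff _).hasFDerivAt.comp_hasDerivAt r h1
    have hi : IntegrableOn (fun r => A (r, θ)) (Set.Ioi 0) := by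
      have : IntegrableOn (fun r => A (r, θ)) (Set.Icc 0 R) :=
        (hAc.comp (by fun_prop : Continuous fun r : ℝ => (r, θ))).continuousOn.integrableOn_compact
          isCompact_Icc
      refine this.of_forall_sdiff_eq_zero measurableSet_Ioi ?_
      rintro r ⟨h1, h3⟩
      have : R < r := by
        by_contra hcon
        exact h3 ⟨le_of_lt h1, not_lt.1 hcon⟩
      simp [hA, hR' _ (hlt (r, θ) this)]
    have := integral_Ioi_of_hasDerivAt_of_tendsto' hd hi (m := 0) (by
      refine tendsto_const_nhds.congr' ?_
      filter_upwards [eventually_ge_atTop R, eventually_ge_atTop 0] with r hr hr0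
      rw [hR]
      rw [norm_mul, hen, mul_one, Complex.norm_real]
      exact hr.trans (le_abs_self _))
    simpa using this
  have hBθ : ∀ r ∈ Set.Ioi (0:ℝ), ∫ θ in Set.Ioo (-π) π, B (r, θ) = 0 := by
    intro r hr
    have hr' : (r:ℂ) ≠ 0 := by exact_mod_cast (ne_of_gt hr)
    have hd : ∀ θ : ℝ, HasDerivAt (fun θ : ℝ => φ (r * e θ)) (r * B (r, θ)) θ := by
      intro θ
      have h0 : HasDerivAt e (Complex.I * e θ) θ := by
        have := ((Complex.ofRealCLM.hasDerivAt (x := θ)).mul_const Complex.I).cexp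
        simp only [Complex.ofRealCLM_apply, Complex.ofReal_one, one_mul] at this
        rw [mul_comm]; exact this
      have h1 : HasDerivAt (fun θ : ℝ => (r : ℂ) * e θ) ((r : ℂ) * (Complex.I * e θ)) θ :=
        h0.const_mul (r : ℂ)
      have := (hdiff (r * e θ)).hasFDerivAt.comp_hasDerivAt θ h1
      have h3 : (r : ℂ) * (Complex.I * e θ) = r • (Complex.I * e θ) := by simp
      have h4 : (fderiv ℝ φ (r * e θ)) ((r : ℂ) * (Complex.I * e θ)) = r * B (r, θ) := by
        rw [h3, map_smul]
        simp [hB]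
      rw [h4] at this
      exact this
    have := intervalIntegral.integral_eq_sub_of_hasDerivAt (a := -π) (b := π) (fun θ _ => hd θ)
      ((hBc.comp (by fun_prop : Continuous fun θ : ℝ => (r, θ))).const_mul (r:ℂ) |>.intervalIntegrable _ _)
    have hee : e π = e (-π) := by
      simp only [he]; push_cast
      rw [neg_mul, Complex.exp_neg, Complex.exp_pi_mul_I]; norm_num
    rw [hee, sub_self, intervalIntegral.integral_const_mul,
      intervalIntegral.integral_of_le (by linarith [Real.pi_pos]), integral_Ioc_eq_integral_Ioo] at this
    exact (mul_eq_zero.1 this).resolve_left hr'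
  rw [← Complex.integral_comp_polarCoord_symm]
  have hcongr : ∫ p in polarCoord.target, p.1 • ((Complex.polarCoord.symm p)⁻¹ * dbar φ (Complex.polarCoord.symm p))
      = ∫ p in Set.Ioi (0:ℝ) ×ˢ Set.Ioo (-π) π, ((2⁻¹ : ℂ) * A p + (2⁻¹ * Complex.I) * B p) := by
    refine setIntegral_congr_fun (measurableSet_Ioi.prod measurableSet_Ioo) ?_
    rintro ⟨r, θ⟩ hp
    have hr : 0 < r := hp.1
    have hr' : (r:ℂ) ≠ 0 := by exact_mod_cast hr.ne'
    have hpc : Complex.polarCoord.symm (r, θ) = r * e θ := by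
      rw [Complex.polarCoord_symm_apply]
      simp [he, Complex.exp_mul_I]
    simp only [hpc]
    have hlin : ∀ (D : ℂ →L[ℝ] ℂ) (x : ℂ), D x = x.re * D 1 + x.im * D Complex.I := by
      intro D x
      have hx : x = x.re • (1:ℂ) + x.im • Complex.I := by simp [Complex.re_add_im]
      conv_lhs => rw [hx]
      rw [map_add, map_smul, map_smul]; simp
    have hene : e θ ≠ 0 := Complex.exp_ne_zero _
    have hcs : e θ = (Real.cos θ : ℂ) + Real.sin θ * Complex.I := by
      simp [he, Complex.exp_mul_I]
    have hre : (e θ).re = Real.cos θ := by rw [hcs]; simp [← Complex.ofReal_cos, ← Complex.ofReal_sin]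
    have him : (e θ).im = Real.sin θ := by rw [hcs]; simp [← Complex.ofReal_cos, ← Complex.ofReal_sin]
    have hinv : (e θ)⁻¹ = (Real.cos θ : ℂ) - Real.sin θ * Complex.I := by
      rw [inv_eq_of_mul_eq_one_right]
      rw [hcs]
      have : ((Real.cos θ : ℂ))^2 + (Real.sin θ : ℂ)^2 = 1 := by
        norm_cast; rw [add_comm]; exact Real.sin_sq_add_cos_sq θ
      linear_combination this - (Real.sin θ : ℂ)^2 * Complex.I_sq
    simp only [hA, hB, dbar]
    rw [hlin _ (e θ), hlin _ (Complex.I * e θ)]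
    simp only [Complex.mul_re, Complex.mul_im, Complex.I_re, Complex.I_im, hre, him, mul_inv, hinv]
    set D1 := fderiv ℝ φ (r * e θ) 1
    set D2 := fderiv ℝ φ (r * e θ) Complex.I
    simp only [Complex.real_smul, smul_eq_mul]
    push_cast
    field_simp
    linear_combination (-1) * (Complex.sin θ * D2) * Complex.I_sq
  rw [hcongr, Measure.volume_eq_prod, integral_add (hAi.const_mul _) (hBi.const_mul _),
    integral_const_mul, integral_const_mul]
  have e2 : ∫ p in Set.Ioi (0:ℝ) ×ˢ Set.Ioo (-π) π, B p ∂(volume.prod volume) = 0 := by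
    rw [setIntegral_prod _ hBi]
    exact setIntegral_eq_zero_of_forall_eq_zero hBθ
  have e1 : ∫ p in Set.Ioi (0:ℝ) ×ˢ Set.Ioo (-π) π, A p ∂(volume.prod volume) = - (2 * π) * φ 0 := by
    rw [← Measure.prod_restrict, integral_prod_symm _ (by rw [Measure.prod_restrict]; exact hAi)]
    simp only [hAr]
    simp [Real.pi_pos.le]
    ring_nf
    norm_num
  rw [e1, e2]
  ring

lemma pt_pompeiu {φ : ℂ → ℂ} (hφ : ContDiff ℝ 1 φ) (hs : HasCompactSupport φ) (w : ℂ) :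
    ∫ z : ℂ, (z - w)⁻¹ * dbar φ z = - π * φ w := by
  have h := pt_pompeiu0 (φ := fun z => φ (z + w)) (hφ.comp (by fun_prop))
    (hs.comp_homeomorph (Homeomorph.addRight w))
  simp only [zero_add] at h
  rw [← h, ← integral_add_right_eq_self _ w]
  congr 1; ext z
  simp only [add_sub_cancel_right, dbar]
  rw [fderiv_comp_add_right]

open scoped Real
open MeasureTheory Filter

lemma pt_area0 {r : ℝ} (hr : 0 < r) (w : ℂ) :
    ∫⁻ z in Metric.ball w r, ‖(z - w)⁻¹‖ₑ ≤ ENNReal.ofReal (2 * π * r) := by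
  rw [← lintegral_indicator Metric.isOpen_ball.measurableSet]
  rw [← lintegral_add_right_eq_self _ w, ← Complex.lintegral_comp_polarCoord_symm]
  have : ∀ p ∈ polarCoord.target, ENNReal.ofReal p.1 • (Metric.ball w r).indicator (fun z => ‖(z - w)⁻¹‖ₑ)
      (Complex.polarCoord.symm p + w) ≤ (Set.Ioo 0 r ×ˢ Set.Ioo (-π) π).indicator (fun _ => 1) p := by
    rintro ⟨ρ, θ⟩ ⟨h1, h2⟩
    have h1' : 0 < ρ := h1
    have hn : ‖Complex.polarCoord.symm (ρ, θ)‖ = ρ := by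
      rw [Complex.norm_polarCoord_symm]; exact abs_of_pos h1'
    by_cases hρ : ρ < r
    · rw [Set.indicator_of_mem, Set.indicator_of_mem]
      · rw [add_sub_cancel_right, enorm_inv (by rw [← norm_pos_iff, hn]; exact h1'), ← ofReal_norm, hn, smul_eq_mul,
          ENNReal.mul_inv_cancel (by simpa using h1') ENNReal.ofReal_ne_top]
      · exact ⟨⟨h1', hρ⟩, h2⟩
      · rw [Metric.mem_ball, dist_eq_norm, add_sub_cancel_right, hn]; exact hρ
    · rw [Set.indicator_of_notMem]
      · simp
      · rw [Metric.mem_ball, dist_eq_norm, add_sub_cancel_right, hn]; exact hρ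
  refine (setLIntegral_mono' (measurableSet_Ioi.prod measurableSet_Ioo) this).trans ?_
  refine (setLIntegral_le_lintegral _ _).trans ?_
  rw [lintegral_indicator (measurableSet_Ioo.prod measurableSet_Ioo), setLIntegral_one, Measure.volume_eq_prod,
    Measure.prod_prod, Real.volume_Ioo, Real.volume_Ioo, ← ENNReal.ofReal_mul (by linarith)]
  apply ENNReal.ofReal_le_ofReal
  apply le_of_eq; ring

lemma pt_area {r : ℝ} (hr : 0 < r) (a w : ℂ) :
    ∫⁻ z in Metric.ball a r, ‖(z - w)⁻¹‖ₑ ≤ ENNReal.ofReal (3 * π * r) := by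
  have hsub : Metric.ball a r ⊆ Metric.ball w r ∪ (Metric.ball a r ∩ (Metric.ball w r)ᶜ) := by
    intro z hz
    by_cases h : z ∈ Metric.ball w r
    · exact Or.inl h
    · exact Or.inr ⟨hz, h⟩
  refine (lintegral_mono_set hsub).trans ((lintegral_union_le _ _ _).trans ?_)
  have h2 : ∫⁻ z in Metric.ball a r ∩ (Metric.ball w r)ᶜ, ‖(z - w)⁻¹‖ₑ ≤ ENNReal.ofReal (π * r) := by
    have hm : MeasurableSet (Metric.ball a r ∩ (Metric.ball w r)ᶜ) :=
      Metric.isOpen_ball.measurableSet.inter Metric.isOpen_ball.measurableSet.compl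
    calc _ ≤ ∫⁻ z in Metric.ball a r ∩ (Metric.ball w r)ᶜ, ENNReal.ofReal r⁻¹ := by
          refine setLIntegral_mono' hm fun z hz => ?_
          rw [← ofReal_norm]
          apply ENNReal.ofReal_le_ofReal
          rw [norm_inv]
          apply inv_anti₀ hr
          have := hz.2
          rw [Set.mem_compl_iff, Metric.mem_ball, dist_eq_norm] at this
          exact not_lt.1 this
      _ ≤ ENNReal.ofReal r⁻¹ * volume (Metric.ball a r) := by
          rw [setLIntegral_const]
          gcongr
          exact Set.inter_subset_left
      _ ≤ _ := by
          rw [Complex.volume_ball, ← ENNReal.ofReal_coe_nnreal, ← ENNReal.ofReal_pow hr.le, ← ENNReal.ofReal_mul (by positivity),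
            ← ENNReal.ofReal_mul (by positivity)]
          apply ENNReal.ofReal_le_ofReal
          rw [NNReal.coe_real_pi]
          field_simp; rfl
  refine (add_le_add (pt_area0 hr w) h2).trans ?_
  rw [← ENNReal.ofReal_add (by positivity) (by positivity)]
  apply ENNReal.ofReal_le_ofReal
  apply le_of_eq; ring

section fub
variable {α : Type*} [MeasurableSpace α] {m : Measure α} [SFinite m] {c : α → ℂ}
variable {F : Type*} [NormedAddCommGroup F] [NormedSpace ℂ F] {ν : α → F}

lemma pt_fub_int {η : ℂ → ℂ} (hη : Continuous η) (hs : HasCompactSupport η)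
    (hc : AEStronglyMeasurable c m) (hν : Integrable ν m) :
    Integrable (fun p : ℂ × α => (η p.1 * (p.1 - c p.2)⁻¹) • ν p.2) (volume.prod m) := by
  obtain ⟨C, hC⟩ := hη.bounded_above_of_compact_support hs
  obtain ⟨R, hR0, hR⟩ : ∃ R > 0, tsupport η ⊆ Metric.ball 0 R :=
    hs.isCompact.isBounded.subset_ball_lt 0 0
  have hm1 : AEStronglyMeasurable (fun p : ℂ × α => (p.1 - c p.2)⁻¹) (volume.prod m) := by
    have h1 : AEMeasurable (fun p : ℂ × α => p.1 - c p.2) (volume.prod m) := by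
      exact measurable_fst.aemeasurable.sub hc.aemeasurable.comp_snd
    exact h1.inv.aestronglyMeasurable
  have hm : AEStronglyMeasurable (fun p : ℂ × α => (η p.1 * (p.1 - c p.2)⁻¹) • ν p.2) (volume.prod m) :=
    ((hη.aestronglyMeasurable.comp_fst).mul hm1).smul hν.1.comp_snd
  refine ⟨hm, ?_⟩
  rw [hasFiniteIntegral_iff_enorm, lintegral_prod_symm _ hm.enorm]
  have hb : ∀ x, ∫⁻ z : ℂ, ‖(η z * (z - c x)⁻¹) • ν x‖ₑ ≤ ENNReal.ofReal C * ENNReal.ofReal (3 * π * R) * ‖ν x‖ₑ := by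
    intro x
    calc ∫⁻ z : ℂ, ‖(η z * (z - c x)⁻¹) • ν x‖ₑ ≤ ∫⁻ z : ℂ, (Metric.ball 0 R).indicator (fun z =>  ENNReal.ofReal C * ‖(z - c x)⁻¹‖ₑ * ‖ν x‖ₑ) z := by
          apply lintegral_mono
          intro z
          beta_reduce
          by_cases hz : z ∈ Metric.ball (0:ℂ) R
          · rw [Set.indicator_of_mem hz, enorm_smul, enorm_mul]
            gcongr
            rw [← ofReal_norm]
            exact ENNReal.ofReal_le_ofReal (hC z)
          · have : η z = 0 := by
              by_contra h
              exact hz (hR (subset_tsupport _ h))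
            simp [this]
      _ = ∫⁻ z in Metric.ball (0:ℂ) R, ENNReal.ofReal C * ‖(z - c x)⁻¹‖ₑ * ‖ν x‖ₑ :=
          lintegral_indicator Metric.isOpen_ball.measurableSet _
      _ = ENNReal.ofReal C * (∫⁻ z in Metric.ball (0:ℂ) R, ‖(z - c x)⁻¹‖ₑ) * ‖ν x‖ₑ := by
          rw [lintegral_mul_const'' _ (by fun_prop), lintegral_const_mul _ (by fun_prop)]
      _ ≤ _ := by
          gcongr
          exact pt_area hR0 0 _
  refine (lintegral_mono hb).trans_lt ?_
  rw [lintegral_const_mul' _ _ (by finiteness)]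
  have := hν.2
  rw [hasFiniteIntegral_iff_enorm] at this
  finiteness

lemma pt_fubini [CompleteSpace F] {φ : ℂ → ℂ} (hφ : ContDiff ℝ 1 φ) (hs : HasCompactSupport φ)
    (hc : AEStronglyMeasurable c m) (hν : Integrable ν m) :
    ∫ z : ℂ, dbar φ z • ∫ x, (z - c x)⁻¹ • ν x ∂m = -(π : ℂ) • ∫ x, φ (c x) • ν x ∂m := by
  have hI := pt_fub_int (pt_dbar_cont hφ) (pt_dbar_supp hs) hc hν
  have e1 : ∀ z : ℂ, dbar φ z • ∫ x, (z - c x)⁻¹ • ν x ∂m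
      = ∫ x, (dbar φ z * (z - c x)⁻¹) • ν x ∂m := by
    intro z
    rw [← integral_smul]; simp only [smul_smul]
  simp_rw [e1]
  rw [integral_integral_swap hI, ← integral_smul]
  congr 1; ext x
  rw [integral_smul_const, smul_smul]
  simp_rw [mul_comm (dbar φ _)]
  rw [pt_pompeiu hφ hs]
end fub

open scoped Real
open MeasureTheory Filter
open scoped CompactlySupported

structure IsRep (γ : ℝ → ℂ) (a : ℂ) (ω : Measure ℂ) : Prop where
  prob : IsProbabilityMeasure ω
  supp : ∀ᵐ z ∂ω, z ∈ γ '' Set.Icc 0 1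
  mom : ∀ n : ℕ, ∫ z, z ^ n ∂ω = a ^ n

lemma JDom.max_re {γ : ℝ → ℂ} {Ω : Set ℂ} (J : JDom γ Ω) {p : ℂ → ℂ} (hp : Differentiable ℂ p)
    {M : ℝ} (h : ∀ z ∈ γ '' Set.Icc 0 1, (p z).re ≤ M) {a : ℂ} (ha : a ∈ closure Ω) :
    (p a).re ≤ M := by
  have := Complex.norm_le_of_forall_mem_frontier_norm_le (f := fun z => Complex.exp (p z)) J.bd
    (hp.cexp.diffContOnCl) (C := Real.exp M) (by
      intro z hz
      rw [Complex.norm_exp, Real.exp_le_exp]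
      exact h z (J.fr ▸ hz)) ha
  rwa [Complex.norm_exp, Real.exp_le_exp] at this

lemma JDom.max_norm {γ : ℝ → ℂ} {Ω : Set ℂ} (J : JDom γ Ω) {p : ℂ → ℂ} (hp : Differentiable ℂ p)
    {M : ℝ} (h : ∀ z ∈ γ '' Set.Icc 0 1, ‖p z‖ ≤ M) {a : ℂ} (ha : a ∈ closure Ω) :
    ‖p a‖ ≤ M :=
  Complex.norm_le_of_forall_mem_frontier_norm_le J.bd hp.diffContOnCl
      (fun z hz => h z (J.fr ▸ hz)) ha

lemma JDom.exists_rep {γ : ℝ → ℂ} {Ω : Set ℂ} (J : JDom γ Ω) {a : ℂ} (ha : a ∈ closure Ω)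
    {U : ℂ → ℝ} (hU : Continuous U) : ∃ ω : Measure ℂ, IsRep γ a ω ∧
      ∀ ε > 0, ∃ p : ℂ → ℂ, Differentiable ℂ p ∧ (∀ z ∈ γ '' Set.Icc 0 1, U z ≤ (p z).re) ∧
        (p a).re ≤ ∫ z, U z ∂ω + ε := by
  set Γ := γ '' Set.Icc 0 1 with hΓ
  have : CompactSpace Γ := isCompact_iff_compactSpace.1 J.isCompact_Γ
  let S : C(Γ, ℝ) → Set ℝ := fun u =>
    {x | ∃ p : ℂ → ℂ, Differentiable ℂ p ∧ (∀ z : Γ, u z ≤ (p z).re) ∧ (p a).re = x}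
  let N : C(Γ, ℝ) → ℝ := fun u => sInf (S u)
  have hlow : ∀ u, ∀ x ∈ S u, -‖u‖ ≤ x := by
    rintro u x ⟨p, hp, h, rfl⟩
    have := J.max_re hp.neg (M := ‖u‖) (by
      intro z hz
      have h1 := h ⟨z, hz⟩
      have h2 := (abs_le.1 (u.norm_coe_le_norm ⟨z, hz⟩)).1
      simp only [Pi.neg_apply, Complex.neg_re]; linarith) ha
    simp only [Pi.neg_apply, Complex.neg_re] at this
    linarith
  have hbdd : ∀ u, BddBelow (S u) := fun u => ⟨-‖u‖, fun x hx => hlow u x hx⟩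
  have hne : ∀ u, (S u).Nonempty := fun u => ⟨‖u‖, fun _ => (‖u‖ : ℂ), by fun_prop, fun z => by
    simpa using (abs_le.1 (u.norm_coe_le_norm z)).2, by simp⟩
  have hNle : ∀ u (p : ℂ → ℂ), Differentiable ℂ p → (∀ z : Γ, u z ≤ (p z).re) → N u ≤ (p a).re :=
    fun u p hp h => csInf_le (hbdd u) ⟨p, hp, h, rfl⟩
  have hNlt : ∀ u, ∀ ε > 0, ∃ p : ℂ → ℂ, Differentiable ℂ p ∧ (∀ z : Γ, u z ≤ (p z).re) ∧ (p a).re < N u + ε := by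
    intro u ε hε
    obtain ⟨x, ⟨p, hp, h, rfl⟩, hx⟩ := exists_lt_of_csInf_lt (hne u) (lt_add_of_pos_right (N u) hε)
    exact ⟨p, hp, h, hx⟩
  have hhomle : ∀ c : ℝ, 0 < c → ∀ x, N (c • x) ≤ c * N x := by
    intro c hc x
    refine le_of_forall_pos_le_add fun ε hε => ?_
    obtain ⟨p, hp, h, hx⟩ := hNlt x (ε / c) (by positivity)
    have := hNle (c • x) (fun z => (c : ℂ) * p z) (by fun_prop) (fun z => by
      simp only [ContinuousMap.smul_apply, smul_eq_mul, Complex.re_ofReal_mul]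
      exact mul_le_mul_of_nonneg_left (h z) hc.le)
    rw [Complex.re_ofReal_mul] at this
    calc _ ≤ _ := this
      _ ≤ c * (N x + ε / c) := by gcongr
      _ = _ := by field_simp
  have hhom : ∀ c : ℝ, 0 < c → ∀ x, N (c • x) = c * N x := by
    intro c hc x
    refine le_antisymm (hhomle c hc x) ?_
    have := hhomle c⁻¹ (by positivity) (c • x)
    rw [smul_smul, inv_mul_cancel₀ hc.ne', one_smul] at this
    calc c * N x ≤ c * (c⁻¹ * N (c • x)) := by gcongr
      _ = _ := by field_simp
  have hadd : ∀ x y, N (x + y) ≤ N x + N y := by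
    intro x y
    refine le_of_forall_pos_le_add fun ε hε => ?_
    obtain ⟨p, hp, h, hx⟩ := hNlt x (ε / 2) (by positivity)
    obtain ⟨q, hq, h', hy⟩ := hNlt y (ε / 2) (by positivity)
    have := hNle (x + y) (fun z => p z + q z) (by fun_prop) (fun z => by
      simpa using add_le_add (h z) (h' z))
    rw [Complex.add_re] at this
    linarith
  have hN0 : N 0 = 0 := by
    have := hhom 2 (by norm_num) 0
    rw [smul_zero] at this; linarith
  let u0 : C(Γ, ℝ) := ⟨fun z => U z, by fun_prop⟩
  have hg : ∃ g : C(Γ, ℝ) →ₗ[ℝ] ℝ, g u0 = N u0 ∧ ∀ x, g x ≤ N x := by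
    have hH : ∀ c : ℝ, c • u0 = 0 → (RingHom.id ℝ c) • N u0 = 0 := by
      intro c hc
      rcases smul_eq_zero.1 hc with h | h
      · simp [h]
      · rw [h, hN0, smul_zero]
    obtain ⟨g, h1, h2⟩ := exists_extension_of_le_sublinear
      (LinearPMap.mkSpanSingleton' u0 (N u0) hH) N hhom hadd (by
        rintro ⟨x, hx⟩
        obtain ⟨c, rfl⟩ := Submodule.mem_span_singleton.1 hx
        rw [LinearPMap.mkSpanSingleton'_apply]
        simp only [RingHom.id_apply, smul_eq_mul]
        rcases lt_trichotomy c 0 with hc | hc | hc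
        · have h3 := hadd (c • u0) ((-c) • u0)
          rw [← add_smul, add_neg_cancel, zero_smul, hN0, hhom (-c) (by linarith)] at h3
          linarith
        · simp [hc, hN0]
        · rw [hhom c hc])
    refine ⟨g, ?_, h2⟩
    rw [h1 ⟨u0, Submodule.mem_span_singleton_self u0⟩]
    exact LinearPMap.mkSpanSingleton'_apply_self u0 (N u0) hH _
  obtain ⟨g, hg0, hgN⟩ := hg
  have hgpos : ∀ u : C(Γ, ℝ), 0 ≤ u → 0 ≤ g u := by
    intro u hu
    have h1 := hgN (-u)
    have h2 := hNle (-u) (fun _ => 0) (by fun_prop) (fun z => by simpa using hu z)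
    rw [map_neg] at h1
    simp only [Complex.zero_re] at h2
    linarith
  have hgp : ∀ (u : C(Γ, ℝ)) (p : ℂ → ℂ), Differentiable ℂ p → (∀ z : Γ, u z = (p z).re) → g u = (p a).re := by
    intro u p hp h
    have h1 := (hgN u).trans (hNle u p hp (fun z => (h z).le))
    have h2 := (hgN (-u)).trans (hNle (-u) (fun z => - p z) hp.neg (fun z => by simp [h z]))
    rw [map_neg, Complex.neg_re] at h2
    linarith
  let toC : C_c(Γ, ℝ) →ₗ[ℝ] C(Γ, ℝ) :=
    { toFun := fun f => f.toContinuousMap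
      map_add' := fun _ _ => rfl
      map_smul' := fun _ _ => rfl }
  let Λ : C_c(Γ, ℝ) →ₚ[ℝ] ℝ := PositiveLinearMap.mk₀ (g ∘ₗ toC) (by
    intro f hf
    exact hgpos _ (fun z => hf z))
  set μ := RealRMK.rieszMeasure Λ with hμ
  have hint : ∀ u : C(Γ, ℝ), ∫ z, u z ∂μ = g u := by
    intro u
    exact RealRMK.integral_rieszMeasure Λ (CompactlySupportedContinuousMap.continuousMapEquiv u)
  have hfin : IsFiniteMeasure μ := by
    infer_instance
  have hone : ∫ z : Γ, (1:ℝ) ∂μ = 1 := by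
    have := hint 1
    simp only [ContinuousMap.one_apply] at this
    rw [this, hgp 1 (fun _ => 1) (by fun_prop) (fun z => by simp)]
    simp
  have hprob : IsProbabilityMeasure μ := by
    rw [integral_const, smul_eq_mul, mul_one] at hone
    constructor
    rw [Measure.real] at hone
    rw [← ENNReal.toReal_eq_one_iff]; exact hone
  have hre : ∀ p : ℂ → ℂ, Differentiable ℂ p → ∫ z : Γ, (p z).re ∂μ = (p a).re := by
    intro p hp
    have hpc := hp.continuous
    have := hint ⟨fun z => (p z).re, by fun_prop⟩
    rw [hgp _ p hp (fun z => rfl)] at this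
    exact this
  have hvm : AEMeasurable (Subtype.val : Γ → ℂ) μ := by fun_prop
  refine ⟨μ.map Subtype.val, ⟨Measure.isProbabilityMeasure_map hvm, ?_, ?_⟩, ?_⟩
  · exact (ae_map_iff hvm J.isCompact_Γ.isClosed.measurableSet).2
      (Eventually.of_forall fun z => z.2)
  · intro n
    rw [integral_map hvm (by fun_prop)]
    have hi : Integrable (fun z : Γ => (z:ℂ) ^ n) μ := by
      have : Continuous fun z : Γ => (z:ℂ) ^ n := by fun_prop
      exact this.integrable_of_hasCompactSupport (HasCompactSupport.of_compactSpace _)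
    have e1 := hre (fun z => z ^ n) (by fun_prop)
    have e2 := hre (fun z => -Complex.I * z ^ n) (by fun_prop)
    apply Complex.ext
    · rw [← e1]; exact (integral_re hi).symm
    · have : ∀ z : ℂ, (-Complex.I * z).re = z.im := by simp
      simp only [this] at e2
      rw [← e2]; exact (integral_im hi).symm
  · intro ε hε
    obtain ⟨p, hp, h, hx⟩ := hNlt u0 ε hε
    refine ⟨p, hp, fun z hz => h ⟨z, hz⟩, ?_⟩
    rw [integral_map hvm (by fun_prop)]
    have := hint u0
    rw [hg0] at this
    exact (hx.le).trans (by rw [← this]; exact le_rfl)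

open scoped Real
open MeasureTheory Filter

noncomputable def reMul : ℂ →L[ℝ] (ℂ →L[ℝ] ℝ) :=
  -((ContinuousLinearMap.compL ℝ ℂ ℂ ℝ Complex.reCLM).comp (ContinuousLinearMap.mul ℝ ℂ))

lemma reMul_apply (c h : ℂ) : reMul c h = -(c * h).re := by simp [reMul]

lemma reMul_norm (c : ℂ) : ‖reMul c‖ ≤ ‖c‖ := by
  refine ContinuousLinearMap.opNorm_le_bound _ (norm_nonneg _) fun h => ?_
  rw [reMul_apply, norm_neg, ← norm_mul]
  exact Complex.abs_re_le_norm _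

lemma pt_log_fderiv {z w : ℂ} (h : z ≠ w) :
    HasFDerivAt (fun w => Real.log ‖z - w‖) (reMul (z - w)⁻¹) w := by
  have h0 : z - w ≠ 0 := sub_ne_zero.2 h
  have e : (fun w => Real.log ‖z - w‖) = fun w => 2⁻¹ * Real.log (‖z - w‖ ^ 2) := by
    ext w; rw [Real.log_pow]; push_cast; ring
  rw [e]
  have h1 : HasFDerivAt (fun w : ℂ => z - w) (-(ContinuousLinearMap.id ℝ ℂ)) w :=
    (hasFDerivAt_id w).const_sub z
  have h2 := ((h1.norm_sq).log (by positivity)).const_mul (2⁻¹ : ℝ)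
  refine h2.congr_fderiv ?_
  ext x
  simp only [smul_apply, ContinuousLinearMap.comp_apply, reMul_apply,
    neg_apply, ContinuousLinearMap.id_apply, smul_eq_mul, innerSL_apply_apply, Complex.inner,
    nsmul_eq_mul]
  rw [Complex.inv_def, ← Complex.normSq_eq_norm_sq]
  simp [Complex.mul_re]
  ring

lemma pt_logpot_deriv {ω : Measure ℂ} [IsFiniteMeasure ω] {K : Set ℂ} (hK : IsCompact K)
    (hωK : ∀ᵐ z ∂ω, z ∈ K) {w : ℂ} (hw : w ∉ K) :
    HasFDerivAt (fun w => ∫ z, Real.log ‖z - w‖ ∂ω) (reMul (∫ z, (z - w)⁻¹ ∂ω)) w := by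
  obtain ⟨δ, hδ, h⟩ := pt_inv_bound hK.isClosed hw
  have hne : ∀ z ∈ K, ∀ w' ∈ Metric.ball w δ, z ≠ w' := by
    rintro z hz w' hw' rfl
    have := h z hz z hw'
    simp at this; linarith
  have hi : Integrable (fun z => (z - w)⁻¹) ω := by
    have := pt_inv_integrable (c := id) (m := ω) (ν := fun _ => (1:ℂ)) aestronglyMeasurable_id (integrable_const _)
      hK.isClosed hωK hw
    simpa using this
  rw [← reMul.integral_comp_comm hi]
  refine hasFDerivAt_integral_of_dominated_of_fderiv_le (𝕜 := ℝ) (μ := ω)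
    (F := fun w z => Real.log ‖z - w‖) (F' := fun w z => reMul (z - w)⁻¹)
    (s := Metric.ball w δ) (bound := fun _ => δ⁻¹) (Metric.ball_mem_nhds _ hδ)
    (Eventually.of_forall fun w' => ?_) ?_ ?_ ?_ (integrable_const _) ?_
  · exact (Measurable.aestronglyMeasurable (by fun_prop))
  · have hc : ContinuousOn (fun z => Real.log ‖z - w‖) K := by
      refine ContinuousOn.log (by fun_prop) ?_
      intro z hz
      rw [norm_ne_zero_iff, sub_ne_zero]
      exact hne z hz w (Metric.mem_ball_self hδ)
    obtain ⟨C, hC⟩ := hK.exists_bound_of_continuousOn hc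
    refine Integrable.of_bound (Measurable.aestronglyMeasurable (by fun_prop)) C ?_
    filter_upwards [hωK] with z hz using hC z hz
  · exact reMul.continuous.comp_aestronglyMeasurable hi.1
  · filter_upwards [hωK] with z hz w' hw'
    refine (reMul_norm _).trans ?_
    rw [norm_inv]
    exact inv_anti₀ hδ (h z hz w' hw')
  · filter_upwards [hωK] with z hz w' hw'
    exact pt_log_fderiv (hne z hz w' hw')

section rep
variable {γ : ℝ → ℂ} {Ω : Set ℂ} {a : ℂ} {ω : Measure ℂ}

lemma pt_rep_cauchy (J : JDom γ Ω) (ha : a ∈ Ω) (hω : IsRep γ a ω) {w : ℂ} (hw : w ∉ closure Ω) :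
    ∫ z, (z - w)⁻¹ ∂ω = (a - w)⁻¹ := by
  have := hω.prob
  obtain ⟨R, hR⟩ := J.isCompact_Γ.isBounded.exists_norm_le
  have hpi : ∀ n : ℕ, Integrable (fun z : ℂ => z ^ n) ω := fun n => by
    refine Integrable.of_bound (by fun_prop) (R ^ n) ?_
    filter_upwards [hω.supp] with z hz
    rw [norm_pow]; gcongr; exact hR _ hz
  have h1 : Integrable (fun z : ℂ => z - a) ω := by
    have := (hpi 1).sub (integrable_const a)
    simp only [pow_one] at this
    exact this
  have h := pt_cauchy_ext J (c := id) (g := fun z => z - a) aestronglyMeasurable_id h1 hω.supp (by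
    intro n
    have : ∀ z : ℂ, id z ^ n * (z - a) = z ^ (n+1) - z ^ n * a := by intro z; simp only [id]; ring
    simp_rw [this]
    rw [integral_sub (hpi _) ((hpi _).mul_const _), integral_mul_const, hω.mom, hω.mom]
    ring) hw
  have hwK : w ∉ γ '' Set.Icc 0 1 := fun h => hw (J.Γ_sub h)
  have hi : Integrable (fun z => (z - w)⁻¹) ω := by
    have := pt_inv_integrable (c := id) (m := ω) (ν := fun _ => (1:ℂ)) aestronglyMeasurable_id (integrable_const _)
      J.isCompact_Γ.isClosed hω.supp hwK
    simpa using this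
  have h2 : ∫ z, (id z - w)⁻¹ * (z - a) ∂ω = ∫ z, (1 + (w - a) * (z - w)⁻¹) ∂ω := by
    refine integral_congr_ae ?_
    filter_upwards [hω.supp] with z hz
    have : z - w ≠ 0 := sub_ne_zero.2 (by rintro rfl; exact hwK hz)
    simp only [id]
    field_simp; ring
  rw [h2, integral_add (integrable_const _) (hi.const_mul _), integral_const_mul] at h
  simp only [integral_const, probReal_univ, one_smul] at h
  have haw : a - w ≠ 0 := sub_ne_zero.2 (by rintro rfl; exact hw (subset_closure ha))
  refine eq_inv_of_mul_eq_one_left ?_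
  linear_combination -h

lemma pt_C1 (J : JDom γ Ω) (ha : a ∈ Ω) (hω : IsRep γ a ω) {w : ℂ} (hw : w ∉ closure Ω) :
    ∫ z, Real.log ‖z - w‖ ∂ω = Real.log ‖a - w‖ := by
  have := hω.prob
  set V : ℂ → ℝ := fun w => ∫ z, Real.log ‖z - w‖ ∂ω - Real.log ‖a - w‖ with hV
  have hne : ∀ w, w ∉ closure Ω → a ≠ w := by rintro w hw rfl; exact hw (subset_closure ha)
  have hd : ∀ w, w ∉ closure Ω → HasFDerivAt V (0 : ℂ →L[ℝ] ℝ) w := by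
    intro w hw
    have h1 := pt_logpot_deriv J.isCompact_Γ hω.supp (fun h => hw (J.Γ_sub h))
    rw [pt_rep_cauchy J ha hω hw] at h1
    have h2 := h1.sub (pt_log_fderiv (hne w hw))
    rw [sub_self] at h2
    exact h2
  set S := connectedComponentIn (closure Ω)ᶜ w with hS
  have hSo : IsOpen S := isClosed_closure.isOpen_compl.connectedComponentIn
  have hSsub : S ⊆ (closure Ω)ᶜ := connectedComponentIn_subset _ _
  have hconst : ∀ w' ∈ S, V w' = V w := by
    intro w' hw'
    have hpc : IsPreconnected S := isPreconnected_connectedComponentIn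
    refine hSo.is_const_of_fderiv_eq_zero (𝕜 := ℝ) hpc ?_ ?_ hw' (mem_connectedComponentIn hw)
    · intro x hx; exact (hd x (hSsub hx)).differentiableAt.differentiableWithinAt
    · intro x hx; exact (hd x (hSsub hx)).fderiv
  have hlim : ∀ ε > 0, |V w| ≤ ε := by
    intro ε hε
    obtain ⟨R, hR⟩ := J.isCompact_cl.isBounded.exists_norm_le
    have hR0 : 0 ≤ R := (norm_nonneg _).trans (hR a (subset_closure ha))
    -- choose far point
    set M := 3 * R + 4 * R / ε + 1 with hM
    have : ∃ w' ∈ S, M < ‖w'‖ := by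
      by_contra hcon
      push Not at hcon
      exact J.unbdd hw (isBounded_iff_forall_norm_le.2 ⟨M, hcon⟩)
    obtain ⟨w', hw', hlt⟩ := this
    rw [← hconst w' hw']
    have hw'E := hSsub hw'
    have hRε : 0 ≤ 4 * R / ε := by positivity
    have hb : ∀ z ∈ closure Ω, ∀ y ∈ closure Ω, Real.log ‖z - w'‖ - Real.log ‖y - w'‖ ≤ ε := by
      intro z hz y hy
      have hz1 : 0 < ‖z - w'‖ := norm_pos_iff.2 (sub_ne_zero.2 (by rintro rfl; exact hw'E hz))
      have hy1 : 0 < ‖y - w'‖ := norm_pos_iff.2 (sub_ne_zero.2 (by rintro rfl; exact hw'E hy))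
      rw [← Real.log_div hz1.ne' hy1.ne']
      refine (Real.log_le_sub_one_of_pos (by positivity)).trans ?_
      rw [sub_le_iff_le_add, div_le_iff₀ hy1]
      have h1 : ‖z - w'‖ ≤ ‖y - w'‖ + 2 * R := by
        calc ‖z - w'‖ = ‖(y - w') + (z - y)‖ := by congr 1; ring
          _ ≤ ‖y - w'‖ + ‖z - y‖ := norm_add_le _ _
          _ ≤ ‖y - w'‖ + (‖z‖ + ‖y‖) := by gcongr; exact norm_sub_le _ _
          _ ≤ _ := by linarith [hR z hz, hR y hy]
      have h2 : 2 * R / ε ≤ ‖y - w'‖ := by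
        have : ‖w'‖ - ‖y‖ ≤ ‖y - w'‖ := by rw [norm_sub_rev]; exact norm_sub_norm_le _ _
        have h3 := hR y hy
        have : 2 * R / ε * 2 = 4 * R / ε := by ring
        have : 0 ≤ 2 * R / ε := by positivity
        linarith
      rw [div_le_iff₀ hε] at h2
      linarith
    have hcst : Real.log ‖a - w'‖ = ∫ z, Real.log ‖a - w'‖ ∂ω := by simp
    have hint : Integrable (fun z => Real.log ‖z - w'‖) ω := by
      refine Integrable.of_bound (C := |Real.log ‖a - w'‖| + ε) (Measurable.aestronglyMeasurable (by fun_prop)) ?_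
      filter_upwards [hω.supp] with z hz
      have h1 := hb z (J.Γ_sub hz) a (subset_closure ha)
      have h2 := hb a (subset_closure ha) z (J.Γ_sub hz)
      rw [Real.norm_eq_abs, abs_le]
      constructor <;> linarith [le_abs_self (Real.log ‖a - w'‖), neg_abs_le (Real.log ‖a - w'‖)]
    simp only [hV]
    rw [hcst, ← integral_sub hint (integrable_const _)]
    rw [← Real.norm_eq_abs]
    refine (norm_integral_le_of_norm_le_const (C := ε) ?_).trans (by simp)
    filter_upwards [hω.supp] with z hz
    have h1 := hb z (J.Γ_sub hz) a (subset_closure ha)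
    have h2 := hb a (subset_closure ha) z (J.Γ_sub hz)
    rw [Real.norm_eq_abs, abs_le]
    constructor <;> linarith
  have : V w = 0 := by
    by_contra hne
    have := hlim (|V w| / 2) (by positivity)
    have h2 : 0 < |V w| := abs_pos.2 hne
    linarith
  simp only [hV] at this
  linarith
end rep

open scoped Real
open MeasureTheory Filter

lemma pt_loglow {ρ δ : ℝ} (hρ : 0 < ρ) (hδ : 0 < δ) :
    Real.log ρ - 2 ≤ ∫ s in (0:ℝ)..1, Real.log (ρ - δ * s) := by
  rw [intervalIntegral.integral_comp_sub_mul (fun x => Real.log x) hδ.ne', integral_log, smul_eq_mul]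
  simp only [mul_one, mul_zero, sub_zero]
  rw [inv_mul_eq_div, le_div_iff₀ hδ]
  have key : -δ ≤ (ρ - δ) * (Real.log ρ - Real.log (ρ - δ)) := by
    rcases lt_trichotomy ρ δ with h | h | h
    · set u := δ - ρ with hu
      have hu0 : 0 < u := by linarith
      have e : ρ - δ = -u := by ring
      rw [e, Real.log_neg_eq_log]
      have h1 := Real.log_le_sub_one_of_pos (show 0 < ρ / u by positivity)
      rw [Real.log_div hρ.ne' hu0.ne'] at h1
      have h2 : u * (Real.log ρ - Real.log u) ≤ u * (ρ / u - 1) := by gcongr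
      have h3 : u * (ρ / u - 1) = ρ - u := by field_simp
      linarith
    · subst h; simp; exact hρ.le
    · have : 0 ≤ (ρ - δ) * (Real.log ρ - Real.log (ρ - δ)) := by
        apply mul_nonneg (by linarith)
        rw [sub_nonneg]
        exact Real.log_le_log (by linarith) (by linarith)
      linarith
  linarith

lemma JDom.circle {γ : ℝ → ℂ} {Ω : Set ℂ} (J : JDom γ Ω) {w₀ : ℂ} (hw : w₀ ∈ γ '' Set.Icc 0 1) {r : ℝ} (hr : 0 < r) :
    ∃ w, w ∉ closure Ω ∧ ‖w - w₀‖ = r := by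
  obtain ⟨e, he, hd⟩ := Metric.mem_closure_iff.1 (J.Γ_sub_ext hw) r hr
  set S := connectedComponentIn (closure Ω)ᶜ e
  have hpc : IsPreconnected S := isPreconnected_connectedComponentIn
  have hub := J.unbdd he
  have : ∃ w' ∈ S, r < ‖w' - w₀‖ := by
    by_contra hcon
    push Not at hcon
    refine hub (isBounded_iff_forall_norm_le.2 ⟨r + ‖w₀‖, fun x hx => ?_⟩)
    have h1 := hcon x hx
    have h2 := norm_sub_norm_le x w₀
    linarith
  obtain ⟨w', hw', h'⟩ := this
  have := hpc.intermediate_value (mem_connectedComponentIn he) hw' (f := fun w => ‖w - w₀‖) (by fun_prop)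
  obtain ⟨w, hwS, hwr⟩ := this ⟨by rw [← dist_eq_norm, dist_comm]; exact hd.le, h'.le⟩
  exact ⟨w, connectedComponentIn_subset _ _ hwS, hwr⟩

lemma JDom.select {γ : ℝ → ℂ} {Ω : Set ℂ} (J : JDom γ Ω) {w₀ : ℂ} (hw : w₀ ∈ γ '' Set.Icc 0 1) :
    ∃ W : ℝ → ℂ, Measurable W ∧ ∀ r > 0, W r ∉ closure Ω ∧ ‖W r - w₀‖ = r := by
  classical
  obtain ⟨θ, hθ⟩ := TopologicalSpace.exists_dense_seq ℝ
  let P : ℕ → ℝ → Prop := fun k r => r ≤ 0 ∨ w₀ + r * Complex.exp (θ k * Complex.I) ∈ (closure Ω)ᶜ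
  have hP : ∀ r, ∃ k, P k r := by
    intro r
    rcases le_or_gt r 0 with h | h
    · exact ⟨0, Or.inl h⟩
    · obtain ⟨w, hwE, hwr⟩ := J.circle hw h
      have hopen : IsOpen {t : ℝ | w₀ + r * Complex.exp (t * Complex.I) ∈ (closure Ω)ᶜ} :=
        isClosed_closure.isOpen_compl.preimage (by fun_prop)
      have hne : {t : ℝ | w₀ + r * Complex.exp (t * Complex.I) ∈ (closure Ω)ᶜ}.Nonempty := by
        refine ⟨Complex.arg (w - w₀), ?_⟩
        have := Complex.norm_mul_exp_arg_mul_I (w - w₀)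
        rw [hwr] at this
        simp only [Set.mem_ofPred_eq]
        rw [this]; simpa using hwE
      obtain ⟨k, hk⟩ := hθ.exists_mem_open hopen hne
      exact ⟨k, Or.inr hk⟩
  have hPm : ∀ k, MeasurableSet {r | P k r} := by
    intro k
    refine (measurableSet_Iic : MeasurableSet (Set.Iic (0:ℝ))).union ?_
    exact (isClosed_closure.isOpen_compl.preimage (by fun_prop : Continuous fun r : ℝ => w₀ + r * Complex.exp (θ k * Complex.I))).measurableSet
  let k : ℝ → ℕ := fun r => Nat.find (hP r)
  have hk : Measurable k := measurable_find hP hPm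
  refine ⟨fun r => w₀ + r * Complex.exp (θ (k r) * Complex.I), ?_, ?_⟩
  · have : Measurable fun r => θ (k r) := (measurable_from_nat).comp hk
    fun_prop
  · intro r hr
    have : P (k r) r := Nat.find_spec (hP r)
    refine ⟨(this.resolve_left (not_le.2 hr)), ?_⟩
    rw [add_sub_cancel_left, norm_mul, Complex.norm_exp_ofReal_mul_I, mul_one, Complex.norm_real]
    exact abs_of_pos hr

open scoped Real
open MeasureTheory Filter

section rep
variable {γ : ℝ → ℂ} {Ω : Set ℂ} {a : ℂ} {ω : Measure ℂ}

lemma pt_C1_int (J : JDom γ Ω) (hω : IsRep γ a ω) {w : ℂ} (hw : w ∉ γ '' Set.Icc 0 1) :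
    Integrable (fun z => Real.log ‖z - w‖) ω := by
  have := hω.prob
  have hc : ContinuousOn (fun z => Real.log ‖z - w‖) (γ '' Set.Icc 0 1) := by
    refine ContinuousOn.log (by fun_prop) ?_
    intro z hz
    rw [norm_ne_zero_iff, sub_ne_zero]
    rintro rfl; exact hw hz
  obtain ⟨C, hC⟩ := J.isCompact_Γ.exists_bound_of_continuousOn hc
  refine Integrable.of_bound (Measurable.aestronglyMeasurable (by fun_prop)) C ?_
  filter_upwards [hω.supp] with z hz using hC z hz

lemma pt_C2 (J : JDom γ Ω) (ha : a ∈ Ω) (hω : IsRep γ a ω) {w : ℂ} (hw : w ∈ γ '' Set.Icc 0 1) :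
    ω {w} = 0 ∧ Integrable (fun z => Real.log ‖z - w‖) ω ∧ ∫ z, Real.log ‖z - w‖ ∂ω = Real.log ‖a - w‖ := by
  have := hω.prob
  obtain ⟨W, hWm, hW⟩ := J.select hw
  obtain ⟨R, hR⟩ := J.isCompact_cl.isBounded.exists_norm_le
  have hR0 : 0 ≤ R := (norm_nonneg _).trans (hR a (subset_closure ha))
  set Γ := γ '' Set.Icc 0 1 with hΓ
  set M := Real.log (2 * R + 1) with hM
  have hM0 : 0 ≤ M := Real.log_nonneg (by linarith)
  have haw : a ≠ w := by rintro rfl; exact J.disj ha hw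
  have hne : ∀ r > 0, ∀ z ∈ Γ, z ≠ W r := by
    rintro r hr z hz rfl; exact (hW r hr).1 (J.Γ_sub hz)
  have hup : ∀ r > 0, r ≤ 1 → ∀ z ∈ closure Ω, Real.log ‖z - W r‖ ≤ M := by
    intro r hr hr1 z hz
    have h0 : 0 < ‖z - W r‖ := norm_pos_iff.2 (sub_ne_zero.2 (by rintro rfl; exact (hW r hr).1 hz))
    apply Real.log_le_log h0
    have h1 : ‖z - W r‖ ≤ ‖z - w‖ + ‖W r - w‖ := by
      calc _ = ‖(z - w) - (W r - w)‖ := by congr 1; ring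
        _ ≤ _ := norm_sub_le _ _
    have h2 := norm_sub_le z w
    rw [(hW r hr).2] at h1
    linarith [hR z hz, hR w (J.Γ_sub hw)]
  have hWlim : ∀ {ι : Type} {l : Filter ι} {r : ι → ℝ}, Tendsto r l (nhds 0) → (∀ i, 0 < r i) →
      Tendsto (fun i => W (r i)) l (nhds w) := by
    intro ι l r hr hr0
    rw [tendsto_iff_norm_sub_tendsto_zero]
    refine hr.congr fun i => ?_
    rw [(hW _ (hr0 i)).2]
  have hlogc : ∀ {z : ℂ}, z ≠ w → ContinuousAt (fun y => Real.log ‖z - y‖) w := by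
    intro z hz
    exact ContinuousAt.log (by fun_prop) (norm_ne_zero_iff.2 (sub_ne_zero.2 hz))
  set δ : ℕ → ℝ := fun n => 1 / ((n:ℝ) + 1) with hδ
  have hδ0 : ∀ n, 0 < δ n := fun n => by positivity
  have hδ1 : ∀ n, δ n ≤ 1 := fun n => by
    rw [hδ, div_le_one (by positivity)]; linarith [Nat.cast_nonneg (α := ℝ) n]
  have hδlim : Tendsto δ atTop (nhds 0) := tendsto_one_div_add_atTop_nhds_zero_nat
  -- step A
  have hA : ∫⁻ z, liminf (fun n => ENNReal.ofReal (M - Real.log ‖z - W (δ n)‖)) atTop ∂ω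
      ≤ ENNReal.ofReal (M - Real.log ‖a - w‖) := by
    refine (lintegral_liminf_le (fun n => by fun_prop)).trans ?_
    have : ∀ n, ∫⁻ z, ENNReal.ofReal (M - Real.log ‖z - W (δ n)‖) ∂ω = ENNReal.ofReal (M - Real.log ‖a - W (δ n)‖) := by
      intro n
      have hWn := (hW _ (hδ0 n)).1
      have hint := pt_C1_int J hω (w := W (δ n)) (fun h => hWn (J.Γ_sub h))
      have hI2 : Integrable (fun z => M - Real.log ‖z - W (δ n)‖) ω := (integrable_const M).sub hint
      rw [← ofReal_integral_eq_lintegral_ofReal hI2, integral_sub (integrable_const M) hint,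
        pt_C1 J ha hω hWn]
      · simp
      · filter_upwards [hω.supp] with z hz
        simpa using hup _ (hδ0 n) (hδ1 n) z (J.Γ_sub hz)
    simp_rw [this]
    apply le_of_eq
    apply Tendsto.liminf_eq
    apply ENNReal.tendsto_ofReal
    exact tendsto_const_nhds.sub ((hlogc haw).tendsto.comp (hWlim hδlim hδ0))
  have hA1 : ∀ z, z ≠ w → liminf (fun n => ENNReal.ofReal (M - Real.log ‖z - W (δ n)‖)) atTop =
      ENNReal.ofReal (M - Real.log ‖z - w‖) := by
    intro z hz
    apply Tendsto.liminf_eq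
    apply ENNReal.tendsto_ofReal
    exact tendsto_const_nhds.sub ((hlogc hz).tendsto.comp (hWlim hδlim hδ0))
  have hA2 : liminf (fun n => ENNReal.ofReal (M - Real.log ‖w - W (δ n)‖)) atTop = ⊤ := by
    apply Tendsto.liminf_eq
    apply ENNReal.tendsto_ofReal_nhds_top.2
    have : Tendsto (fun n => Real.log (δ n)) atTop atBot := by
      refine Real.tendsto_log_nhdsNE_zero.comp ?_
      exact tendsto_nhdsWithin_iff.2 ⟨hδlim, Eventually.of_forall fun n => (hδ0 n).ne'⟩
    refine (tendsto_atTop_add_const_left _ M (tendsto_neg_atBot_atTop.comp this)).congr fun n => ?_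
    rw [norm_sub_rev, (hW _ (hδ0 n)).2]; simp [sub_eq_add_neg]
  have hw0 : ω {w} = 0 := by
    by_contra hne0
    have : ∫⁻ z in {w}, liminf (fun n => ENNReal.ofReal (M - Real.log ‖z - W (δ n)‖)) atTop ∂ω = ⊤ := by
      rw [lintegral_singleton, hA2, ENNReal.top_mul hne0]
    have h2 := (setLIntegral_le_lintegral {w} _).trans hA
    rw [this] at h2
    exact absurd h2 (by simp)
  have haew : ∀ᵐ z ∂ω, z ≠ w := by
    rw [ae_iff]; simpa using hw0
  have hIw : Integrable (fun z => Real.log ‖z - w‖) ω := by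
    have h1 : Integrable (fun z => M - Real.log ‖z - w‖) ω := by
      refine ⟨Measurable.aestronglyMeasurable (by fun_prop), ?_⟩
      rw [hasFiniteIntegral_iff_ofReal]
      · rw [lintegral_congr_ae (haew.mono fun z hz => hA1 z hz)] at hA
        exact hA.trans_lt ENNReal.ofReal_lt_top
      · filter_upwards [haew, hω.supp] with z hz hzΓ
        have h3 : Tendsto (fun n => Real.log ‖z - W (δ n)‖) atTop (nhds (Real.log ‖z - w‖)) :=
          (hlogc hz).tendsto.comp (hWlim hδlim hδ0)
        have := le_of_tendsto h3 (Eventually.of_forall fun n => hup _ (hδ0 n) (hδ1 n) z (J.Γ_sub hzΓ))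
        simpa using this
    have := (integrable_const (μ := ω) M).sub h1
    refine this.congr (Eventually.of_forall fun z => ?_)
    simp
  refine ⟨hw0, hIw, ?_⟩
  -- step B
  set lam : Measure ℝ := volume.restrict (Set.Ioc 0 1) with hlam
  have hlamp : IsProbabilityMeasure lam := ⟨by simp [hlam]⟩
  have hs : ∀ᵐ s ∂lam, s ∈ Set.Ioc (0:ℝ) 1 := ae_restrict_mem measurableSet_Ioc
  have hpos : ∀ n, ∀ s ∈ Set.Ioc (0:ℝ) 1, 0 < δ n * s ∧ δ n * s ≤ 1 := by
    intro n s hs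
    exact ⟨mul_pos (hδ0 n) hs.1, by nlinarith [hδ1 n, hδ0 n, hs.1, hs.2]⟩
  have hWa : ∃ C, ∀ r > 0, r ≤ 1 → |Real.log ‖a - W r‖| ≤ C := by
    have hd : 0 < Metric.infDist a (closure Ω)ᶜ ∨ True := Or.inr trivial
    obtain ⟨η, hη, hball⟩ := Metric.isOpen_iff.1 J.op a ha
    refine ⟨|M| + |Real.log η|, fun r hr hr1 => ?_⟩
    have h1 := hup r hr hr1 a (subset_closure ha)
    have h2 : Real.log η ≤ Real.log ‖a - W r‖ := by
      apply Real.log_le_log hη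
      by_contra hcon
      push Not at hcon
      apply (hW r hr).1
      apply subset_closure
      apply hball
      rw [Metric.mem_ball, dist_comm, dist_eq_norm]; exact hcon
    rw [abs_le]
    constructor <;> linarith [le_abs_self M, neg_abs_le (Real.log η), abs_nonneg M, abs_nonneg (Real.log η)]
  obtain ⟨Ca, hCa⟩ := hWa
  have hFm : ∀ n, Measurable (fun p : ℝ × ℂ => Real.log ‖p.2 - W (δ n * p.1)‖) := by
    intro n; fun_prop
  have hFint : ∀ n, Integrable (fun p : ℝ × ℂ => Real.log ‖p.2 - W (δ n * p.1)‖) (lam.prod ω) := by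
    intro n
    rw [integrable_prod_iff (hFm n).aestronglyMeasurable]
    constructor
    · filter_upwards [hs] with s hs
      exact pt_C1_int J hω (fun h => (hW _ (hpos n s hs).1).1 (J.Γ_sub h))
    · refine Integrable.of_bound (C := 2 * M + Ca) ?_ ?_
      · exact (hFm n).aestronglyMeasurable.norm.integral_prod_right'
      · filter_upwards [hs] with s hs
        have hWn := (hW _ (hpos n s hs).1).1
        have hint := pt_C1_int J hω (w := W (δ n * s)) (fun h => hWn (J.Γ_sub h))
        rw [Real.norm_of_nonneg (by positivity)]
        calc ∫ z, ‖Real.log ‖z - W (δ n * s)‖‖ ∂ω ≤ ∫ z, (2 * M - Real.log ‖z - W (δ n * s)‖) ∂ω := by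
              refine integral_mono_ae hint.norm ((integrable_const _).sub hint) ?_
              filter_upwards [hω.supp] with z hz
              have := hup _ (hpos n s hs).1 (hpos n s hs).2 z (J.Γ_sub hz)
              rw [Real.norm_eq_abs, abs_le]
              constructor <;> linarith
          _ = 2 * M - Real.log ‖a - W (δ n * s)‖ := by
              rw [integral_sub (integrable_const _) hint, pt_C1 J ha hω hWn]; simp
          _ ≤ _ := by
              have := (abs_le.1 (hCa _ (hpos n s hs).1 (hpos n s hs).2)).1
              linarith
  set K : ℕ → ℂ → ℝ := fun n z => ∫ s, Real.log ‖z - W (δ n * s)‖ ∂lam with hK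
  have hKint : ∀ n, ∫ z, K n z ∂ω = ∫ s, Real.log ‖a - W (δ n * s)‖ ∂lam := by
    intro n
    simp only [hK]
    rw [← integral_integral_swap (hFint n)]
    refine integral_congr_ae ?_
    filter_upwards [hs] with s hs
    exact pt_C1 J ha hω (hW _ (hpos n s hs).1).1
  have hcv : ∀ {z : ℂ}, z ≠ w → ∀ s ∈ Set.Ioc (0:ℝ) 1, Tendsto (fun n => Real.log ‖z - W (δ n * s)‖) atTop (nhds (Real.log ‖z - w‖)) := by
    intro z hz s hs
    refine (hlogc hz).tendsto.comp (hWlim ?_ (fun n => (hpos n s hs).1))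
    simpa using hδlim.mul_const s
  have hlim1 : Tendsto (fun n => ∫ s, Real.log ‖a - W (δ n * s)‖ ∂lam) atTop (nhds (Real.log ‖a - w‖)) := by
    have : Real.log ‖a - w‖ = ∫ s, Real.log ‖a - w‖ ∂lam := by simp
    rw [this]
    refine tendsto_integral_of_dominated_convergence (fun _ => Ca) (fun n => Measurable.aestronglyMeasurable (by fun_prop)) (integrable_const _) ?_ ?_
    · intro n
      filter_upwards [hs] with s hs using hCa _ (hpos n s hs).1 (hpos n s hs).2
    · filter_upwards [hs] with s hs using hcv haw s hs
  have hlim2 : Tendsto (fun n => ∫ z, K n z ∂ω) atTop (nhds (∫ z, Real.log ‖z - w‖ ∂ω)) := by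
    refine tendsto_integral_of_dominated_convergence (fun z => M + 2 + |Real.log ‖z - w‖|) ?_ ((integrable_const _).add hIw.abs) ?_ ?_
    · intro n
      exact (hFm n).aestronglyMeasurable.prod_swap.integral_prod_right'
    · intro n
      filter_upwards [haew, hω.supp, (hFint n).prod_left_ae] with z hz hzΓ hint
      have hρ : 0 < ‖z - w‖ := norm_pos_iff.2 (sub_ne_zero.2 hz)
      have h1 : K n z ≤ M := by
        calc K n z ≤ ∫ s, M ∂lam := by
              refine integral_mono_ae hint (integrable_const _) ?_
              filter_upwards [hs] with s hs using hup _ (hpos n s hs).1 (hpos n s hs).2 z (J.Γ_sub hzΓ)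
          _ = M := by simp
      have h2 : Real.log ‖z - w‖ - 2 ≤ K n z := by
        refine (pt_loglow hρ (hδ0 n)).trans ?_
        rw [intervalIntegral.integral_of_le zero_le_one]
        refine integral_mono_ae ?_ hint ?_
        · have : IntervalIntegrable (fun s => Real.log (‖z - w‖ - δ n * s)) volume 0 1 := by
            have h3 := (intervalIntegral.intervalIntegrable_log' (a := ‖z - w‖) (b := ‖z - w‖ - δ n)).comp_sub_left ‖z - w‖
            have h4 := h3.comp_mul_left (c := δ n)
            have h5 := (hδ0 n).ne'
            simpa [h5] using h4
          exact (intervalIntegrable_iff_integrableOn_Ioc_of_le zero_le_one).1 this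
        · have hns : ∀ᵐ s ∂lam, s ≠ ‖z - w‖ / δ n := by
            refine ae_restrict_of_ae ?_
            rw [ae_iff]; simp
          filter_upwards [hs, hns] with s hs hns
          have hx : ‖z - w‖ - δ n * s ≠ 0 := by
            intro h
            apply hns
            rw [eq_div_iff (hδ0 n).ne']; linarith
          rw [← Real.log_abs]
          apply Real.log_le_log (abs_pos.2 hx)
          calc |‖z - w‖ - δ n * s| = |‖z - w‖ - ‖W (δ n * s) - w‖| := by rw [(hW _ (hpos n s hs).1).2]
            _ ≤ ‖(z - w) - (W (δ n * s) - w)‖ := abs_norm_sub_norm_le _ _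
            _ = _ := by congr 1; ring
      rw [Real.norm_eq_abs, abs_le]
      constructor <;> linarith [neg_abs_le (Real.log ‖z - w‖), abs_nonneg (Real.log ‖z - w‖)]
    · filter_upwards [haew] with z hz
      have hρ : 0 < ‖z - w‖ := norm_pos_iff.2 (sub_ne_zero.2 hz)
      have hl : Tendsto (fun n => Real.log (‖z - w‖ - δ n)) atTop (nhds (Real.log ‖z - w‖)) := by
        have : Tendsto (fun n => ‖z - w‖ - δ n) atTop (nhds ‖z - w‖) := by simpa using tendsto_const_nhds.sub hδlim
        exact (Real.continuousAt_log hρ.ne').tendsto.comp this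
      have hu : Tendsto (fun n => Real.log (‖z - w‖ + δ n)) atTop (nhds (Real.log ‖z - w‖)) := by
        have : Tendsto (fun n => ‖z - w‖ + δ n) atTop (nhds ‖z - w‖) := by simpa using tendsto_const_nhds.add hδlim
        exact (Real.continuousAt_log hρ.ne').tendsto.comp this
      have hsm : ∀ᶠ n in atTop, δ n < ‖z - w‖ := hδlim.eventually_lt_const hρ
      have hbnd : ∀ n, δ n < ‖z - w‖ → ∀ s ∈ Set.Ioc (0:ℝ) 1, Real.log (‖z - w‖ - δ n) ≤ Real.log ‖z - W (δ n * s)‖ ∧ Real.log ‖z - W (δ n * s)‖ ≤ Real.log (‖z - w‖ + δ n) := by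
        intro n hn s hs
        have h1 : |‖z - w‖ - ‖z - W (δ n * s)‖| ≤ δ n := by
          calc |‖z - w‖ - ‖z - W (δ n * s)‖| ≤ ‖(z - w) - (z - W (δ n * s))‖ := abs_norm_sub_norm_le _ _
            _ = ‖W (δ n * s) - w‖ := by congr 1; ring
            _ = δ n * s := (hW _ (hpos n s hs).1).2
            _ ≤ δ n := by nlinarith [hδ0 n, hs.2]
        rw [abs_le] at h1
        exact ⟨Real.log_le_log (by linarith) (by linarith), Real.log_le_log (by linarith) (by linarith)⟩
      have hKi : ∀ n, δ n < ‖z - w‖ → Integrable (fun s => Real.log ‖z - W (δ n * s)‖) lam := by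
        intro n hn
        refine Integrable.of_bound (C := |Real.log (‖z - w‖ - δ n)| + |Real.log (‖z - w‖ + δ n)|) (Measurable.aestronglyMeasurable (by fun_prop)) ?_
        filter_upwards [hs] with s hs
        have := hbnd n hn s hs
        rw [Real.norm_eq_abs, abs_le]
        constructor <;> linarith [neg_abs_le (Real.log (‖z - w‖ - δ n)), le_abs_self (Real.log (‖z - w‖ + δ n)), abs_nonneg (Real.log (‖z - w‖ - δ n)), abs_nonneg (Real.log (‖z - w‖ + δ n))]
      refine tendsto_of_tendsto_of_tendsto_of_le_of_le' hl hu ?_ ?_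
      · filter_upwards [hsm] with n hn
        calc _ = ∫ s, Real.log (‖z - w‖ - δ n) ∂lam := by simp
          _ ≤ _ := integral_mono_ae (integrable_const _) (hKi n hn) (hs.mono fun s hs => (hbnd n hn s hs).1)
      · filter_upwards [hsm] with n hn
        calc _ ≤ ∫ s, Real.log (‖z - w‖ + δ n) ∂lam := 
              integral_mono_ae (hKi n hn) (integrable_const _) (hs.mono fun s hs => (hbnd n hn s hs).2)
          _ = _ := by simp
  simp_rw [hKint] at hlim2
  exact tendsto_nhds_unique hlim2 hlim1
end rep

open scoped Real
open MeasureTheory Filter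

section rep
variable {γ : ℝ → ℂ} {Ω : Set ℂ} {a b : ℂ} {ω ω' τ : Measure ℂ}

lemma pt_C3 (J : JDom γ Ω) (ha : a ∈ Ω) (hω : IsRep γ a ω) (hb : b ∈ Ω) (hτ : IsRep γ b τ) :
    ∫ z, Real.log ‖z - b‖ ∂ω = ∫ w, Real.log ‖w - a‖ ∂τ := by
  have := hω.prob
  have := hτ.prob
  obtain ⟨R, hR⟩ := J.isCompact_cl.isBounded.exists_norm_le
  have hR0 : 0 ≤ R := (norm_nonneg _).trans (hR a (subset_closure ha))
  set M := Real.log (2 * R + 1) with hM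
  have hM0 : 0 ≤ M := Real.log_nonneg (by linarith)
  have hup : ∀ z ∈ closure Ω, ∀ w ∈ closure Ω, Real.log ‖w - z‖ ≤ M := by
    intro z hz w hw
    rcases eq_or_ne w z with h | h
    · simp [h, hM0]
    · apply Real.log_le_log (norm_pos_iff.2 (sub_ne_zero.2 h))
      linarith [norm_sub_le w z, hR z hz, hR w hw]
  have hFm : Measurable (fun p : ℂ × ℂ => Real.log ‖p.2 - p.1‖) := by fun_prop
  have hbi := pt_C1_int J hω (J.disj hb)
  have hFint : Integrable (fun p : ℂ × ℂ => Real.log ‖p.2 - p.1‖) (ω.prod τ) := by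
    rw [integrable_prod_iff hFm.aestronglyMeasurable]
    constructor
    · filter_upwards [hω.supp] with z hz using (pt_C2 J hb hτ hz).2.1
    · have hI2 : Integrable (fun z => 2 * M - Real.log ‖z - b‖) ω := (integrable_const _).sub hbi
      refine hI2.mono' hFm.aestronglyMeasurable.norm.integral_prod_right' ?_
      filter_upwards [hω.supp] with z hz
      obtain ⟨-, hint, heq⟩ := pt_C2 J hb hτ hz
      rw [Real.norm_of_nonneg (by positivity)]
      calc ∫ w, ‖Real.log ‖w - z‖‖ ∂τ ≤ ∫ w, (2 * M - Real.log ‖w - z‖) ∂τ := by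
            refine integral_mono_ae hint.norm ((integrable_const _).sub hint) ?_
            filter_upwards [hτ.supp] with w hw
            have := hup z (J.Γ_sub hz) w (J.Γ_sub hw)
            rw [Real.norm_eq_abs, abs_le]
            constructor <;> linarith
        _ = 2 * M - Real.log ‖z - b‖ := by
            rw [integral_sub (integrable_const _) hint, heq, norm_sub_rev b z]; simp
  have e1 : ∫ z, Real.log ‖z - b‖ ∂ω = ∫ z, ∫ w, Real.log ‖w - z‖ ∂τ ∂ω := by
    refine integral_congr_ae ?_
    filter_upwards [hω.supp] with z hz
    rw [(pt_C2 J hb hτ hz).2.2, norm_sub_rev]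
  have e2 : ∫ w, Real.log ‖w - a‖ ∂τ = ∫ w, ∫ z, Real.log ‖w - z‖ ∂ω ∂τ := by
    refine integral_congr_ae ?_
    filter_upwards [hτ.supp] with w hw
    simp_rw [norm_sub_rev w]
    rw [(pt_C2 J ha hω hw).2.2]
  rw [e1, e2]
  exact integral_integral_swap hFint

lemma reMul_inj {c d : ℂ} (h : reMul c = reMul d) : c = d := by
  have h1 := congrArg (fun L : ℂ →L[ℝ] ℝ => L 1) h
  have h2 := congrArg (fun L : ℂ →L[ℝ] ℝ => L Complex.I) h
  simp only [reMul_apply] at h1 h2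
  simp at h1 h2
  exact Complex.ext h1 h2

lemma pt_C4a (J : JDom γ Ω) (ha : a ∈ Ω) (hω : IsRep γ a ω) (hω' : IsRep γ a ω') {w : ℂ} (hw : w ∉ γ '' Set.Icc 0 1) :
    ∫ z, (z - w)⁻¹ ∂ω = ∫ z, (z - w)⁻¹ ∂ω' := by
  have := hω.prob
  have := hω'.prob
  by_cases hwc : w ∈ closure Ω
  · have hwΩ : w ∈ Ω := by
      rw [J.closure_eq] at hwc; exact hwc.resolve_right hw
    apply reMul_inj
    have h1 := pt_logpot_deriv J.isCompact_Γ hω.supp hw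
    have h2 := pt_logpot_deriv J.isCompact_Γ hω'.supp hw
    refine h1.unique (h2.congr_of_eventuallyEq ?_)
    filter_upwards [J.op.mem_nhds hwΩ] with b hb
    obtain ⟨τ, hτ, -⟩ := J.exists_rep (subset_closure hb) (U := fun _ => 0) continuous_const
    rw [pt_C3 J ha hω hb hτ, pt_C3 J ha hω' hb hτ]
  · rw [pt_rep_cauchy J ha hω hwc, pt_rep_cauchy J ha hω' hwc]

lemma pt_C4b (J : JDom γ Ω) (ha : a ∈ Ω) (hω : IsRep γ a ω) (hω' : IsRep γ a ω') {φ : ℂ → ℂ}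
    (hφ : ContDiff ℝ 1 φ) (hs : HasCompactSupport φ) : ∫ z, φ z ∂ω = ∫ z, φ z ∂ω' := by
  have := hω.prob
  have := hω'.prob
  have h1 := pt_fubini (m := ω) (c := id) (ν := fun _ => (1:ℂ)) hφ hs aestronglyMeasurable_id (integrable_const _)
  have h2 := pt_fubini (m := ω') (c := id) (ν := fun _ => (1:ℂ)) hφ hs aestronglyMeasurable_id (integrable_const _)
  have h3 : -(π:ℂ) • ∫ x, φ (id x) • (1:ℂ) ∂ω = -(π:ℂ) • ∫ x, φ (id x) • (1:ℂ) ∂ω' := by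
    rw [← h1, ← h2]
    refine integral_congr_ae ?_
    have : ∀ᵐ z : ℂ, z ∉ γ '' Set.Icc 0 1 := measure_eq_zero_iff_ae_notMem.1 J.vol_zero
    filter_upwards [this] with z hz
    have h4 := pt_C4a J ha hω hω' hz
    have h5 : ∀ x, (z - id x)⁻¹ • (1:ℂ) = - (x - z)⁻¹ := by
      intro x; rw [← inv_neg, neg_sub]; simp
    simp_rw [h5, integral_neg, h4]
  have hpi : -(π:ℂ) ≠ 0 := by simp [Real.pi_ne_zero]
  have h6 := smul_right_injective ℂ hpi h3
  simpa using h6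

lemma pt_C4 (J : JDom γ Ω) (ha : a ∈ Ω) (hω : IsRep γ a ω) (hω' : IsRep γ a ω') {U : ℂ → ℝ}
    (hU : Continuous U) : ∫ z, U z ∂ω = ∫ z, U z ∂ω' := by
  have := hω.prob
  have := hω'.prob
  obtain ⟨C, hC⟩ := J.isCompact_Γ.exists_bound_of_continuousOn hU.continuousOn
  have hsupp : ∀ᵐ z ∂(ω + ω'), z ∈ γ '' Set.Icc 0 1 := by
    rw [ae_add_measure_iff]; exact ⟨hω.supp, hω'.supp⟩
  have hUi : Integrable U (ω + ω') :=
    Integrable.of_bound (by fun_prop) C (hsupp.mono fun z hz => hC z hz)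
  have key : ∀ ε > 0, |∫ z, U z ∂ω - ∫ z, U z ∂ω'| ≤ ε := by
    intro ε hε
    obtain ⟨φ, hs, hφ, hd⟩ := MemLp.exist_eLpNorm_sub_le (p := 1) (by simp) le_rfl (memLp_one_iff_integrable.2 hUi) hε
    have hφi : ∀ m : Measure ℂ, IsFiniteMeasure m → Integrable φ m := fun m _ =>
      hφ.continuous.integrable_of_hasCompactSupport hs
    have e : ∫ z, φ z ∂ω = ∫ z, φ z ∂ω' := by
      have := pt_C4b J ha hω hω' (φ := fun z => (φ z : ℂ)) ?_ ?_
      · rw [integral_complex_ofReal, integral_complex_ofReal] at this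
        exact_mod_cast this
      · exact (Complex.ofRealCLM.contDiff.comp hφ).of_le (by simp)
      · exact hs.comp_left (g := Complex.ofReal) (by simp)
    have hU1 := hUi.left_of_add_measure
    have hU2 := hUi.right_of_add_measure
    have e2 : ∫ z, U z ∂ω - ∫ z, U z ∂ω' = ∫ z, (U z - φ z) ∂ω - ∫ z, (U z - φ z) ∂ω' := by
      rw [integral_sub hU1 (hφi _ inferInstance), integral_sub hU2 (hφi _ inferInstance), e]; ring
    have hdi : ∀ m : Measure ℂ, IsFiniteMeasure m → Integrable U m → Integrable (fun z => U z - φ z) m := fun m _ h => h.sub (hφi m inferInstance)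
    rw [e2]
    have h7 : ∫ z, ‖U z - φ z‖ ∂(ω + ω') ≤ ε := by
      have h8 : eLpNorm (fun z => U z - φ z) 1 (ω + ω') ≤ ENNReal.ofReal ε := hd
      rw [eLpNorm_one_eq_lintegral_enorm] at h8
      rw [integral_norm_eq_lintegral_enorm (hdi _ inferInstance hUi).1]
      exact ENNReal.toReal_le_of_le_ofReal hε.le h8
    rw [integral_add_measure (hdi _ inferInstance hU1).norm (hdi _ inferInstance hU2).norm] at h7
    calc _ ≤ |∫ z, (U z - φ z) ∂ω| + |∫ z, (U z - φ z) ∂ω'| := abs_sub _ _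
      _ ≤ ∫ z, ‖U z - φ z‖ ∂ω + ∫ z, ‖U z - φ z‖ ∂ω' := 
        add_le_add (by rw [← Real.norm_eq_abs]; exact norm_integral_le_integral_norm _) (by rw [← Real.norm_eq_abs]; exact norm_integral_le_integral_norm _)
      _ ≤ ε := h7
  by_contra hne
  have h0 : 0 < |∫ z, U z ∂ω - ∫ z, U z ∂ω'| := abs_pos.2 (sub_ne_zero.2 hne)
  have := key _ (half_pos h0)
  linarith

lemma pt_dirichlet (J : JDom γ Ω) (ha : a ∈ Ω) (hω : IsRep γ a ω) {U : ℂ → ℝ}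
    (hU : Continuous U) {ε : ℝ} (hε : 0 < ε) :
    ∃ p : ℂ → ℂ, Differentiable ℂ p ∧ (∀ z ∈ γ '' Set.Icc 0 1, (p z).re ≤ U z) ∧
        ∫ z, U z ∂ω - ε ≤ (p a).re ∧ (p a).im = 0 := by
  obtain ⟨ω', hω', h⟩ := J.exists_rep (subset_closure ha) (U := fun z => - U z) hU.neg
  obtain ⟨p, hp, h1, h2⟩ := h ε hε
  rw [integral_neg, ← pt_C4 J ha hω hω' hU] at h2
  refine ⟨fun z => - p z + Complex.I * (p a).im, by fun_prop, ?_, ?_, ?_⟩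
  · intro z hz
    have := h1 z hz
    simp; linarith
  · simp; linarith
  · simp
end rep

open scoped Real
open MeasureTheory Filter

section mult
variable {α : Type*} [MeasurableSpace α] {m : Measure α} {c g : α → ℂ} {γ : ℝ → ℂ} {Ω : Set ℂ} {a : ℂ}

noncomputable def ellN (d : ℂ → ℝ) (N : ℕ) (w : ℂ) : ℝ := -Real.log (max (d w) (Real.exp (-N)))

lemma ellN_cont {d : ℂ → ℝ} (hd : Continuous d) (N : ℕ) : Continuous (ellN d N) := by
  refine Continuous.neg (Continuous.log (by fun_prop) fun w => ?_)
  exact (lt_max_of_lt_right (Real.exp_pos _)).ne'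

lemma ellN_exp (d : ℂ → ℝ) (N : ℕ) (w : ℂ) : Real.exp (-ellN d N w) = max (d w) (Real.exp (-N)) := by
  rw [ellN, neg_neg, Real.exp_log (lt_max_of_lt_right (Real.exp_pos _))]

lemma ellN_mono (d : ℂ → ℝ) {n N : ℕ} (h : n ≤ N) (w : ℂ) : ellN d n w ≤ ellN d N w := by
  unfold ellN
  refine neg_le_neg (Real.log_le_log (lt_max_of_lt_right (Real.exp_pos _)) ?_)
  refine max_le_max le_rfl (Real.exp_le_exp.2 ?_)
  have : (n:ℝ) ≤ N := by exact_mod_cast h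
  linarith

lemma pt_mult (J : JDom γ Ω) (hc : AEStronglyMeasurable c m) (hg : Integrable g m)
    (hcΓ : ∀ᵐ x ∂m, c x ∈ γ '' Set.Icc 0 1) (hmom : ∀ n : ℕ, ∫ x, c x ^ n * g x ∂m = 0)
    {d : ℂ → ℝ} (hd : Continuous d) (hd0 : ∀ w, 0 ≤ d w) {v : α → ℝ} (hv : Integrable v m)
    (hgv : ∀ᵐ x ∂m, ‖g x‖ ≤ d (c x) * v x) (hv0 : ∀ᵐ x ∂m, 0 ≤ v x) (ha : a ∈ Ω)
    (hma : ∫ x, (c x - a)⁻¹ * g x ∂m ≠ 0) {δ : ℝ} (hδ : 0 < δ) :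
    ∃ C > 0, ∀ η > 0, ∃ f : ℂ → ℂ, Differentiable ℂ f ∧ (∀ z ∈ γ '' Set.Icc 0 1, ‖f z‖ ≤ 1) ∧
      (∀ z ∈ γ '' Set.Icc 0 1, ‖f z‖ ≤ C * (d z + η)) ∧ ‖f a - 1‖ ≤ δ := by
  obtain ⟨ω, hω, -⟩ := J.exists_rep (subset_closure ha) (U := fun _ => 0) continuous_const
  have := hω.prob
  have hK : IsClosed (γ '' Set.Icc 0 1) := J.isCompact_Γ.isClosed
  have haK := J.disj ha
  obtain ⟨R, hR⟩ := J.isCompact_Γ.isBounded.exists_norm_le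
  have hR' : ∀ᵐ x ∂m, ‖c x‖ ≤ R := hcΓ.mono fun x hx => hR _ hx
  have hint : ∀ N, Integrable (ellN d N) ω := by
    intro N
    obtain ⟨C, hC⟩ := J.isCompact_Γ.exists_bound_of_continuousOn (ellN_cont hd N).continuousOn
    exact Integrable.of_bound (ellN_cont hd N).aestronglyMeasurable C (hω.supp.mono fun z hz => hC z hz)
  set s : ℕ → ℝ := fun N => ∫ z, ellN d N z ∂ω with hs
  set V : ℝ := ∫ x, ‖(c x - a)⁻¹ • (v x : ℂ)‖ ∂m with hV
  have hVi : Integrable (fun x => (c x - a)⁻¹ • (v x : ℂ)) m :=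
    pt_inv_integrable hc hv.ofReal hK hcΓ haK
  have hm0 : 0 < ‖∫ x, (c x - a)⁻¹ * g x ∂m‖ := norm_pos_iff.2 hma
  have hsb : ∀ N, Real.exp (s N - 1) * ‖∫ x, (c x - a)⁻¹ * g x ∂m‖ ≤ V := by
    intro N
    obtain ⟨p, hp, h1, h2, h3⟩ := pt_dirichlet J ha hω (ellN_cont hd N) one_pos
    have hf : Differentiable ℂ (fun z => Complex.exp (p z)) := hp.cexp
    have e := pt_entire_cauchy hK hcΓ hc hg hR' hmom hf haK
    calc _ ≤ ‖Complex.exp (p a)‖ * ‖∫ x, (c x - a)⁻¹ * g x ∂m‖ := by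
          rw [Complex.norm_exp]; gcongr
      _ = ‖∫ x, (c x - a)⁻¹ * (Complex.exp (p (c x)) * g x) ∂m‖ := by rw [e, norm_mul]
      _ ≤ V := by
        refine norm_integral_le_of_norm_le hVi.norm ?_
        filter_upwards [hcΓ, hgv, hv0] with x hx hgx hvx
        rw [norm_mul, norm_smul]
        refine mul_le_mul_of_nonneg_left ?_ (norm_nonneg _)
        rw [norm_mul, Complex.norm_exp, Complex.norm_real, Real.norm_of_nonneg hvx]
        have h4 : Real.exp (p (c x)).re * d (c x) ≤ 1 := by
          calc _ ≤ Real.exp (ellN d N (c x)) * Real.exp (-ellN d N (c x)) := by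
                rw [ellN_exp]
                exact mul_le_mul (Real.exp_le_exp.2 (h1 _ hx)) (le_max_left _ _) (hd0 _) (Real.exp_pos _).le
            _ = 1 := by rw [← Real.exp_add]; simp
        calc _ ≤ Real.exp (p (c x)).re * (d (c x) * v x) := by gcongr
          _ = (Real.exp (p (c x)).re * d (c x)) * v x := by ring
          _ ≤ 1 * v x := by gcongr
          _ = v x := one_mul _
  have hbdd : BddAbove (Set.range s) := by
    refine ⟨V / ‖∫ x, (c x - a)⁻¹ * g x ∂m‖, ?_⟩
    rintro _ ⟨N, rfl⟩
    rw [le_div_iff₀ hm0]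
    refine le_trans ?_ (hsb N)
    gcongr
    have := Real.add_one_le_exp (s N - 1)
    linarith
  obtain ⟨n, hn⟩ := exists_lt_of_lt_ciSup (show (⨆ i, s i) - δ / 2 < ⨆ i, s i by linarith)
  refine ⟨Real.exp n, Real.exp_pos _, fun η hη => ?_⟩
  obtain ⟨N, hN1, hN2⟩ : ∃ N : ℕ, n ≤ N ∧ Real.exp (-N) ≤ η := by
    obtain ⟨N, hN⟩ := exists_nat_ge (-Real.log η)
    refine ⟨max n N, le_max_left _ _, ?_⟩
    rw [← Real.le_log_iff_exp_le hη]
    have : (N:ℝ) ≤ (max n N : ℕ) := by exact_mod_cast le_max_right _ _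
    linarith
  obtain ⟨q, hq, h1, h2, h3⟩ := pt_dirichlet J ha hω (U := fun z => ellN d n z - ellN d N z)
    ((ellN_cont hd n).sub (ellN_cont hd N)) (half_pos hδ)
  have hq0 : ∀ z ∈ γ '' Set.Icc 0 1, ‖Complex.exp (q z)‖ ≤ 1 := by
    intro z hz
    rw [Complex.norm_exp, Real.exp_le_one_iff]
    have := ellN_mono d hN1 z
    linarith [h1 z hz]
  refine ⟨fun z => Complex.exp (q z), hq.cexp, hq0, ?_, ?_⟩
  · intro z hz
    rw [Complex.norm_exp]
    calc _ ≤ Real.exp (ellN d n z - ellN d N z) := Real.exp_le_exp.2 (h1 z hz)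
      _ = Real.exp (ellN d n z) * max (d z) (Real.exp (-N)) := by
        rw [sub_eq_add_neg, Real.exp_add, ellN_exp]
      _ ≤ Real.exp n * (d z + η) := by
        gcongr
        · unfold ellN
          rw [neg_le, Real.le_log_iff_exp_le (lt_max_of_lt_right (Real.exp_pos _))]
          exact le_max_right _ _
        · exact max_le (by linarith) (by linarith [hd0 z])
  · have h4 := J.max_norm hq.cexp hq0 (subset_closure ha)
    rw [Complex.norm_exp] at h4
    have h5 : q a = ((q a).re : ℂ) := Complex.ext (by simp) (by simp [h3])
    show ‖Complex.exp (q a) - 1‖ ≤ δ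
    rw [h5, ← Complex.ofReal_exp, ← Complex.ofReal_one, ← Complex.ofReal_sub, Complex.norm_real,
      Real.norm_eq_abs, abs_sub_comm, abs_of_nonneg (by linarith)]
    rw [integral_sub (hint n) (hint N)] at h2
    have h6 : s N ≤ ⨆ i, s i := le_ciSup hbdd N
    have h7 := Real.add_one_le_exp (q a).re
    change s n - s N - δ / 2 ≤ _ at h2
    linarith
end mult

open scoped Real
open MeasureTheory Filter Topology

lemma pt_harn {f : ℂ → ℂ} (hf : Differentiable ℂ f) {x y : ℂ} {R : ℝ} (hR : 0 < R)
    (h1 : ∀ z ∈ Metric.ball x R, ‖f z‖ ≤ 1) (hy : y ∈ Metric.ball x (R / 2)) :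
    ‖f y - 1‖ ≤ 3 * ‖f x - 1‖ := by
  refine le_of_forall_pos_le_add fun M hM => ?_
  have hy' : ‖y - x‖ < R / 2 := by rwa [← dist_eq_norm]
  have hb := Complex.borelCaratheodory (f := fun z => f (x + z) - 1) (M := M / 2) (R := R) (z := y - x)
    (by positivity) (by fun_prop) ?_ hR (by rw [mem_ball_zero_iff]; linarith)
  · simp only [add_sub_cancel, add_zero] at hb
    have hpos : 0 < R - ‖y - x‖ := by linarith
    have e1 : 2 * (M / 2) * ‖y - x‖ / (R - ‖y - x‖) ≤ M := by
      rw [div_le_iff₀ hpos]; nlinarith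
    have e2 : ‖f x - 1‖ * (R + ‖y - x‖) / (R - ‖y - x‖) ≤ 3 * ‖f x - 1‖ := by
      rw [div_le_iff₀ hpos]; nlinarith [norm_nonneg (f x - 1)]
    linarith
  · intro z hz
    have := h1 (x + z) (by simpa using hz)
    simp only [Set.mem_ofPred_eq, Complex.sub_re, Complex.one_re]
    have := (Complex.re_le_norm (f (x + z))).trans this
    linarith

lemma pt_F {Ω : Set ℂ} (ho : IsOpen Ω) (hp : IsPreconnected Ω) {f : ℕ → ℂ → ℂ}
    (hf : ∀ j, Differentiable ℂ (f j)) (h1 : ∀ j, ∀ z ∈ Ω, ‖f j z‖ ≤ 1) {a : ℂ} (ha : a ∈ Ω)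
    (hlim : Tendsto (fun j => f j a) atTop (𝓝 1)) {b : ℂ} (hb : b ∈ Ω) :
    Tendsto (fun j => f j b) atTop (𝓝 1) := by
  set u : Set ℂ := {z | z ∈ Ω ∧ Tendsto (fun j => f j z) atTop (𝓝 1)} with hu
  have step : ∀ x y R, 0 < R → Metric.ball x R ⊆ Ω → y ∈ Metric.ball x (R / 2) →
      Tendsto (fun j => f j x) atTop (𝓝 1) → Tendsto (fun j => f j y) atTop (𝓝 1) := by
    intro x y R hR hs hy hx
    rw [tendsto_iff_norm_sub_tendsto_zero] at hx ⊢
    refine squeeze_zero (fun _ => norm_nonneg _) (fun j => pt_harn (hf j) hR (fun z hz => h1 j z (hs hz)) hy) ?_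
    simpa using hx.const_mul 3
  have : Ω ⊆ u := by
    refine hp.subset_of_closure_inter_subset ?_ ⟨a, ha, ha, hlim⟩ ?_
    · rw [Metric.isOpen_iff]
      rintro x ⟨hx, hx'⟩
      obtain ⟨R, hR, hs⟩ := Metric.isOpen_iff.1 ho x hx
      refine ⟨R / 2, half_pos hR, fun y hy => ⟨hs (Metric.ball_subset_ball (by linarith) hy), step x y R hR hs hy hx'⟩⟩
    · rintro y ⟨hy, hyΩ⟩
      obtain ⟨R, hR, hs⟩ := Metric.isOpen_iff.1 ho y hyΩ
      obtain ⟨x, ⟨hx, hx'⟩, hxy⟩ := Metric.mem_closure_iff.1 hy (R / 4) (by positivity)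
      refine ⟨hyΩ, step x y (R / 2) (by positivity) ?_ ?_ hx'⟩
      · refine subset_trans (Metric.ball_subset_ball' ?_) hs
        rw [dist_comm]; linarith
      · rw [Metric.mem_ball]; linarith
  exact (this hb).2

section weak
variable {α : Type*} [MeasurableSpace α] {m : Measure α} [SFinite m] {c g : α → ℂ} {γ : ℝ → ℂ} {Ω : Set ℂ}

lemma pt_W1 (J : JDom γ Ω) (hc : AEStronglyMeasurable c m) (hg : Integrable g m)
    (hcΓ : ∀ᵐ x ∂m, c x ∈ γ '' Set.Icc 0 1) (hmom : ∀ n : ℕ, ∫ x, c x ^ n * g x ∂m = 0)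
    {f : ℕ → ℂ → ℂ} (hf : ∀ j, Differentiable ℂ (f j)) (h1 : ∀ j, ∀ z ∈ γ '' Set.Icc 0 1, ‖f j z‖ ≤ 1)
    (hlim : ∀ b ∈ Ω, Tendsto (fun j => f j b * ∫ x, (c x - b)⁻¹ * g x ∂m) atTop
      (𝓝 (∫ x, (c x - b)⁻¹ * g x ∂m)))
    {φ : ℂ → ℂ} (hφ : ContDiff ℝ 1 φ) (hs : HasCompactSupport φ) :
    Tendsto (fun j => ∫ x, φ (c x) * (f j (c x) * g x) ∂m) atTop (𝓝 (∫ x, φ (c x) * g x ∂m)) := by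
  have hK : IsClosed (γ '' Set.Icc 0 1) := J.isCompact_Γ.isClosed
  obtain ⟨R, hR⟩ := J.isCompact_Γ.isBounded.exists_norm_le
  have hR' : ∀ᵐ x ∂m, ‖c x‖ ≤ R := hcΓ.mono fun x hx => hR _ hx
  have hfg : ∀ j, Integrable (fun x => f j (c x) * g x) m := fun j =>
    hg.bdd_mul (c := 1) ((hf j).continuous.comp_aestronglyMeasurable hc) (hcΓ.mono fun x hx => h1 j _ hx)
  have e : ∀ ν : α → ℂ, Integrable ν m → ∫ x, φ (c x) * ν x ∂m = 
      -(π:ℂ)⁻¹ * ∫ z, dbar φ z • ∫ x, (z - c x)⁻¹ • ν x ∂m := by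
    intro ν hν
    rw [pt_fubini hφ hs hc hν]
    have : (π:ℂ) ≠ 0 := by simp [Real.pi_ne_zero]
    simp only [smul_eq_mul]
    field_simp
  have ei : ∀ ν : α → ℂ, Integrable ν m → Integrable (fun z => dbar φ z • ∫ x, (z - c x)⁻¹ • ν x ∂m) := by
    intro ν hν
    have := (pt_fub_int (pt_dbar_cont hφ) (pt_dbar_supp hs) hc hν).integral_prod_left
    refine this.congr (Eventually.of_forall fun z => ?_)
    simp only [smul_eq_mul]
    rw [← integral_const_mul]
    simp only [mul_assoc]
  have hneg : ∀ (z : ℂ) (ν : α → ℂ), ∫ x, (z - c x)⁻¹ • ν x ∂m = - ∫ x, (c x - z)⁻¹ * ν x ∂m := by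
    intro z ν
    rw [← integral_neg]
    congr 1; ext x
    rw [← neg_sub (c x) z, inv_neg]; simp
  have hmul : ∀ z ∉ γ '' Set.Icc 0 1, ∀ j, ∫ x, (z - c x)⁻¹ • (f j (c x) * g x) ∂m
      = f j z * ∫ x, (z - c x)⁻¹ • g x ∂m := by
    intro z hz j
    rw [hneg, hneg, pt_entire_cauchy hK hcΓ hc hg hR' hmom (hf j) hz]
    ring
  have hext : ∀ z ∉ closure Ω, ∫ x, (z - c x)⁻¹ • g x ∂m = 0 := by
    intro z hz
    rw [hneg, pt_cauchy_ext J hc hg hcΓ hmom hz, neg_zero]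
  have hae : ∀ᵐ z : ℂ, z ∉ γ '' Set.Icc 0 1 := measure_eq_zero_iff_ae_notMem.1 J.vol_zero
  simp_rw [fun j => e _ (hfg j), e _ hg]
  refine Tendsto.const_mul _ ?_
  refine tendsto_integral_of_dominated_convergence (fun z => ‖dbar φ z • ∫ x, (z - c x)⁻¹ • g x ∂m‖)
    (fun j => (ei _ (hfg j)).1) (ei _ hg).norm ?_ ?_
  · intro j
    filter_upwards [hae] with z hz
    rw [hmul z hz j]
    by_cases hzc : z ∈ closure Ω
    · have := J.max_norm (hf j) (h1 j) hzc
      rw [norm_smul, norm_smul, norm_mul]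
      refine mul_le_mul_of_nonneg_left ?_ (norm_nonneg _)
      exact mul_le_of_le_one_left (norm_nonneg _) this
    · rw [hext z hzc]; simp
  · filter_upwards [hae] with z hz
    simp_rw [hmul z hz]
    by_cases hzc : z ∈ closure Ω
    · have hzΩ : z ∈ Ω := by
        rw [J.closure_eq] at hzc; exact hzc.resolve_right hz
      have := (hlim z hzΩ).neg
      refine Tendsto.const_smul ?_ _
      rw [hneg]
      simpa using this
    · rw [hext z hzc]; simp
end weak

open scoped Real
open MeasureTheory Filter Topology

section weak2
variable {α : Type*} [MeasurableSpace α] {m : Measure α} {c g : α → ℂ} {γ : ℝ → ℂ} {Ω : Set ℂ}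
variable {F : Type*} [NormedAddCommGroup F] [NormedSpace ℂ F]

noncomputable def pushm (m : Measure α) (c g : α → ℂ) : Measure ℂ :=
  (m.withDensity fun x => ((‖g x‖₊ : NNReal) : ENNReal)).map c

lemma pushm_fin (hg : Integrable g m) : IsFiniteMeasure (pushm m c g) := by
  have : IsFiniteMeasure (m.withDensity fun x => ((‖g x‖₊ : NNReal) : ENNReal)) :=
    isFiniteMeasure_withDensity hg.2.ne
  unfold pushm
  infer_instance

lemma pushm_aem (hc : AEStronglyMeasurable c m) (g : α → ℂ) :
    AEMeasurable c (m.withDensity fun x => ((‖g x‖₊ : NNReal) : ENNReal)) :=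
  hc.aemeasurable.mono_ac (withDensity_absolutelyContinuous _ _)

lemma pushm_int' (hc : AEStronglyMeasurable c m) (hg : Integrable g m) {ρ : ℂ → F}
    (hm : AEStronglyMeasurable ρ (pushm m c g)) :
    Integrable ρ (pushm m c g) ↔ Integrable (fun x => ‖g x‖₊ • ρ (c x)) m := by
  unfold pushm at *
  rw [integrable_map_measure hm (pushm_aem hc g),
    integrable_withDensity_iff_integrable_smul₀ hg.1.aemeasurable.nnnorm]
  rfl

lemma pushm_int (hc : AEStronglyMeasurable c m) (hg : Integrable g m) {ρ : ℂ → F}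
    (hρ : Integrable ρ (pushm m c g)) : Integrable (fun x => g x • ρ (c x)) m := by
  have h := (pushm_int' hc hg hρ.1).1 hρ
  have h2 : Integrable (fun x => (g x / ‖g x‖) • (‖g x‖₊ • ρ (c x))) m := by
    refine h.bdd_smul 1 ?_ (Eventually.of_forall fun x => ?_)
    · exact (hg.1.aemeasurable.div (Complex.measurable_ofReal.comp_aemeasurable hg.1.aemeasurable.norm)).aestronglyMeasurable
    · rw [norm_div, Complex.norm_real, norm_norm]; exact div_self_le_one _
  refine h2.congr (Eventually.of_forall fun x => ?_)
  show (g x / ‖g x‖) • ((‖g x‖₊ : ℝ) • ρ (c x)) = g x • ρ (c x)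
  rw [← Complex.coe_smul, smul_smul]
  by_cases hx : g x = 0
  · simp [hx]
  · congr 1
    have : (‖g x‖ : ℂ) ≠ 0 := by exact_mod_cast (norm_pos_iff.2 hx).ne'
    rw [coe_nnnorm]; field_simp

lemma pushm_norm (hc : AEStronglyMeasurable c m) (hg : Integrable g m) {ρ : ℂ → F}
    (hρ : Integrable ρ (pushm m c g)) : ∫ x, ‖g x • ρ (c x)‖ ∂m = ∫ z, ‖ρ z‖ ∂(pushm m c g) := by
  have hm := hρ.1.norm
  unfold pushm at hm ⊢
  rw [integral_map (pushm_aem hc g) hm, integral_withDensity_eq_integral_smul₀ hg.1.aemeasurable.nnnorm]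
  congr 1; ext x
  rw [norm_smul]; rfl

lemma pt_close (hc : AEStronglyMeasurable c m) (hg : Integrable g m) {u : ℕ → α → ℂ}
    (hum : ∀ j, AEStronglyMeasurable (u j) m) (hu : ∀ j, ∀ᵐ x ∂m, ‖u j x‖ ≤ 1)
    {ρ : ℂ → F} (hρ : Integrable ρ (pushm m c g))
    (H : ∀ ε > 0, ∃ ρ' : ℂ → F, Integrable ρ' (pushm m c g) ∧ ∫ z, ‖ρ z - ρ' z‖ ∂(pushm m c g) ≤ ε ∧
      Tendsto (fun j => ∫ x, u j x • g x • ρ' (c x) ∂m) atTop (𝓝 (∫ x, g x • ρ' (c x) ∂m))) :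
    Tendsto (fun j => ∫ x, u j x • g x • ρ (c x) ∂m) atTop (𝓝 (∫ x, g x • ρ (c x) ∂m)) := by
  rw [Metric.tendsto_atTop]
  intro ε hε
  obtain ⟨ρ', hρ', hd, hl⟩ := H (ε / 3) (by positivity)
  rw [Metric.tendsto_atTop] at hl
  obtain ⟨j0, hj⟩ := hl (ε / 3) (by positivity)
  refine ⟨j0, fun j hjj => ?_⟩
  have i1 := pushm_int hc hg hρ
  have i2 := pushm_int hc hg hρ'
  have i3 : Integrable (fun x => u j x • g x • ρ (c x)) m := i1.bdd_smul 1 (hum j) (hu j)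
  have i4 : Integrable (fun x => u j x • g x • ρ' (c x)) m := i2.bdd_smul 1 (hum j) (hu j)
  have hd' : ∫ x, ‖g x • ρ (c x) - g x • ρ' (c x)‖ ∂m ≤ ε / 3 := by
    have := pushm_norm hc hg (ρ := fun z => ρ z - ρ' z) (hρ.sub hρ')
    simp only [smul_sub] at this
    rw [this]; exact hd
  have b1 : ‖∫ x, g x • ρ (c x) ∂m - ∫ x, g x • ρ' (c x) ∂m‖ ≤ ε / 3 := by
    rw [← integral_sub i1 i2]
    exact (norm_integral_le_integral_norm _).trans hd'
  have b2 : ‖∫ x, u j x • g x • ρ (c x) ∂m - ∫ x, u j x • g x • ρ' (c x) ∂m‖ ≤ ε / 3 := by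
    rw [← integral_sub i3 i4]
    refine (norm_integral_le_of_norm_le (i1.sub i2).norm ?_).trans hd'
    filter_upwards [hu j] with x hx
    rw [← smul_sub, norm_smul]
    exact mul_le_of_le_one_left (norm_nonneg _) hx
  have b3 := hj j hjj
  rw [dist_eq_norm] at b3 ⊢
  calc _ = ‖(∫ x, u j x • g x • ρ (c x) ∂m - ∫ x, u j x • g x • ρ' (c x) ∂m)
        + (∫ x, u j x • g x • ρ' (c x) ∂m - ∫ x, g x • ρ' (c x) ∂m)
        - (∫ x, g x • ρ (c x) ∂m - ∫ x, g x • ρ' (c x) ∂m)‖ := by congr 1; abel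
    _ ≤ _ := norm_sub_le _ _
    _ ≤ _ := add_le_add_left (norm_add_le _ _) _
    _ < ε := by linarith

lemma pt_Wgen [SFinite m] [CompleteSpace F] (J : JDom γ Ω) (hc : AEStronglyMeasurable c m) (hg : Integrable g m)
    (hcΓ : ∀ᵐ x ∂m, c x ∈ γ '' Set.Icc 0 1) (hmom : ∀ n : ℕ, ∫ x, c x ^ n * g x ∂m = 0)
    {f : ℕ → ℂ → ℂ} (hf : ∀ j, Differentiable ℂ (f j)) (h1 : ∀ j, ∀ z ∈ γ '' Set.Icc 0 1, ‖f j z‖ ≤ 1)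
    (hlim : ∀ b ∈ Ω, Tendsto (fun j => f j b * ∫ x, (c x - b)⁻¹ * g x ∂m) atTop
      (𝓝 (∫ x, (c x - b)⁻¹ * g x ∂m)))
    {ρ : ℂ → F} (hρ : Integrable ρ (pushm m c g)) :
    Tendsto (fun j => ∫ x, f j (c x) • g x • ρ (c x) ∂m) atTop (𝓝 (∫ x, g x • ρ (c x) ∂m)) := by
  have := pushm_fin (c := c) hg
  have hum : ∀ j, AEStronglyMeasurable (fun x => f j (c x)) m := fun j =>
    (hf j).continuous.comp_aestronglyMeasurable hc
  have hu : ∀ j, ∀ᵐ x ∂m, ‖f j (c x)‖ ≤ 1 := fun j => hcΓ.mono fun x hx => h1 j _ hx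
  have scal : ∀ ρ : ℂ → ℂ, Integrable ρ (pushm m c g) →
      Tendsto (fun j => ∫ x, f j (c x) • g x • ρ (c x) ∂m) atTop (𝓝 (∫ x, g x • ρ (c x) ∂m)) := by
    intro ρ hρ
    refine pt_close hc hg hum hu hρ fun ε hε => ?_
    obtain ⟨φ, hs, hφ, hd⟩ := MemLp.exist_eLpNorm_sub_le (p := 1) (by simp) le_rfl (memLp_one_iff_integrable.2 hρ) hε
    have hφi : Integrable φ (pushm m c g) := hφ.continuous.integrable_of_hasCompactSupport hs
    refine ⟨φ, hφi, ?_, ?_⟩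
    · have h8 : eLpNorm (fun z => ρ z - φ z) 1 (pushm m c g) ≤ ENNReal.ofReal ε := hd
      rw [eLpNorm_one_eq_lintegral_enorm] at h8
      rw [integral_norm_eq_lintegral_enorm (f := fun z => ρ z - φ z) (hρ.sub hφi).1]
      exact ENNReal.toReal_le_of_le_ofReal hε.le h8
    · have := pt_W1 J hc hg hcΓ hmom hf h1 hlim (hφ.of_le (by simp)) hs
      have q1 : ∀ j x, f j (c x) • g x • φ (c x) = φ (c x) * (f j (c x) * g x) := fun j x => by
        simp only [smul_eq_mul]; ring
      have q2 : ∀ x, g x • φ (c x) = φ (c x) * g x := fun x => by simp only [smul_eq_mul]; ring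
      simp_rw [q1, q2]
      exact this
  refine Integrable.induction (P := fun ρ : ℂ → F => Tendsto (fun j => ∫ x, f j (c x) • g x • ρ (c x) ∂m) atTop (𝓝 (∫ x, g x • ρ (c x) ∂m))) ?_ ?_ ?_ ?_ hρ
  · intro v s hs hfin
    have hi : Integrable (s.indicator fun _ => (1:ℂ)) (pushm m c g) :=
      (integrable_const (1:ℂ)).indicator hs
    have := (scal _ hi).smul_const v
    simp_rw [← integral_smul_const] at this
    convert this using 3
    · congr 1; ext x; by_cases hx : c x ∈ s <;> simp [hx, smul_smul]
    · congr 1; ext x; by_cases hx : c x ∈ s <;> simp [hx]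
  · intro p q _ hp hq h1 h2
    have i1 := pushm_int hc hg hp
    have i2 := pushm_int hc hg hq
    have i3 : ∀ j, Integrable (fun x => f j (c x) • g x • p (c x)) m := fun j => i1.bdd_smul 1 (hum j) (hu j)
    have i4 : ∀ j, Integrable (fun x => f j (c x) • g x • q (c x)) m := fun j => i2.bdd_smul 1 (hum j) (hu j)
    have := h1.add h2
    rw [← integral_add i1 i2] at this
    simp_rw [fun j => (integral_add (i3 j) (i4 j)).symm] at this
    simpa only [Pi.add_apply, smul_add] using this
  · rw [← isSeqClosed_iff_isClosed]
    intro p q hp hq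
    refine pt_close hc hg hum hu (L1.integrable_coeFn q) fun ε hε => ?_
    obtain ⟨k, hk⟩ := ((tendsto_iff_norm_sub_tendsto_zero.1 hq).eventually (ge_mem_nhds hε)).exists
    refine ⟨p k, L1.integrable_coeFn _, ?_, hp k⟩
    rw [norm_sub_rev, L1.norm_eq_integral_norm] at hk
    refine le_trans (le_of_eq (integral_congr_ae ?_)) hk
    filter_upwards [Lp.coeFn_sub q (p k)] with z hz
    rw [hz]; rfl
  · intro p q hpq hp hP
    have hac : ∀ᵐ x ∂m, g x • p (c x) = g x • q (c x) := by
      have := ae_of_ae_map (pushm_aem hc g) hpq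
      rw [ae_withDensity_iff' hg.1.aemeasurable.nnnorm.coe_nnreal_ennreal] at this
      filter_upwards [this] with x hx
      by_cases h0 : g x = 0
      · simp [h0]
      · rw [hx (by simpa using h0)]
    have e1 : ∀ j, ∫ x, f j (c x) • g x • p (c x) ∂m = ∫ x, f j (c x) • g x • q (c x) ∂m := fun j =>
      integral_congr_ae (hac.mono fun x hx => by simp only [hx])
    have e2 := integral_congr_ae hac
    simp_rw [e1, e2] at hP
    exact hP

lemma pt_W [SFinite m] [CompleteSpace F] (J : JDom γ Ω) (hc : AEStronglyMeasurable c m) (hg : Integrable g m)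
    (hcΓ : ∀ᵐ x ∂m, c x ∈ γ '' Set.Icc 0 1) (hmom : ∀ n : ℕ, ∫ x, c x ^ n * g x ∂m = 0)
    {f : ℕ → ℂ → ℂ} (hf : ∀ j, Differentiable ℂ (f j)) (h1 : ∀ j, ∀ z ∈ γ '' Set.Icc 0 1, ‖f j z‖ ≤ 1)
    (hlim : ∀ b ∈ Ω, Tendsto (fun j => f j b * ∫ x, (c x - b)⁻¹ * g x ∂m) atTop
      (𝓝 (∫ x, (c x - b)⁻¹ * g x ∂m)))
    {ρ : ℂ → F} (hρ : StronglyMeasurable ρ) (hi : Integrable (fun x => g x • ρ (c x)) m) :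
    Tendsto (fun j => ∫ x, f j (c x) • g x • ρ (c x) ∂m) atTop (𝓝 (∫ x, g x • ρ (c x) ∂m)) := by
  refine pt_Wgen J hc hg hcΓ hmom hf h1 hlim ((pushm_int' hc hg hρ.aestronglyMeasurable).2 ?_)
  refine (integrable_norm_iff ?_).1 ?_
  · exact hg.1.nnnorm.smul (hρ.aestronglyMeasurable.comp_aemeasurable hc.aemeasurable)
  · refine hi.norm.congr (Eventually.of_forall fun x => ?_)
    show ‖g x • ρ (c x)‖ = ‖((‖g x‖₊ : ℝ) • ρ (c x))‖
    rw [norm_smul, norm_smul]; simp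
end weak2

open scoped Real
open MeasureTheory Filter Topology

lemma pt_arc_mom {L : ℝ} (hL : 0 ≤ L) {β : ℝ → ℂ} (hβ : LipschitzWith 1 β) (hcl : β 0 = β L) (n : ℕ) :
    ∫ t, β t ^ n * deriv β t ∂(volume.restrict (Set.Ioc 0 L)) = 0 := by
  set B : ℝ → ℂ := fun t => β (Set.projIcc 0 L hL t) with hB
  have hBl : LipschitzWith 1 B := by
    have := (hβ.comp (LipschitzWith.subtype_val (Set.Icc 0 L))).comp (LipschitzWith.projIcc hL)
    rw [one_mul, one_mul] at this
    exact this
  have hBm : ∀ t, B t ∈ Metric.closedBall (β 0) L := by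
    intro t
    have h1 := hβ.dist_le_mul (Set.projIcc 0 L hL t) 0
    have h2 := (Set.projIcc 0 L hL t).2
    rw [Metric.mem_closedBall]
    refine h1.trans ?_
    rw [Real.dist_eq, sub_zero, abs_of_nonneg h2.1]
    simpa using h2.2
  obtain ⟨K, hK⟩ := ContDiffOn.exists_lipschitzOnWith (n := 1) (s := Metric.closedBall (β 0) L)
    (f := fun z : ℂ => ((n:ℂ)+1)⁻¹ * z ^ (n + 1)) (by fun_prop) (by simp) (convex_closedBall _ _) (isCompact_closedBall _ _)
  have hP : LipschitzWith (K * 1) (fun t => ((n:ℂ)+1)⁻¹ * B t ^ (n + 1)) := by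
    have := hK.comp (hBl.lipschitzOnWith (s := Set.univ)) (fun t _ => hBm t)
    exact lipschitzOnWith_univ.1 this
  have h := pt_ftc hP 0 L
  have e0 : B 0 = B L := by simp [hB, hcl]
  rw [e0, sub_self, intervalIntegral.integral_of_le hL] at h
  rw [← h]
  rw [integral_Ioc_eq_integral_Ioo, integral_Ioc_eq_integral_Ioo]
  refine integral_congr_ae ?_
  filter_upwards [ae_restrict_mem measurableSet_Ioo, ae_restrict_of_ae hβ.ae_differentiableAt_real] with t ht hd
  have hev : B =ᶠ[𝓝 t] β := by
    filter_upwards [isOpen_Ioo.mem_nhds ht] with s hs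
    simp only [hB, Set.projIcc_of_mem hL (Set.Ioo_subset_Icc_self hs)]
  have hd2 : HasDerivAt B (deriv β t) t := hd.hasDerivAt.congr_of_eventuallyEq hev
  have hd3 := ((hasDerivAt_pow (n+1) (B t)).const_mul (((n:ℂ)+1)⁻¹)).comp t hd2
  have := hd3.deriv
  have hB' : B t = β t := hev.eq_of_nhds
  have hn : (n:ℂ) + 1 ≠ 0 := by exact_mod_cast Nat.succ_ne_zero n
  change deriv (fun t => ((n:ℂ)+1)⁻¹ * B t ^ (n + 1)) t = _ at this
  rw [this, hB']
  push_cast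
  field_simp

section E
variable {γ : ℝ → ℂ} {Ω : Set ℂ}

lemma pt_E0 (J : JDom γ Ω) {f : ℕ → ℂ → ℂ} (hf : ∀ j, Differentiable ℂ (f j))
    (h1 : ∀ j, ∀ z ∈ γ '' Set.Icc 0 1, ‖f j z‖ ≤ 1)
    (hlim : ∀ b ∈ Ω, Tendsto (fun j => f j b) atTop (𝓝 1)) {K : Set ℂ} (hK : IsClosed K)
    (hsmall : ∀ j : ℕ, ∀ z ∈ K, ‖f j z‖ ≤ 1 / ((j:ℝ) + 1)) {L : ℝ} {β : ℝ → ℂ} (hL : 0 ≤ L)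
    (hβ : LipschitzWith 1 β) (him : β '' Set.Icc 0 L = γ '' Set.Icc 0 1) (hcl : β 0 = β L)
    (hinj : Set.InjOn β (Set.Ico 0 L)) (hnorm : ∀ᵐ s ∂(volume.restrict (Set.Ioc 0 L)), ‖deriv β s‖ = 1) :
    volume (β ⁻¹' K ∩ Set.Ioo 0 L) = 0 := by
  set m := volume.restrict (Set.Ioc 0 L) with hm
  set S := β ⁻¹' K ∩ Set.Ioo 0 L with hS
  have hSm : MeasurableSet S := (hK.preimage hβ.continuous).measurableSet.inter measurableSet_Ioo
  have hg : Integrable (deriv β) m := by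
    refine Integrable.of_bound (aestronglyMeasurable_deriv β _) 1 (hnorm.mono fun x hx => hx.le)
  have hcΓ : ∀ᵐ x ∂m, β x ∈ γ '' Set.Icc 0 1 := by
    filter_upwards [ae_restrict_mem measurableSet_Ioc] with x hx
    rw [← him]; exact ⟨x, Set.Ioc_subset_Icc_self hx, rfl⟩
  have hIoo : ∀ᵐ x ∂m, x ∈ Set.Ioo 0 L := by
    rw [hm, ← restrict_Ioo_eq_restrict_Ioc]; exact ae_restrict_mem measurableSet_Ioo
  have key : ∀ M : Set ℝ, MeasurableSet M → ∫ x in M ∩ S, deriv β x = 0 := by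
    intro M hM
    have hMS : M ∩ S ⊆ Set.Ico 0 L := fun x hx => Set.Ioo_subset_Ico_self hx.2.2
    have hBor : MeasurableSet (β '' (M ∩ S)) :=
      (hM.inter hSm).image_of_continuousOn_injOn hβ.continuous.continuousOn (hinj.mono hMS)
    set ρ : ℂ → ℂ := (β '' (M ∩ S)).indicator fun _ => 1 with hρ
    have hρm : StronglyMeasurable ρ := stronglyMeasurable_const.indicator hBor
    have hρ1 : ∀ z, ‖ρ z‖ ≤ 1 := by
      intro z; rw [hρ]; by_cases hz : z ∈ β '' (M ∩ S) <;> simp [hz]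
    have hi : Integrable (fun x => deriv β x • ρ (β x)) m :=
      hg.smul_bdd 1 (hρm.aestronglyMeasurable.comp_aemeasurable hβ.continuous.aemeasurable) (Eventually.of_forall fun x => hρ1 _)
    have hw := pt_W J hβ.continuous.aestronglyMeasurable hg hcΓ (pt_arc_mom hL hβ hcl) hf h1
      (fun b hb => by simpa using (hlim b hb).mul_const (∫ x, (β x - b)⁻¹ * deriv β x ∂m)) hρm hi
    have hz : Tendsto (fun j => ∫ x, f j (β x) • deriv β x • ρ (β x) ∂m) atTop (𝓝 0) := by
      have ht : Tendsto (fun j : ℕ => 1 / ((j:ℝ) + 1) * ∫ x, ‖deriv β x • ρ (β x)‖ ∂m) atTop (𝓝 0) := by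
        simpa using (tendsto_one_div_add_atTop_nhds_zero_nat (𝕜 := ℝ)).mul_const (∫ x, ‖deriv β x • ρ (β x)‖ ∂m)
      refine squeeze_zero_norm (fun j => ?_) ht
      rw [← integral_const_mul]
      refine norm_integral_le_of_norm_le (hi.norm.const_mul _) (Eventually.of_forall fun x => ?_)
      rw [norm_smul]
      by_cases hx : β x ∈ β '' (M ∩ S)
      · refine mul_le_mul_of_nonneg_right (hsmall j _ ?_) (norm_nonneg _)
        obtain ⟨y, hy, hyx⟩ := hx
        rw [← hyx]; exact hy.2.1
      · simp [hρ, hx]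
    have h0 := tendsto_nhds_unique hw hz
    rw [← h0]
    have hsub : Set.Ioo 0 L ∩ (M ∩ S) = M ∩ S := Set.inter_eq_right.2 fun x hx => hx.2.2
    rw [← hsub, ← setIntegral_indicator (hM.inter hSm), ← integral_Ioc_eq_integral_Ioo]
    refine integral_congr_ae ?_
    filter_upwards [hIoo] with x hx
    by_cases hxM : x ∈ M ∩ S
    · simp [hρ, hxM, Set.mem_image_of_mem β hxM]
    · have : β x ∉ β '' (M ∩ S) := by
        rintro ⟨y, hy, hyx⟩
        exact hxM (hinj (hMS hy) (Set.Ioo_subset_Ico_self hx) hyx ▸ hy)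
      simp only [hρ, Set.indicator_of_notMem hxM, Set.indicator_of_notMem this, smul_zero]
  have hz : deriv β =ᵐ[volume.restrict S] 0 := by
    have hSI : S ⊆ Set.Ioc 0 L := fun x hx => Set.Ioo_subset_Ioc_self hx.2
    refine Integrable.ae_eq_zero_of_forall_setIntegral_eq_zero (hg.mono_measure (Measure.restrict_mono hSI le_rfl)) ?_
    intro M hM _
    rw [Measure.restrict_restrict hM]; exact key M hM
  have hn : ∀ᵐ x ∂(volume.restrict S), ‖deriv β x‖ = 1 :=
    ae_mono (Measure.restrict_mono (fun x hx => Set.Ioo_subset_Ioc_self hx.2) le_rfl) hnorm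
  have hF : ∀ᵐ x ∂(volume.restrict S), False := by
    filter_upwards [hz, hn] with x h1 h2
    rw [h1] at h2; simp at h2
  simpa [ae_iff] using hF

lemma pt_grid {S : Set ℝ} (hS : IsCompact S) (h0 : volume S = 0) {ε : ℝ} (hε : 0 < ε) :
    ∃ r > 0, ∃ t : Finset ℝ, (↑t ⊆ S) ∧ (S ⊆ ⋃ s ∈ t, Metric.ball s r) ∧ t.card * r ≤ ε := by
  classical
  obtain ⟨U, hSU, hU, hUε⟩ := Set.exists_isOpen_lt_of_lt S (ENNReal.ofReal (ε / 2)) (μ := volume) (by rw [h0]; simpa using hε)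
  obtain ⟨δ, hδ, hth⟩ := hS.exists_thickening_subset_open hU hSU
  set q : ℝ := δ / 2 with hq
  have hq0 : 0 < q := by positivity
  have hfl : ∀ s : ℝ, s ∈ Set.Ico (⌊s / q⌋ * q) ((⌊s / q⌋ + 1) * q) := by
    intro s
    constructor
    · rw [← le_div_iff₀ hq0]; exact Int.floor_le _
    · rw [← div_lt_iff₀ hq0]; exact Int.lt_floor_add_one _
  have hfin : ((fun s : ℝ => ⌊s / q⌋) '' S).Finite := by
    obtain ⟨R, hR⟩ := hS.isBounded.exists_norm_le
    refine (Set.finite_Icc ⌊-R / q⌋ ⌊R / q⌋).subset ?_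
    rintro _ ⟨s, hs, rfl⟩
    have := abs_le.1 (hR s hs)
    exact ⟨Int.floor_le_floor (by gcongr; exact this.1), Int.floor_le_floor (by gcongr; exact this.2)⟩
  set I := hfin.toFinset with hI
  have hIm : ∀ i ∈ I, ∃ s ∈ S, ⌊s / q⌋ = i := by
    intro i hi; rw [hI, Set.Finite.mem_toFinset] at hi; exact hi
  choose! x hxS hxi using hIm
  refine ⟨δ, hδ, I.image x, ?_, ?_, ?_⟩
  · intro s hs
    simp only [Finset.coe_image, Set.mem_image, Finset.mem_coe] at hs
    obtain ⟨i, hi, rfl⟩ := hs; exact hxS i hi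
  · intro s hs
    have hi : ⌊s / q⌋ ∈ I := by rw [hI, Set.Finite.mem_toFinset]; exact ⟨s, hs, rfl⟩
    simp only [Set.mem_iUnion]
    refine ⟨x ⌊s / q⌋, Finset.mem_image_of_mem _ hi, ?_⟩
    have h1 := hfl s
    have h2 := hfl (x ⌊s / q⌋)
    rw [hxi _ hi] at h2
    rw [Metric.mem_ball, Real.dist_eq, abs_lt]
    constructor <;> nlinarith [h1.1, h1.2, h2.1, h2.2]
  · have hdis : Set.PairwiseDisjoint (↑I : Set ℤ) (fun i : ℤ => Set.Ico ((i:ℝ) * q) ((i + 1) * q)) := by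
      intro i _ j _ hij
      rw [Function.onFun, Set.disjoint_left]
      intro s hs hs'
      apply hij
      have a1 : ⌊s / q⌋ = i := by
        rw [Int.floor_eq_iff, le_div_iff₀ hq0, div_lt_iff₀ hq0]; exact hs
      have a2 : ⌊s / q⌋ = j := by
        rw [Int.floor_eq_iff, le_div_iff₀ hq0, div_lt_iff₀ hq0]; exact hs'
      omega
    have hsub : (⋃ i ∈ I, Set.Ico ((i:ℝ) * q) ((i + 1) * q)) ⊆ U := by
      intro s hs
      simp only [Set.mem_iUnion] at hs
      obtain ⟨i, hi, hs⟩ := hs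
      apply hth
      rw [Metric.mem_thickening_iff]
      refine ⟨x i, hxS i hi, ?_⟩
      have h2 := hfl (x i)
      rw [hxi _ hi] at h2
      rw [Real.dist_eq, abs_lt]
      constructor <;> nlinarith [hs.1, hs.2, h2.1, h2.2]
    have hv := (measure_mono hsub).trans hUε.le
    rw [measure_biUnion_finset hdis (fun i _ => measurableSet_Ico)] at hv
    have e : ∀ i ∈ I, volume (Set.Ico ((i:ℝ) * q) ((i + 1) * q)) = ENNReal.ofReal q := by
      intro i _; rw [Real.volume_Ico]; congr 1; ring
    rw [Finset.sum_congr rfl e, Finset.sum_const, nsmul_eq_mul, ← ENNReal.ofReal_natCast,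
      ← ENNReal.ofReal_mul (by positivity), ENNReal.ofReal_le_ofReal_iff (by positivity)] at hv
    have hc : ((I.image x).card : ℝ) ≤ I.card := by exact_mod_cast Finset.card_image_le
    calc _ ≤ (I.card : ℝ) * δ := by gcongr
      _ = 2 * (I.card * q) := by rw [hq]; ring
      _ ≤ ε := by linarith

lemma pt_E (J : JDom γ Ω) {f : ℕ → ℂ → ℂ} (hf : ∀ j, Differentiable ℂ (f j))
    (h1 : ∀ j, ∀ z ∈ γ '' Set.Icc 0 1, ‖f j z‖ ≤ 1)
    (hlim : ∀ b ∈ Ω, Tendsto (fun j => f j b) atTop (𝓝 1)) {K : Set ℂ} (hK : IsClosed K)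
    (hKΓ : K ⊆ γ '' Set.Icc 0 1)
    (hsmall : ∀ j : ℕ, ∀ z ∈ K, ‖f j z‖ ≤ 1 / ((j:ℝ) + 1)) {ε : ℝ} (hε : 0 < ε) :
    ∃ r > 0, ∃ t : Finset ℂ, (↑t ⊆ K) ∧ (K ⊆ ⋃ a ∈ t, Metric.ball a r) ∧ t.card * r ≤ ε := by
  classical
  obtain ⟨L, β, hL, hβ, him, hcl, hinj, hnorm⟩ := J.arc
  have hv := pt_E0 J hf h1 hlim hK hsmall hL hβ him hcl hinj hnorm
  have hS : IsCompact (Set.Icc 0 L ∩ β ⁻¹' K) := isCompact_Icc.inter_right (hK.preimage hβ.continuous)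
  have hS0 : volume (Set.Icc 0 L ∩ β ⁻¹' K) = 0 := by
    refine measure_mono_null (t := (β ⁻¹' K ∩ Set.Ioo 0 L) ∪ {0, L}) ?_ ?_
    · rintro x ⟨hx, hxK⟩
      rcases eq_or_lt_of_le hx.1 with h | h
      · right; simp [← h]
      rcases eq_or_lt_of_le hx.2 with h' | h'
      · right; simp [h']
      · left; exact ⟨hxK, h, h'⟩
    · exact measure_union_null hv ((Set.toFinite {(0:ℝ), L}).measure_zero _)
  obtain ⟨r, hr, t, htS, hcov, hcard⟩ := pt_grid hS hS0 hε
  refine ⟨r, hr, t.image β, ?_, ?_, ?_⟩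
  · intro z hz
    simp only [Finset.coe_image, Set.mem_image, Finset.mem_coe] at hz
    obtain ⟨s, hs, rfl⟩ := hz
    exact (htS hs).2
  · intro z hz
    have := hKΓ hz
    rw [← him] at this
    obtain ⟨s, hs, rfl⟩ := this
    have h2 := hcov ⟨hs, hz⟩
    simp only [Set.mem_iUnion] at h2 ⊢
    obtain ⟨s', hs', hss⟩ := h2
    refine ⟨β s', Finset.mem_image_of_mem _ hs', ?_⟩
    rw [Metric.mem_ball] at hss ⊢
    have := hβ.dist_le_mul s s'
    simp only [NNReal.coe_one, one_mul] at this
    linarith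
  · refine le_trans ?_ hcard
    gcongr
    exact Finset.card_image_le
end E

open scoped Real
open MeasureTheory Filter Topology

section db
variable {F : Type*} [NormedAddCommGroup F] [NormedSpace ℂ F]

lemma dbar_congr {φ ψ : ℂ → F} {z : ℂ} (h : φ =ᶠ[𝓝 z] ψ) : dbar φ z = dbar ψ z := by
  unfold dbar; rw [h.fderiv_eq]

lemma dbar_const (v : F) (z : ℂ) : dbar (fun _ => v) z = 0 := by
  simp [dbar]

lemma dbar_smul {φ : ℂ → ℂ} {G : ℂ → F} {z : ℂ} (hφ : DifferentiableAt ℝ φ z) (hG : DifferentiableAt ℝ G z) :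
    dbar (fun z => φ z • G z) z = dbar φ z • G z + φ z • dbar G z := by
  unfold dbar
  have : fderiv ℝ (fun z => φ z • G z) z = _ := fderiv_fun_smul hφ hG
  rw [this]
  simp only [add_apply, smul_apply, ContinuousLinearMap.smulRight_apply,
    smul_add, add_smul, smul_smul, smul_eq_mul]
  module

lemma dbar_holo {G : ℂ → F} {z : ℂ} (hG : DifferentiableAt ℂ G z) : dbar G z = 0 := by
  unfold dbar
  rw [hG.fderiv_restrictScalars ℝ]
  simp only [ContinuousLinearMap.coe_restrictScalars']
  have : fderiv ℂ G z Complex.I = Complex.I • fderiv ℂ G z 1 := by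
    rw [← map_smul]; simp
  rw [this, smul_smul, Complex.I_mul_I]; simp

lemma dbar_comp {G : ℂ → F} (l : F →L[ℂ] ℂ) {z : ℂ} (hG : DifferentiableAt ℝ G z) :
    dbar (fun z => l (G z)) z = l (dbar G z) := by
  unfold dbar
  have h : HasFDerivAt (fun z => l (G z)) ((l.restrictScalars ℝ).comp (fderiv ℝ G z)) z :=
    (l.restrictScalars ℝ).hasFDerivAt.comp z hG.hasFDerivAt
  rw [h.fderiv]
  simp
  ring

lemma pt_int_dbar0 {φ : ℂ → ℂ} (hφ : ContDiff ℝ 1 φ) (hs : HasCompactSupport φ) : ∫ z, dbar φ z = 0 := by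
  have hi : ContDiff ℝ 1 (fun z : ℂ => z) := contDiff_id
  have h := pt_pompeiu (φ := fun z => z * φ z) (hi.mul hφ) (hs.mul_left) 0
  simp only [sub_zero, zero_mul, mul_zero] at h
  rw [← h]
  refine integral_congr_ae ?_
  have : ∀ᵐ z : ℂ, z ≠ 0 := by
    have := (Set.countable_singleton (0:ℂ)).ae_notMem volume
    filter_upwards [this] with z hz using hz
  filter_upwards [this] with z hz
  have e := dbar_smul (φ := fun z : ℂ => z) (G := φ) (z := z) differentiableAt_fun_id ((hφ.differentiable (by simp)) z)
  have e2 : dbar (fun z : ℂ => z) z = 0 := dbar_holo differentiableAt_fun_id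
  rw [e2] at e
  simp only [smul_eq_mul, zero_mul, zero_add] at e
  rw [e]; field_simp

lemma pt_int_dbar [CompleteSpace F] {φ : ℂ → F} (hφ : ContDiff ℝ 1 φ) (hs : HasCompactSupport φ)
    (hi : Integrable (dbar φ)) : ∫ z, dbar φ z = 0 := by
  refine SeparatingDual.eq_zero_of_forall_dual_eq_zero (R := ℂ) fun l => ?_
  rw [← l.integral_comp_comm hi]
  have := pt_int_dbar0 (φ := fun z => l (φ z)) ((l.restrictScalars ℝ).contDiff.comp hφ) (hs.comp_left (map_zero l))
  rw [← this]
  congr 1; ext z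
  rw [dbar_comp l ((hφ.differentiable (by simp)) z)]

lemma pt_cut : ∃ C > 0, ∀ (r : ℝ), 0 < r → ∀ t : Finset ℂ, ∃ κ : ℂ → ℂ, ContDiff ℝ 1 κ ∧ (∀ z, ‖κ z‖ ≤ 1) ∧
    (∀ a ∈ t, ∀ z ∈ Metric.ball a r, κ z = 0) ∧ (∀ z, (∀ a ∈ t, 3 * r ≤ dist z a) → κ z = 1) ∧
    ∀ z, ‖dbar κ z‖ ≤ C / r * ∑ a ∈ t, (Metric.ball a (3 * r)).indicator (fun _ => (1:ℝ)) z := by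
  classical
  let b : ContDiffBump (0:ℂ) := ⟨1, 2, one_pos, one_lt_two⟩
  have hbc : ContDiff ℝ 1 (fun z => (b z : ℂ)) := Complex.ofRealCLM.contDiff.comp b.contDiff
  have hbs : HasCompactSupport (fun z => (b z : ℂ)) := b.hasCompactSupport.comp_left (g := Complex.ofReal) (by simp)
  obtain ⟨C, hC⟩ := (hbc.continuous_fderiv (by simp)).bounded_above_of_compact_support (hbs.fderiv (𝕜 := ℝ))
  refine ⟨|C| + 1, by positivity, fun r hr t => ?_⟩
  set B : ℂ → ℂ := fun z => (b z : ℂ) with hB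
  -- single factor
  have single : ∀ a : ℂ, ∃ χ : ℂ → ℂ, ContDiff ℝ 1 χ ∧ (∀ z, ‖χ z‖ ≤ 1) ∧ (∀ z ∈ Metric.ball a r, χ z = 0) ∧
      (∀ z, 3 * r ≤ dist z a → χ z = 1) ∧
      ∀ z, ‖dbar χ z‖ ≤ (|C| + 1) / r * (Metric.ball a (3 * r)).indicator (fun _ => (1:ℝ)) z := by
    intro a
    set χ : ℂ → ℂ := fun z => 1 - B ((r⁻¹ : ℝ) • (z - a)) with hχ
    have hχc : ContDiff ℝ 1 χ := by
      have : ContDiff ℝ 1 (fun z : ℂ => (r⁻¹ : ℝ) • (z - a)) := by fun_prop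
      exact contDiff_const.sub (hbc.comp this)
    have hout : ∀ z, 2 * r ≤ dist z a → χ z = 1 := by
      intro z hz
      have : b ((r⁻¹ : ℝ) • (z - a)) = 0 := by
        apply b.zero_of_le_dist
        rw [dist_zero_right, norm_smul, norm_inv, Real.norm_of_nonneg hr.le, ← dist_eq_norm]
        show 2 ≤ _
        rw [inv_mul_eq_div, le_div_iff₀ hr]; exact hz
      show 1 - ((b ((r⁻¹ : ℝ) • (z - a)) : ℝ) : ℂ) = _
      rw [this]; simp
    refine ⟨χ, hχc, ?_, ?_, ?_, ?_⟩
    · intro z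
      have h1 := b.nonneg (x := (r⁻¹ : ℝ) • (z - a))
      have h2 := b.le_one (x := (r⁻¹ : ℝ) • (z - a))
      show ‖1 - ((b ((r⁻¹ : ℝ) • (z - a)) : ℝ) : ℂ)‖ ≤ 1
      rw [← Complex.ofReal_one, ← Complex.ofReal_sub, Complex.norm_real, Real.norm_of_nonneg (by linarith)]
      linarith
    · intro z hz
      have : b ((r⁻¹ : ℝ) • (z - a)) = 1 := by
        apply b.one_of_mem_closedBall
        rw [mem_closedBall_zero_iff, norm_smul, norm_inv, Real.norm_of_nonneg hr.le, ← dist_eq_norm]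
        show _ ≤ 1
        rw [inv_mul_eq_div, div_le_one hr]; exact (Metric.mem_ball.1 hz).le
      show 1 - ((b ((r⁻¹ : ℝ) • (z - a)) : ℝ) : ℂ) = _
      rw [this]; simp
    · intro z hz; exact hout z (by linarith)
    · intro z
      by_cases hz : z ∈ Metric.ball a (3 * r)
      · rw [Set.indicator_of_mem hz, mul_one]
        have hd : HasFDerivAt χ (-((fderiv ℝ B ((r⁻¹ : ℝ) • (z - a))).comp ((r⁻¹ : ℝ) • ContinuousLinearMap.id ℝ ℂ))) z := by
          have h1 : HasFDerivAt (fun z : ℂ => (r⁻¹ : ℝ) • (z - a)) ((r⁻¹ : ℝ) • ContinuousLinearMap.id ℝ ℂ) z :=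
            ((hasFDerivAt_id z).sub_const a).fun_const_smul (r⁻¹ : ℝ)
          exact (((hbc.differentiable (by simp)) _).hasFDerivAt.comp z h1).const_sub 1
        have hn : ∀ v : ℂ, ‖v‖ = 1 → ‖fderiv ℝ χ z v‖ ≤ |C| / r := by
          intro v hv
          rw [hd.fderiv]
          simp only [neg_apply, ContinuousLinearMap.comp_apply, smul_apply, ContinuousLinearMap.id_apply, norm_neg]
          refine (ContinuousLinearMap.le_opNorm _ _).trans ?_
          rw [norm_smul, hv, mul_one, norm_inv, Real.norm_of_nonneg hr.le, div_eq_mul_inv]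
          gcongr
          exact (hC _).trans (le_abs_self _)
        unfold dbar
        rw [norm_smul, norm_inv]
        have h3 := norm_add_le (fderiv ℝ χ z 1) (Complex.I • fderiv ℝ χ z Complex.I)
        rw [norm_smul, Complex.norm_I, one_mul] at h3
        have h4 := hn 1 (by simp)
        have h5 := hn Complex.I (by simp)
        have h6 : |C| / r ≤ (|C| + 1) / r := by gcongr; linarith
        simp only [Complex.norm_ofNat]
        linarith
      · have : dbar χ z = 0 := by
          rw [← dbar_const (1:ℂ) z]
          apply dbar_congr
          have ho : IsOpen {w : ℂ | 2 * r < dist w a} := isOpen_lt continuous_const (by fun_prop)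
          filter_upwards [ho.mem_nhds (show 2 * r < dist z a by rw [Metric.mem_ball] at hz; linarith)] with w hw
          exact hout w (le_of_lt hw)
        rw [this, Set.indicator_of_notMem hz]; simp
  induction t using Finset.induction_on with
  | empty => exact ⟨fun _ => 1, contDiff_const, by simp, by simp, by simp, fun z => by rw [dbar_const]; simp⟩
  | insert a s ha ih =>
    obtain ⟨κ, k1, k2, k3, k4, k5⟩ := ih
    obtain ⟨χ, c1, c2, c3, c4, c5⟩ := single a
    refine ⟨fun z => χ z * κ z, c1.mul k1, ?_, ?_, ?_, ?_⟩
    · intro z; rw [norm_mul]; exact mul_le_one₀ (c2 z) (norm_nonneg _) (k2 z)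
    · intro a' ha' z hz
      rcases Finset.mem_insert.1 ha' with rfl | h
      · simp [c3 z hz]
      · simp [k3 a' h z hz]
    · intro z hz
      show χ z * κ z = 1
      rw [c4 z (hz a (Finset.mem_insert_self _ _)), k4 z fun a' h => hz a' (Finset.mem_insert_of_mem h), one_mul]
    · intro z
      have e := dbar_smul (φ := χ) (G := κ) (z := z) ((c1.differentiable (by simp)) z) ((k1.differentiable (by simp)) z)
      simp only [smul_eq_mul] at e
      rw [e, Finset.sum_insert ha, mul_add]
      refine (norm_add_le _ _).trans (add_le_add ?_ ?_)
      · rw [norm_mul]; exact (mul_le_of_le_one_right (norm_nonneg _) (k2 z)).trans (c5 z)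
      · rw [norm_mul]; exact (mul_le_of_le_one_left (norm_nonneg _) (c2 z)).trans (k5 z)
end db

open scoped Real
open MeasureTheory Filter Topology

section fin1
variable {𝔸 : Type*} [NormedRing 𝔸] [NormedAlgebra ℂ 𝔸] [CompleteSpace 𝔸] {T : 𝔸}
variable {α : Type*} [MeasurableSpace α] {m : Measure α} {c u : α → ℂ} {γ : ℝ → ℂ} {Ω : Set ℂ}

lemma pt_res_l {w : ℂ} (hw : w ∉ spectrum ℂ T) : resolvent T w * (algebraMap ℂ 𝔸 w - T) = 1 :=
  Ring.inverse_mul_cancel _ (spectrum.notMem_iff.1 hw)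

lemma pt_res_r {w : ℂ} (hw : w ∉ spectrum ℂ T) : (algebraMap ℂ 𝔸 w - T) * resolvent T w = 1 :=
  Ring.mul_inverse_cancel _ (spectrum.notMem_iff.1 hw)

lemma pt_id_aux (J : JDom γ Ω) (hc : AEStronglyMeasurable c m) (hu : Integrable u m)
    (hcΓ : ∀ᵐ x ∂m, c x ∈ γ '' Set.Icc 0 1) (hmom : ∀ n : ℕ, ∫ x, c x ^ n * u x ∂m = 0)
    {z : ℂ} (hz : z ∉ closure Ω) : Integrable (fun x => ((z - c x)⁻¹ * u x) • (1:𝔸)) m ∧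
      ∫ x, ((z - c x)⁻¹ * u x) • (1:𝔸) ∂m = 0 := by
  have e : ∀ x, (z - c x)⁻¹ = - (c x - z)⁻¹ := fun x => by rw [← inv_neg, neg_sub]
  constructor
  · have := pt_inv_integrable hc hu J.isCompact_Γ.isClosed hcΓ (fun h => hz (J.Γ_sub h))
    simp only [e]
    simpa [neg_mul] using (this.smul_const (1:𝔸)).neg
  · rw [integral_smul_const]
    simp only [e, neg_mul, integral_neg, pt_cauchy_ext J hc hu hcΓ hmom hz]
    simp

lemma pt_nu_int (J : JDom γ Ω) (hc : AEStronglyMeasurable c m) {ν : α → 𝔸}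
    (hcΓ : ∀ᵐ x ∂m, c x ∈ γ '' Set.Icc 0 1) (hν : Integrable ν m) {z : ℂ} (hz : z ∉ closure Ω) :
    Integrable (fun x => (z - c x)⁻¹ • ν x) m := by
  have e : ∀ x, (z - c x)⁻¹ = - (c x - z)⁻¹ := fun x => by rw [← inv_neg, neg_sub]
  have := pt_inv_integrable hc hν J.isCompact_Γ.isClosed hcΓ (fun h => hz (J.Γ_sub h))
  simp only [e]
  simpa [neg_smul] using this.neg

lemma pt_nu_diff (J : JDom γ Ω) (hc : AEStronglyMeasurable c m) {ν : α → 𝔸}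
    (hcΓ : ∀ᵐ x ∂m, c x ∈ γ '' Set.Icc 0 1) (hν : Integrable ν m) {z : ℂ} (hz : z ∉ closure Ω) :
    DifferentiableAt ℂ (fun z => ∫ x, (z - c x)⁻¹ • ν x ∂m) z := by
  have e : ∀ z x, (z - c x)⁻¹ = - (c x - z)⁻¹ := fun z x => by rw [← inv_neg, neg_sub]
  have := pt_inv_hasDeriv hc hν J.isCompact_Γ.isClosed hcΓ (fun h => hz (J.Γ_sub h))
  simp only [e, neg_smul, integral_neg]
  exact this.differentiableAt.fun_neg

lemma pt_id_r (J : JDom γ Ω) (hc : AEStronglyMeasurable c m) (hu : Integrable u m)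
    (hcΓ : ∀ᵐ x ∂m, c x ∈ γ '' Set.Icc 0 1) (hmom : ∀ n : ℕ, ∫ x, c x ^ n * u x ∂m = 0)
    (hS : ∀ᵐ x ∂m, c x ∉ spectrum ℂ T) (hν : Integrable (fun x => u x • resolvent T (c x)) m)
    {z : ℂ} (hz : z ∉ closure Ω) :
    (∫ x, (z - c x)⁻¹ • u x • resolvent T (c x) ∂m) * (algebraMap ℂ 𝔸 z - T) =
      ∫ x, u x • resolvent T (c x) ∂m := by
  obtain ⟨h1, h2⟩ := pt_id_aux (𝔸 := 𝔸) J hc hu hcΓ hmom hz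
  rw [← integral_mul_const_of_integrable (pt_nu_int J hc hcΓ hν hz),
    ← add_zero (∫ x, u x • resolvent T (c x) ∂m), ← h2, ← integral_add hν h1]
  refine integral_congr_ae ?_
  filter_upwards [hS, hcΓ] with x hx hxΓ
  have hne : z - c x ≠ 0 := fun h => hz (J.Γ_sub (by rwa [← sub_eq_zero.1 h] at hxΓ))
  have e : algebraMap ℂ 𝔸 z - T = (z - c x) • (1:𝔸) + (algebraMap ℂ 𝔸 (c x) - T) := by
    simp only [Algebra.algebraMap_eq_smul_one]; module
  rw [e, mul_add, smul_mul_assoc, smul_mul_assoc, smul_mul_assoc, smul_mul_assoc, pt_res_l hx, mul_smul_comm, mul_one,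
    smul_comm (u x) (z - c x), inv_smul_smul₀ hne, smul_smul]

lemma pt_id_l (J : JDom γ Ω) (hc : AEStronglyMeasurable c m) (hu : Integrable u m)
    (hcΓ : ∀ᵐ x ∂m, c x ∈ γ '' Set.Icc 0 1) (hmom : ∀ n : ℕ, ∫ x, c x ^ n * u x ∂m = 0)
    (hS : ∀ᵐ x ∂m, c x ∉ spectrum ℂ T) (hν : Integrable (fun x => u x • resolvent T (c x)) m)
    {z : ℂ} (hz : z ∉ closure Ω) :
    (algebraMap ℂ 𝔸 z - T) * (∫ x, (z - c x)⁻¹ • u x • resolvent T (c x) ∂m) =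
      ∫ x, u x • resolvent T (c x) ∂m := by
  obtain ⟨h1, h2⟩ := pt_id_aux (𝔸 := 𝔸) J hc hu hcΓ hmom hz
  rw [← integral_const_mul_of_integrable (pt_nu_int J hc hcΓ hν hz),
    ← add_zero (∫ x, u x • resolvent T (c x) ∂m), ← h2, ← integral_add hν h1]
  refine integral_congr_ae ?_
  filter_upwards [hS, hcΓ] with x hx hxΓ
  have hne : z - c x ≠ 0 := fun h => hz (J.Γ_sub (by rwa [← sub_eq_zero.1 h] at hxΓ))
  have e : algebraMap ℂ 𝔸 z - T = (z - c x) • (1:𝔸) + (algebraMap ℂ 𝔸 (c x) - T) := by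
    simp only [Algebra.algebraMap_eq_smul_one]; module
  rw [e, add_mul, mul_smul_comm, mul_smul_comm, mul_smul_comm, mul_smul_comm, pt_res_r hx, smul_mul_assoc, one_mul,
    smul_comm (u x) (z - c x), inv_smul_smul₀ hne, smul_smul]

/-- The glued function. -/
lemma pt_glue {I Jf : ℂ → 𝔸} {B₁ B₂ : 𝔸} {γ₁ γ₂ : ℝ → ℂ} {Ω₁ Ω₂ : Set ℂ} (J₁ : JDom γ₁ Ω₁) (J₂ : JDom γ₂ Ω₂)
    (hd : Ω₁ ∩ Ω₂ = ∅)
    (hI : ∀ z ∉ closure Ω₂, DifferentiableAt ℂ I z) (hJ : ∀ z ∉ closure Ω₁, DifferentiableAt ℂ Jf z)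
    (hI2 : ∀ z ∉ closure Ω₂, I z * (algebraMap ℂ 𝔸 z - T) = B₂)
    (hJ2 : ∀ z ∉ closure Ω₁, (algebraMap ℂ 𝔸 z - T) * Jf z = B₁) :
    ∃ G : ℂ → 𝔸, (∀ z ∉ γ₁ '' Set.Icc 0 1 ∩ γ₂ '' Set.Icc 0 1 ∩ spectrum ℂ T, DifferentiableAt ℂ G z) ∧
      (∀ z ∉ closure Ω₂, G z = I z * B₁) ∧ (∀ z ∉ closure Ω₁, G z = B₂ * Jf z) := by
  classical
  have hIJ : ∀ z ∉ closure Ω₂, z ∉ closure Ω₁ → I z * B₁ = B₂ * Jf z := by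
    intro z h2 h1
    rw [← hJ2 z h1, ← hI2 z h2, mul_assoc]
  set G : ℂ → 𝔸 := fun z => if z ∉ closure Ω₂ then I z * B₁ else if z ∉ closure Ω₁ then B₂ * Jf z
    else B₂ * resolvent T z * B₁ with hG
  have g2 : ∀ z ∉ closure Ω₂, G z = I z * B₁ := fun z hz => by simp only [hG]; rw [if_pos hz]
  have g1 : ∀ z ∉ closure Ω₁, G z = B₂ * Jf z := fun z hz => by
    by_cases h2 : z ∉ closure Ω₂
    · rw [g2 z h2, hIJ z h2 hz]
    · simp only [hG]; rw [if_neg h2, if_pos hz]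
  have gR : ∀ z ∉ spectrum ℂ T, G z = B₂ * resolvent T z * B₁ := fun z hz => by
    by_cases h2 : z ∉ closure Ω₂
    · rw [g2 z h2, ← hI2 z h2, mul_assoc (I z), pt_res_r hz, mul_one]
    · by_cases h1 : z ∉ closure Ω₁
      · rw [g1 z h1, ← hJ2 z h1, mul_assoc B₂, ← mul_assoc (resolvent T z), pt_res_l hz, one_mul]
      · simp only [hG]; rw [if_neg h2, if_neg h1]
  refine ⟨G, ?_, g2, g1⟩
  intro z hz
  by_cases h2 : z ∈ closure Ω₂
  · by_cases h1 : z ∈ closure Ω₁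
    · have d12 : Disjoint Ω₁ Ω₂ := Set.disjoint_iff_inter_eq_empty.2 hd
      have n1 : z ∉ Ω₁ := fun h => Set.disjoint_left.1 (d12.closure_right J₁.op) h h2
      have n2 : z ∉ Ω₂ := fun h => Set.disjoint_left.1 (d12.closure_left J₂.op) h1 h
      rw [J₁.closure_eq] at h1
      rw [J₂.closure_eq] at h2
      have hS : z ∉ spectrum ℂ T := fun h => hz ⟨⟨h1.resolve_left n1, h2.resolve_left n2⟩, h⟩
      have : G =ᶠ[𝓝 z] fun z => B₂ * resolvent T z * B₁ := by
        filter_upwards [(spectrum.isClosed (𝕜 := ℂ) T).isOpen_compl.mem_nhds hS] with w hw using gR w hw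
      refine DifferentiableAt.congr_of_eventuallyEq ?_ this
      have hr : DifferentiableAt ℂ (resolvent T) z :=
        (spectrum.hasDerivAt_resolvent_const_left (spectrum.mem_resolventSet_iff.2 (spectrum.notMem_iff.1 hS))).differentiableAt
      exact (hr.const_mul B₂).mul_const B₁
    · have : G =ᶠ[𝓝 z] fun z => B₂ * Jf z := by
        filter_upwards [isClosed_closure.isOpen_compl.mem_nhds h1] with w hw using g1 w hw
      exact ((hJ z h1).const_mul B₂).congr_of_eventuallyEq this
  · have : G =ᶠ[𝓝 z] fun z => I z * B₁ := by
      filter_upwards [isClosed_closure.isOpen_compl.mem_nhds h2] with w hw using g2 w hw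
    exact ((hI z h2).mul_const B₁).congr_of_eventuallyEq this

lemma pt_q_meas {m : Measure α} [SFinite m] {F : Type*} [NormedAddCommGroup F] {ν : α → F} (hc : AEStronglyMeasurable c m) (hν : AEStronglyMeasurable ν m)
    (μ : Measure ℂ) [SFinite μ] :
    AEMeasurable (Function.uncurry fun (z : ℂ) (x : α) => ‖(z - c x)⁻¹‖ₑ * ‖ν x‖ₑ) (μ.prod m) := by
  have h1 : AEMeasurable (fun p : ℂ × α => c p.2) (μ.prod m) := hc.aemeasurable.comp_snd
  have h2 : AEMeasurable (fun p : ℂ × α => ‖ν p.2‖ₑ) (μ.prod m) := hν.enorm.comp_snd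
  exact ((measurable_fst.aemeasurable.sub h1).inv.enorm).mul h2

lemma pt_q_bound {m : Measure α} [SFinite m] {F : Type*} [NormedAddCommGroup F] {ν : α → F} (hc : AEStronglyMeasurable c m) (hν : AEStronglyMeasurable ν m)
    {v : α → ℝ} (hv : Integrable v m) (hv0 : ∀ᵐ x ∂m, 0 ≤ v x) {d : ℂ → ℝ} {a : ℂ} (hda : ∀ w, d w ≤ dist w a)
    {M η r : ℝ} (hM : 0 ≤ M) (hη : 0 ≤ η) (hr : 0 < r) (hb : ∀ᵐ x ∂m, ‖ν x‖ ≤ M * (d (c x) + η) * v x) :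
    ∫⁻ z in Metric.ball a (3 * r), ∫⁻ x, ‖(z - c x)⁻¹‖ₑ * ‖ν x‖ₑ ∂m ≤
      ENNReal.ofReal (9 * π * r * (4 * r + η) * M * ∫ x, v x ∂m) := by
  rw [lintegral_lintegral_swap (pt_q_meas hc hν _)]
  have key : ∀ᵐ x ∂m, ∫⁻ z in Metric.ball a (3 * r), ‖(z - c x)⁻¹‖ₑ * ‖ν x‖ₑ ≤
      ENNReal.ofReal (9 * π * r * (4 * r + η) * M) * ENNReal.ofReal (v x) := by
    filter_upwards [hv0, hb] with x hx hbx
    have hpt : ∀ z ∈ Metric.ball a (3 * r), ‖(z - c x)⁻¹‖ₑ * ‖ν x‖ₑ ≤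
        ENNReal.ofReal (M * v x) * (1 + ENNReal.ofReal (3 * r + η) * ‖(z - c x)⁻¹‖ₑ) := by
      intro z hz
      have h1 : ‖(z - c x)⁻¹‖ * ‖ν x‖ ≤ M * v x * (1 + (3 * r + η) * ‖(z - c x)⁻¹‖) := by
        have hd : d (c x) ≤ ‖z - c x‖ + 3 * r := by
          have := dist_triangle (c x) z a
          rw [dist_comm (c x) z, dist_eq_norm z (c x)] at this
          linarith [hda (c x), Metric.mem_ball.1 hz]
        have hii : ‖(z - c x)⁻¹‖ * ‖z - c x‖ ≤ 1 := by
          rw [norm_inv]; exact inv_mul_le_one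
        calc ‖(z - c x)⁻¹‖ * ‖ν x‖ ≤ ‖(z - c x)⁻¹‖ * (M * (‖z - c x‖ + 3 * r + η) * v x) := by
              gcongr; refine hbx.trans ?_; gcongr
          _ = M * v x * (‖(z - c x)⁻¹‖ * ‖z - c x‖ + (3 * r + η) * ‖(z - c x)⁻¹‖) := by ring
          _ ≤ _ := by gcongr
      have e1 : ∀ y : ℂ, ‖y‖ₑ = ENNReal.ofReal ‖y‖ := fun y => (ofReal_norm y).symm
      rw [e1, ← ofReal_norm (ν x), ← ENNReal.ofReal_mul (norm_nonneg _), ← ENNReal.ofReal_mul (by positivity),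
        ← ENNReal.ofReal_one, ← ENNReal.ofReal_add (by positivity) (by positivity), ← ENNReal.ofReal_mul (by positivity)]
      exact ENNReal.ofReal_le_ofReal h1
    calc _ ≤ ∫⁻ z in Metric.ball a (3 * r), ENNReal.ofReal (M * v x) * (1 + ENNReal.ofReal (3 * r + η) * ‖(z - c x)⁻¹‖ₑ) :=
          setLIntegral_mono' measurableSet_ball hpt
      _ = ENNReal.ofReal (M * v x) * (∫⁻ z in Metric.ball a (3 * r), (1 + ENNReal.ofReal (3 * r + η) * ‖(z - c x)⁻¹‖ₑ)) := by
          rw [lintegral_const_mul' _ _ ENNReal.ofReal_ne_top]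
      _ = ENNReal.ofReal (M * v x) * (volume (Metric.ball a (3 * r)) + ENNReal.ofReal (3 * r + η) * ∫⁻ z in Metric.ball a (3 * r), ‖(z - c x)⁻¹‖ₑ) := by
          rw [lintegral_add_left measurable_const, lintegral_const_mul' _ _ ENNReal.ofReal_ne_top, lintegral_one, Measure.restrict_apply_univ]
      _ ≤ ENNReal.ofReal (M * v x) * (ENNReal.ofReal (π * (3 * r) ^ 2) + ENNReal.ofReal (3 * r + η) * ENNReal.ofReal (3 * π * (3 * r))) := by
          gcongr
          · rw [Complex.volume_ball, ← ENNReal.ofReal_pow (by positivity), mul_comm π, ENNReal.ofReal_mul (by positivity)]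
            apply le_of_eq; congr 1
            rw [ENNReal.ofReal, Real.toNNReal_of_nonneg Real.pi_pos.le]; rfl
          · exact pt_area (by positivity) a (c x)
      _ = _ := by
          rw [← ENNReal.ofReal_mul (by positivity), ← ENNReal.ofReal_add (by positivity) (by positivity), ← ENNReal.ofReal_mul (by positivity), ← ENNReal.ofReal_mul (by positivity)]
          congr 1; ring
  refine (lintegral_mono_ae key).trans ?_
  rw [lintegral_const_mul' _ _ ENNReal.ofReal_ne_top, ← ofReal_integral_eq_lintegral_ofReal hv hv0, ← ENNReal.ofReal_mul (by positivity)]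
end fin1

open scoped Real
open MeasureTheory Filter Topology

section fin2
variable {𝔸 : Type*} [NormedRing 𝔸] [NormedAlgebra ℂ 𝔸] [CompleteSpace 𝔸] {T : 𝔸}

lemma pt_dbar_contF {F : Type*} [NormedAddCommGroup F] [NormedSpace ℂ F] {φ : ℂ → F} (hφ : ContDiff ℝ 1 φ) :
    Continuous (dbar φ) := by
  have h := hφ.continuous_fderiv (by simp)
  unfold dbar
  exact ((h.clm_apply continuous_const).add ((h.clm_apply continuous_const).const_smul Complex.I)).const_smul (2⁻¹ : ℂ)

lemma pt_dbar_suppF {F : Type*} [NormedAddCommGroup F] [NormedSpace ℂ F] {φ : ℂ → F} (hs : HasCompactSupport φ) :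
    HasCompactSupport (dbar φ) := by
  refine (hs.fderiv (𝕜 := ℝ)).mono fun z hz => ?_
  intro h
  apply hz
  unfold dbar
  rw [h]; simp

lemma pt_core : ∃ C > 0, ∀ (G : ℂ → 𝔸) (K : Set ℂ) (r : ℝ) (t : Finset ℂ) (L : Set ℂ) (b : ℝ),
    IsClosed K → volume K = 0 → (∀ z ∉ K, DifferentiableAt ℂ G z) → 0 < r → (K ⊆ ⋃ a ∈ t, Metric.ball a r) →
    Bornology.IsBounded L → 0 ≤ b →
    (∀ a ∈ t, ∫⁻ z in Metric.ball a (3 * r), ‖G z‖ₑ ≤ ENNReal.ofReal b) →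
    ∀ {α : Type} [MeasurableSpace α] (m : Measure α) [SFinite m] (c : α → ℂ) (ν : α → 𝔸),
      AEStronglyMeasurable c m → Integrable ν m → (∀ᵐ x ∂m, c x ∈ L) →
      (∀ z ∉ L, G z = ∫ x, (z - c x)⁻¹ • ν x ∂m) → ‖∫ x, ν x ∂m‖ ≤ C / r * t.card * b := by
  obtain ⟨C, hC, hcut⟩ := pt_cut
  refine ⟨C / π, by positivity, ?_⟩
  intro G K r t L b hK hK0 hG hr hcov hL hb0 hbG α _ m _ c ν hc hν hcL hGL
  obtain ⟨κ, k1, k2, k3, k4, k5⟩ := hcut r hr t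
  -- big radius
  have hbd : Bornology.IsBounded (L ∪ ⋃ a ∈ t, Metric.ball a (3 * r)) := by
    refine hL.union ?_
    exact (Bornology.isBounded_biUnion_finset t).2 fun a _ => Metric.isBounded_ball
  obtain ⟨R, hR0, hR⟩ := hbd.subset_ball_lt 0 0
  let B : ContDiffBump (0:ℂ) := ⟨R, R + 1, hR0, by linarith⟩
  set ψ : ℂ → ℂ := fun z => (B z : ℂ) with hψ
  have p1 : ContDiff ℝ 1 ψ := Complex.ofRealCLM.contDiff.comp B.contDiff
  have p2 : HasCompactSupport ψ := B.hasCompactSupport.comp_left (g := Complex.ofReal) (by simp)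
  have p3 : ∀ z ∈ Metric.ball (0:ℂ) R, ψ z = 1 := by
    intro z hz
    have : B z = 1 := B.one_of_mem_closedBall (Metric.ball_subset_closedBall hz)
    simp [hψ, this]
  have p4 : ∀ z ∈ Metric.ball (0:ℂ) R, dbar ψ z = 0 := by
    intro z hz
    rw [← dbar_const (1:ℂ) z]
    apply dbar_congr
    filter_upwards [Metric.isOpen_ball.mem_nhds hz] with w hw using p3 w hw
  have k6 : ∀ z ∉ Metric.ball (0:ℂ) R, κ z = 1 := by
    intro z hz
    refine k4 z fun a ha => ?_
    by_contra h
    push Not at h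
    exact hz (hR (Or.inr (Set.mem_biUnion ha (Metric.mem_ball.2 h))))
  have k7 : ∀ z ∉ Metric.ball (0:ℂ) R, dbar κ z = 0 := by
    intro z hz
    rw [← norm_le_zero_iff]
    refine (k5 z).trans ?_
    rw [Finset.sum_eq_zero, mul_zero]
    intro a ha
    refine Set.indicator_of_notMem (fun h => hz (hR (Or.inr (Set.mem_biUnion ha h)))) _
  have kψ : ∀ z, dbar (fun z => κ z * ψ z) z = dbar κ z + dbar ψ z := by
    intro z
    have e := dbar_smul (φ := κ) (G := ψ) (z := z) ((k1.differentiable (by simp)) z) ((p1.differentiable (by simp)) z)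
    simp only [smul_eq_mul] at e
    rw [e]
    by_cases hz : z ∈ Metric.ball (0:ℂ) R
    · rw [p3 z hz, p4 z hz]; simp
    · rw [k6 z hz, k7 z hz]; simp
  have hκK : ∀ z ∈ K, κ =ᶠ[𝓝 z] fun _ => 0 := by
    intro z hz
    obtain ⟨a, ha, hza⟩ := Set.mem_iUnion₂.1 (hcov hz)
    filter_upwards [Metric.isOpen_ball.mem_nhds hza] with w hw using k3 a ha w hw
  set Φ : ℂ → 𝔸 := fun z => (κ z * ψ z) • G z with hΦ
  have hΦ0 : ∀ z ∈ K, Φ =ᶠ[𝓝 z] fun _ => 0 := by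
    intro z hz
    filter_upwards [hκK z hz] with w hw
    simp [hΦ, hw]
  have f1 : ContDiff ℝ 1 Φ := by
    rw [contDiff_iff_contDiffAt]
    intro z
    by_cases hz : z ∈ K
    · exact contDiffAt_const.congr_of_eventuallyEq (hΦ0 z hz)
    · have hGz : ContDiffAt ℂ 1 G z := by
        have : DifferentiableOn ℂ G Kᶜ := fun w hw => (hG w hw).differentiableWithinAt
        exact (this.analyticAt (hK.isOpen_compl.mem_nhds hz)).contDiffAt
      exact ((k1.mul p1).contDiffAt).smul (hGz.restrict_scalars ℝ)
  have f2 : HasCompactSupport Φ := (p2.mul_left (f := κ)).smul_right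
  have f3 : ∀ z, dbar Φ z = dbar κ z • G z + dbar ψ z • G z := by
    intro z
    rw [← add_smul, ← kψ]
    by_cases hz : z ∈ K
    · rw [dbar_congr (hΦ0 z hz), dbar_const]
      have : (fun z => κ z * ψ z) =ᶠ[𝓝 z] fun _ => 0 := by
        filter_upwards [hκK z hz] with w hw; simp [hw]
      rw [dbar_congr this, dbar_const, zero_smul]
    · have e := dbar_smul (φ := fun z => κ z * ψ z) (G := G) (z := z)
        (((k1.mul p1).differentiable (by simp)) z) ((hG z hz).restrictScalars ℝ)
      rw [dbar_holo (hG z hz), smul_zero, add_zero] at e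
      exact e
  have f4 : Integrable (dbar Φ) :=
    (pt_dbar_contF f1).integrable_of_hasCompactSupport (pt_dbar_suppF f2)
  have f5 := pt_int_dbar f1 f2 f4
  have g1 : ∀ z, dbar ψ z • G z = dbar ψ z • ∫ x, (z - c x)⁻¹ • ν x ∂m := by
    intro z
    by_cases hz : z ∈ L
    · rw [p4 z (hR (Or.inl hz))]; simp
    · rw [hGL z hz]
  have g2 : Integrable (fun z => dbar ψ z • G z) := by
    have := (pt_fub_int (pt_dbar_contF p1) (pt_dbar_suppF p2) hc hν).integral_prod_left
    refine this.congr (Eventually.of_forall fun z => ?_)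
    beta_reduce
    rw [g1, ← integral_smul]
    simp only [smul_smul]
  have g3 : ∫ z, dbar ψ z • G z = -(π:ℂ) • ∫ x, ν x ∂m := by
    simp only [g1]
    rw [pt_fubini p1 p2 hc hν]
    congr 1
    refine integral_congr_ae ?_
    filter_upwards [hcL] with x hx
    rw [p3 _ (hR (Or.inl hx)), one_smul]
  have g4 : Integrable (fun z => dbar κ z • G z) := by
    have : (fun z => dbar κ z • G z) = fun z => dbar Φ z - dbar ψ z • G z := by
      funext z; rw [f3]; simp
    rw [this]; exact f4.sub g2
  have g5 : ∫ z, dbar κ z • G z = (π:ℂ) • ∫ x, ν x ∂m := by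
    simp only [f3] at f5
    rw [integral_add g4 g2, g3] at f5
    rw [eq_neg_of_add_eq_zero_left f5, neg_smul, neg_neg]
  have hGm : AEStronglyMeasurable G := by
    have h1 : ContinuousOn G Kᶜ := fun z hz => (hG z hz).continuousAt.continuousWithinAt
    have h2 := h1.aestronglyMeasurable (μ := volume) hK.isOpen_compl.measurableSet
    rwa [Measure.restrict_eq_self_of_ae_mem (s := Kᶜ) (measure_eq_zero_iff_ae_notMem.1 hK0)] at h2
  have hfin : ‖∫ z, dbar κ z • G z‖ₑ ≤ ENNReal.ofReal (C / r * t.card * b) := by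
    refine (enorm_integral_le_lintegral_enorm _).trans ?_
    calc ∫⁻ z, ‖dbar κ z • G z‖ₑ ≤ ∫⁻ z, ENNReal.ofReal (C / r) * ∑ a ∈ t, (Metric.ball a (3 * r)).indicator (fun z => ‖G z‖ₑ) z := by
          refine lintegral_mono fun z => ?_
          beta_reduce
          rw [enorm_smul, ← ofReal_norm (dbar κ z)]
          refine (mul_le_mul_left (ENNReal.ofReal_le_ofReal (k5 z)) _).trans ?_
          rw [ENNReal.ofReal_mul (by positivity), mul_assoc]
          gcongr
          rw [ENNReal.ofReal_sum_of_nonneg (fun a _ => Set.indicator_nonneg (fun _ _ => zero_le_one) _), Finset.sum_mul]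
          refine Finset.sum_le_sum fun a _ => ?_
          by_cases h : z ∈ Metric.ball a (3 * r)
          · simp [h]
          · simp [Set.indicator_of_notMem h]
      _ = ENNReal.ofReal (C / r) * ∑ a ∈ t, ∫⁻ z in Metric.ball a (3 * r), ‖G z‖ₑ := by
          rw [lintegral_const_mul' _ _ ENNReal.ofReal_ne_top, lintegral_finsetSum' _ fun a _ => hGm.enorm.indicator measurableSet_ball]
          simp only [lintegral_indicator measurableSet_ball]
      _ ≤ ENNReal.ofReal (C / r) * ∑ a ∈ t, ENNReal.ofReal b := by
          gcongr with a ha; exact hbG a ha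
      _ = _ := by
          rw [Finset.sum_const, nsmul_eq_mul, ← ENNReal.ofReal_natCast, ← ENNReal.ofReal_mul (by positivity), ← ENNReal.ofReal_mul (by positivity), mul_assoc]
  rw [g5, enorm_smul, ← ofReal_norm, ← ofReal_norm, ← ENNReal.ofReal_mul (norm_nonneg _), ENNReal.ofReal_le_ofReal_iff (by positivity),
    Complex.norm_real, Real.norm_of_nonneg Real.pi_pos.le] at hfin
  have hpi := Real.pi_pos
  have e : C / π / r * t.card * b = (C / r * t.card * b) / π := by field_simp
  rw [e, le_div_iff₀ hpi]; linarith

/-- key estimate -/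
lemma pt_est : ∃ C > 0, ∀ {T : 𝔸} {γ₁ γ₂ : ℝ → ℂ} {Ω₁ Ω₂ : Set ℂ} (_ : JDom γ₁ Ω₁) (_ : JDom γ₂ Ω₂)
    (_ : Ω₁ ∩ Ω₂ = ∅) {α : Type} [MeasurableSpace α] {m : Measure α} [SFinite m] {c₁ c₂ u₁ u₂ : α → ℂ}
    (_ : AEStronglyMeasurable c₁ m) (_ : AEStronglyMeasurable c₂ m) (_ : Integrable u₁ m) (_ : Integrable u₂ m)
    (_ : ∀ᵐ x ∂m, c₁ x ∈ γ₁ '' Set.Icc 0 1) (_ : ∀ᵐ x ∂m, c₂ x ∈ γ₂ '' Set.Icc 0 1)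
    (_ : ∀ n : ℕ, ∫ x, c₁ x ^ n * u₁ x ∂m = 0) (_ : ∀ n : ℕ, ∫ x, c₂ x ^ n * u₂ x ∂m = 0)
    (_ : ∀ᵐ x ∂m, c₁ x ∉ spectrum ℂ T) (_ : ∀ᵐ x ∂m, c₂ x ∉ spectrum ℂ T)
    (_ : Integrable (fun x => u₁ x • resolvent T (c₁ x)) m) (_ : Integrable (fun x => u₂ x • resolvent T (c₂ x)) m)
    {v₁ v₂ : α → ℝ} (_ : Integrable v₁ m) (_ : Integrable v₂ m) (_ : ∀ᵐ x ∂m, 0 ≤ v₁ x) (_ : ∀ᵐ x ∂m, 0 ≤ v₂ x)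
    {M η r : ℝ} (_ : 0 ≤ M) (_ : 0 ≤ η) (_ : 0 < r) {t : Finset ℂ}
    (_ : ↑t ⊆ γ₁ '' Set.Icc 0 1 ∩ γ₂ '' Set.Icc 0 1 ∩ spectrum ℂ T)
    (_ : γ₁ '' Set.Icc 0 1 ∩ γ₂ '' Set.Icc 0 1 ∩ spectrum ℂ T ⊆ ⋃ a ∈ t, Metric.ball a r)
    (_ : ∀ᵐ x ∂m, ‖u₁ x • resolvent T (c₁ x)‖ ≤ M * (Metric.infDist (c₁ x) (spectrum ℂ T) + η) * v₁ x)
    (_ : ∀ᵐ x ∂m, ‖u₂ x • resolvent T (c₂ x)‖ ≤ M * (Metric.infDist (c₂ x) (spectrum ℂ T) + η) * v₂ x)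
    {V : ℝ} (_ : ∫ x, v₁ x ∂m ≤ V) (_ : ∫ x, v₂ x ∂m ≤ V)
    (_ : ‖∫ x, u₁ x • resolvent T (c₁ x) ∂m‖ ≤ V) (_ : ‖∫ x, u₂ x • resolvent T (c₂ x) ∂m‖ ≤ V),
    ‖(∫ x, u₂ x • resolvent T (c₂ x) ∂m) * ∫ x, u₁ x • resolvent T (c₁ x) ∂m‖ ≤ C * M * V ^ 2 * (t.card * r + t.card * η) := by
  obtain ⟨C, hC, core⟩ := pt_core (𝔸 := 𝔸)
  refine ⟨C * (72 * π), by positivity, ?_⟩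
  intro T γ₁ γ₂ Ω₁ Ω₂ J₁ J₂ hd α _ m _ c₁ c₂ u₁ u₂ hc₁ hc₂ hu₁ hu₂ hΓ₁ hΓ₂ hm₁ hm₂ hS₁ hS₂ hν₁ hν₂ v₁ v₂ hv₁ hv₂ hp₁ hp₂
    M η r hM hη hr t htK hcov hb₁ hb₂ V hV₁ hV₂ hB₁ hB₂
  set B₁ := ∫ x, u₁ x • resolvent T (c₁ x) ∂m with hB₁'
  set B₂ := ∫ x, u₂ x • resolvent T (c₂ x) ∂m with hB₂'
  have hV0 : 0 ≤ V := (norm_nonneg _).trans hB₁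
  obtain ⟨G, G0, G2, G1⟩ := pt_glue (T := T) (B₁ := B₁) (B₂ := B₂) J₁ J₂ hd
    (fun z hz => pt_nu_diff J₂ hc₂ hΓ₂ hν₂ hz) (fun z hz => pt_nu_diff J₁ hc₁ hΓ₁ hν₁ hz)
    (fun z hz => pt_id_r J₂ hc₂ hu₂ hΓ₂ hm₂ hS₂ hν₂ hz) (fun z hz => pt_id_l J₁ hc₁ hu₁ hΓ₁ hm₁ hS₁ hν₁ hz)
  set K := γ₁ '' Set.Icc 0 1 ∩ γ₂ '' Set.Icc 0 1 ∩ spectrum ℂ T with hKdef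
  have hK : IsClosed K := (J₁.isCompact_Γ.isClosed.inter J₂.isCompact_Γ.isClosed).inter (spectrum.isClosed T)
  have hK0 : volume K = 0 := measure_mono_null (fun z hz => hz.1.1) J₁.vol_zero
  set b := V * (9 * π * r * (4 * r + η) * M * V) + V * (9 * π * r * (4 * r + η) * M * V) with hb
  have hq : ∀ a ∈ t, ∀ w, Metric.infDist w (spectrum ℂ T) ≤ dist w a := fun a ha w => Metric.infDist_le_dist_of_mem (htK ha).2
  have e1 : ∀ z ∉ closure Ω₂, ‖G z‖ₑ ≤ ENNReal.ofReal V * ∫⁻ x, ‖(z - c₂ x)⁻¹‖ₑ * ‖u₂ x • resolvent T (c₂ x)‖ₑ ∂m := by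
    intro z hz
    rw [G2 z hz, ← ofReal_norm]
    refine (ENNReal.ofReal_le_ofReal (norm_mul_le _ _)).trans ?_
    rw [mul_comm, ENNReal.ofReal_mul (norm_nonneg _), ofReal_norm (∫ x, (z - c₂ x)⁻¹ • u₂ x • resolvent T (c₂ x) ∂m)]
    gcongr
    refine (enorm_integral_le_lintegral_enorm _).trans (le_of_eq ?_)
    simp only [enorm_smul]
  have e2 : ∀ z ∉ closure Ω₁, ‖G z‖ₑ ≤ ENNReal.ofReal V * ∫⁻ x, ‖(z - c₁ x)⁻¹‖ₑ * ‖u₁ x • resolvent T (c₁ x)‖ₑ ∂m := by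
    intro z hz
    rw [G1 z hz, ← ofReal_norm]
    refine (ENNReal.ofReal_le_ofReal (norm_mul_le _ _)).trans ?_
    rw [ENNReal.ofReal_mul (norm_nonneg _), ofReal_norm (∫ x, (z - c₁ x)⁻¹ • u₁ x • resolvent T (c₁ x) ∂m)]
    gcongr
    refine (enorm_integral_le_lintegral_enorm _).trans (le_of_eq ?_)
    simp only [enorm_smul]
  have hbG : ∀ a ∈ t, ∫⁻ z in Metric.ball a (3 * r), ‖G z‖ₑ ≤ ENNReal.ofReal b := by
    intro a ha
    have q1 := pt_q_bound hc₁ hν₁.aestronglyMeasurable hv₁ hp₁ (hq a ha) hM hη hr hb₁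
    have q2 := pt_q_bound hc₂ hν₂.aestronglyMeasurable hv₂ hp₂ (hq a ha) hM hη hr hb₂
    have hae : ∀ᵐ z ∂(volume.restrict (Metric.ball a (3 * r))), ‖G z‖ₑ ≤
        ENNReal.ofReal V * (∫⁻ x, ‖(z - c₂ x)⁻¹‖ₑ * ‖u₂ x • resolvent T (c₂ x)‖ₑ ∂m) +
        ENNReal.ofReal V * ∫⁻ x, ‖(z - c₁ x)⁻¹‖ₑ * ‖u₁ x • resolvent T (c₁ x)‖ₑ ∂m := by
      refine ae_restrict_of_ae ?_
      filter_upwards [measure_eq_zero_iff_ae_notMem.1 J₁.vol_zero] with z hz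
      by_cases h2 : z ∈ closure Ω₂
      · have h1 : z ∉ closure Ω₁ := by
          rw [J₁.closure_eq]
          rintro (h | h)
          · exact Set.disjoint_left.1 ((Set.disjoint_iff_inter_eq_empty.2 hd).closure_right J₁.op) h h2
          · exact hz h
        exact (e2 z h1).trans le_add_self
      · exact (e1 z h2).trans le_self_add
    refine (lintegral_mono_ae hae).trans ?_
    rw [lintegral_add_left' ((AEMeasurable.lintegral_prod_right (pt_q_meas hc₂ hν₂.aestronglyMeasurable _)).const_mul _),
      lintegral_const_mul' _ _ ENNReal.ofReal_ne_top, lintegral_const_mul' _ _ ENNReal.ofReal_ne_top,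
      hb, ENNReal.ofReal_add (by positivity) (by positivity), ENNReal.ofReal_mul hV0]
    gcongr
    · exact q2.trans (ENNReal.ofReal_le_ofReal (by gcongr))
    · exact q1.trans (ENNReal.ofReal_le_ofReal (by gcongr))
  have hν := hν₂.mul_const B₁
  have := core G K r t (closure Ω₂) b hK hK0 G0 hr hcov J₂.isCompact_cl.isBounded (by positivity) hbG m c₂
    (fun x => u₂ x • resolvent T (c₂ x) * B₁) hc₂ hν (hΓ₂.mono fun x hx => J₂.Γ_sub hx) (by
      intro z hz
      rw [G2 z hz, ← integral_mul_const_of_integrable (pt_nu_int J₂ hc₂ hΓ₂ hν₂ hz)]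
      simp only [smul_mul_assoc])
  rw [integral_mul_const_of_integrable hν₂] at this
  refine this.trans ?_
  have e : C / r * t.card * b = C * (18 * π) * M * V ^ 2 * (4 * (t.card * r) + t.card * η) := by
    rw [hb]; field_simp; ring
  rw [e]
  have : C * (72 * π) * M * V ^ 2 * (t.card * r + t.card * η) = C * (18 * π) * M * V ^ 2 * (4 * (t.card * r) + 4 * (t.card * η)) := by ring
  rw [this]
  refine mul_le_mul_of_nonneg_left ?_ (by positivity)
  have : 0 ≤ t.card * η := by positivity
  linarith
end fin2

open scoped Real
open MeasureTheory Filter Topology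

section asm
variable {𝔸 : Type*} [NormedRing 𝔸] [NormedAlgebra ℂ 𝔸] [CompleteSpace 𝔸] {T : 𝔸}

lemma pt_res_sm (T : 𝔸) : StronglyMeasurable (resolvent T : ℂ → 𝔸) := by
  classical
  have h1 : ContinuousOn (resolvent T : ℂ → 𝔸) (resolventSet ℂ T) := fun z hz =>
    (spectrum.hasDerivAt_resolvent_const_left hz).continuousAt.continuousWithinAt
  have hm : MeasurableSet (resolventSet ℂ T) := (spectrum.isOpen_resolventSet T).measurableSet
  have h2 : StronglyMeasurable (fun z : resolventSet ℂ T => (resolvent T (z : ℂ) : 𝔸)) :=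
    (continuousOn_iff_continuous_restrict.1 h1).stronglyMeasurable
  have h3 : StronglyMeasurable (fun z : ((resolventSet ℂ T)ᶜ : Set ℂ) => (resolvent T (z : ℂ) : 𝔸)) := by
    have : (fun z : ((resolventSet ℂ T)ᶜ : Set ℂ) => (resolvent T (z : ℂ) : 𝔸)) = fun _ => 0 := by
      funext z
      exact Ring.inverse_non_unit _ fun h => z.2 (spectrum.mem_resolventSet_iff.2 h)
    rw [this]; exact stronglyMeasurable_const
  refine stronglyMeasurable_of_stronglyMeasurable_union_cover (resolventSet ℂ T) (resolventSet ℂ T)ᶜ hm hm.compl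
    (by simp) h2 h3

lemma pt_res_lb {w s : ℂ} (hw : w ∉ spectrum ℂ T) (hs : s ∈ spectrum ℂ T) : 1 ≤ dist w s * ‖resolvent T w‖ := by
  by_contra h
  push Not at h
  have h1 : ‖(w - s) • resolvent T w‖ < 1 := by rwa [norm_smul, ← dist_eq_norm]
  have h2 : IsUnit (1 - (w - s) • resolvent T w) := isUnit_one_sub_of_norm_lt_one h1
  refine hs ?_
  have e : algebraMap ℂ 𝔸 s - T = (algebraMap ℂ 𝔸 w - T) * (1 - (w - s) • resolvent T w) := by
    rw [mul_sub, mul_one, mul_smul_comm, pt_res_r hw]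
    simp only [Algebra.algebraMap_eq_smul_one]; module
  rw [spectrum.mem_resolventSet_iff, e]
  exact (spectrum.notMem_iff.1 hw).mul h2

lemma pt_lim {γ : ℝ → ℂ} {Ω : Set ℂ} (J : JDom γ Ω) {f : ℕ → ℂ → ℂ} {a : ℂ} (ha : a ∈ Ω)
    (hf : ∀ j, Differentiable ℂ (f j)) (h1 : ∀ j, ∀ z ∈ γ '' Set.Icc 0 1, ‖f j z‖ ≤ 1)
    (hj : ∀ j : ℕ, ‖f j a - 1‖ ≤ 1 / ((j:ℝ) + 1)) : ∀ b ∈ Ω, Tendsto (fun j => f j b) atTop (𝓝 1) := by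
  intro b hb
  refine pt_F J.op J.preconn hf (fun j z hz => J.max_norm (hf j) (h1 j) (subset_closure hz)) ha ?_ hb
  rw [tendsto_iff_norm_sub_tendsto_zero]
  exact squeeze_zero (fun _ => norm_nonneg _) hj tendsto_one_div_add_atTop_nhds_zero_nat

variable {α : Type} [MeasurableSpace α] {m : Measure α} [SFinite m]

lemma pt_zero {γ : ℝ → ℂ} {Ω : Set ℂ} (J : JDom γ Ω) {c g : α → ℂ} (hc : AEStronglyMeasurable c m) (hg : Integrable g m)
    (hΓ : ∀ᵐ x ∂m, c x ∈ γ '' Set.Icc 0 1) (hm : ∀ n : ℕ, ∫ x, c x ^ n * g x ∂m = 0)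
    (hν : Integrable (fun x => g x • resolvent T (c x)) m)
    (h0 : ∀ b ∈ Ω, ∫ x, (c x - b)⁻¹ * g x ∂m = 0) : ∫ x, g x • resolvent T (c x) ∂m = 0 := by
  have := pt_W J hc hg hΓ hm (f := fun _ _ => 0) (fun _ => differentiable_const 0) (by simp)
    (fun b hb => by rw [h0 b hb]; simp) (pt_res_sm T) hν
  simp only [zero_smul, integral_zero] at this
  exact tendsto_nhds_unique this tendsto_const_nhds |>.symm ▸ rfl

lemma pt_umom {γ : ℝ → ℂ} {Ω : Set ℂ} (J : JDom γ Ω) {c g : α → ℂ} (hc : AEStronglyMeasurable c m) (hg : Integrable g m)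
    (hΓ : ∀ᵐ x ∂m, c x ∈ γ '' Set.Icc 0 1) (hm : ∀ n : ℕ, ∫ x, c x ^ n * g x ∂m = 0)
    (hν : Integrable (fun x => g x • resolvent T (c x)) m)
    {f : ℂ → ℂ} (hf : Differentiable ℂ f) (h1 : ∀ z ∈ γ '' Set.Icc 0 1, ‖f z‖ ≤ 1) :
    Integrable (fun x => f (c x) * g x) m ∧ (∀ n : ℕ, ∫ x, c x ^ n * (f (c x) * g x) ∂m = 0) ∧
    Integrable (fun x => (f (c x) * g x) • resolvent T (c x)) m ∧
    ‖∫ x, (f (c x) * g x) • resolvent T (c x) ∂m‖ ≤ ∫ x, ‖g x • resolvent T (c x)‖ ∂m := by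
  have hfc : AEStronglyMeasurable (fun x => f (c x)) m := hf.continuous.comp_aestronglyMeasurable hc
  have hb : ∀ᵐ x ∂m, ‖f (c x)‖ ≤ 1 := hΓ.mono fun x hx => h1 _ hx
  obtain ⟨R, hR⟩ := J.isCompact_Γ.isBounded.exists_norm_le
  have hi : Integrable (fun x => (f (c x) * g x) • resolvent T (c x)) m := by
    simp only [mul_smul]
    exact hν.bdd_smul 1 hfc hb
  refine ⟨hg.bdd_mul (c := 1) hfc hb, fun n => ?_, hi, ?_⟩
  · have := pt_entire hc hg (hΓ.mono fun x hx => hR _ hx) hm (f := fun z => z ^ n * f z) (by fun_prop)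
    simpa [mul_assoc] using this
  · refine norm_integral_le_of_norm_le hν.norm ?_
    filter_upwards [hb] with x hx
    rw [mul_smul, norm_smul]
    exact mul_le_of_le_one_left (norm_nonneg _) hx

lemma pt_main {γ₁ γ₂ : ℝ → ℂ} {Ω₁ Ω₂ : Set ℂ} (J₁ : JDom γ₁ Ω₁) (J₂ : JDom γ₂ Ω₂)
    (hd : Ω₁ ∩ Ω₂ = ∅) {c₁ c₂ g₁ g₂ : α → ℂ}
    (hc₁ : AEStronglyMeasurable c₁ m) (hc₂ : AEStronglyMeasurable c₂ m) (hg₁ : Integrable g₁ m) (hg₂ : Integrable g₂ m)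
    (hΓ₁ : ∀ᵐ x ∂m, c₁ x ∈ γ₁ '' Set.Icc 0 1) (hΓ₂ : ∀ᵐ x ∂m, c₂ x ∈ γ₂ '' Set.Icc 0 1)
    (hm₁ : ∀ n : ℕ, ∫ x, c₁ x ^ n * g₁ x ∂m = 0) (hm₂ : ∀ n : ℕ, ∫ x, c₂ x ^ n * g₂ x ∂m = 0)
    (hS₁ : ∀ᵐ x ∂m, c₁ x ∉ spectrum ℂ T) (hS₂ : ∀ᵐ x ∂m, c₂ x ∉ spectrum ℂ T)
    (hν₁ : Integrable (fun x => g₁ x • resolvent T (c₁ x)) m) (hν₂ : Integrable (fun x => g₂ x • resolvent T (c₂ x)) m) :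
    (∫ x, g₂ x • resolvent T (c₂ x) ∂m) * ∫ x, g₁ x • resolvent T (c₁ x) ∂m = 0 := by
  rcases subsingleton_or_nontrivial 𝔸 with hsub | hnt
  · exact Subsingleton.elim _ _
  have hne : (spectrum ℂ T).Nonempty := spectrum.nonempty T
  by_cases z1 : ∀ b ∈ Ω₁, ∫ x, (c₁ x - b)⁻¹ * g₁ x ∂m = 0
  · rw [pt_zero J₁ hc₁ hg₁ hΓ₁ hm₁ hν₁ z1, mul_zero]
  by_cases z2 : ∀ b ∈ Ω₂, ∫ x, (c₂ x - b)⁻¹ * g₂ x ∂m = 0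
  · rw [pt_zero J₂ hc₂ hg₂ hΓ₂ hm₂ hν₂ z2, zero_mul]
  push Not at z1 z2
  obtain ⟨a₁, ha₁, hma₁⟩ := z1
  obtain ⟨a₂, ha₂, hma₂⟩ := z2
  set S := spectrum ℂ T with hS
  have hgv : ∀ {c g : α → ℂ}, (∀ᵐ x ∂m, c x ∉ S) →
      ∀ᵐ x ∂m, ‖g x‖ ≤ Metric.infDist (c x) S * ‖g x • resolvent T (c x)‖ := by
    intro c g h
    filter_upwards [h] with x hx
    obtain ⟨s, hs, he⟩ := (spectrum.isClosed (𝕜 := ℂ) T).exists_infDist_eq_dist hne (c x)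
    rw [he, norm_smul]
    have := pt_res_lb hx hs
    nlinarith [norm_nonneg (g x)]
  have hp : ∀ {c g : α → ℂ}, ∀ᵐ x ∂m, 0 ≤ ‖g x • resolvent T (c x)‖ := fun {c g} => Eventually.of_forall fun _ => norm_nonneg _
  have hdc : Continuous fun w => Metric.infDist w S := Metric.continuous_infDist_pt S
  have pos : ∀ j : ℕ, 0 < 1 / ((j:ℝ) + 1) := fun j => by positivity
  have P1 := fun j : ℕ => pt_mult J₁ hc₁ hg₁ hΓ₁ hm₁ hdc (fun _ => Metric.infDist_nonneg) hν₁.norm (hgv hS₁) hp ha₁ hma₁ (pos j)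
  have P2 := fun j : ℕ => pt_mult J₂ hc₂ hg₂ hΓ₂ hm₂ hdc (fun _ => Metric.infDist_nonneg) hν₂.norm (hgv hS₂) hp ha₂ hma₂ (pos j)
  choose C₁ hC₁ P1 using P1
  choose C₂ hC₂ P2 using P2
  set K := γ₁ '' Set.Icc 0 1 ∩ γ₂ '' Set.Icc 0 1 ∩ S with hKdef
  have hK : IsClosed K := (J₁.isCompact_Γ.isClosed.inter J₂.isCompact_Γ.isClosed).inter (spectrum.isClosed T)
  have cover : ∀ ε : ℝ, 0 < ε → ∃ r > 0, ∃ t : Finset ℂ, ↑t ⊆ K ∧ K ⊆ ⋃ a ∈ t, Metric.ball a r ∧ t.card * r ≤ ε := by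
    have Q := fun j : ℕ => P1 j (1 / (((j:ℝ) + 1) * C₁ j)) (by have := hC₁ j; positivity)
    choose f f1 f2 f3 f4 using Q
    intro ε hε
    refine pt_E J₁ f1 f2 (pt_lim J₁ ha₁ f1 f2 f4) hK (fun z hz => hz.1.1) ?_ hε
    intro j z hz
    refine (f3 j z hz.1.1).trans ?_
    rw [Metric.infDist_zero_of_mem hz.2, zero_add]
    have := hC₁ j
    apply le_of_eq; field_simp
  obtain ⟨C, hC, est⟩ := pt_est (𝔸 := 𝔸)
  set V := (∫ x, ‖g₁ x • resolvent T (c₁ x)‖ ∂m) + ∫ x, ‖g₂ x • resolvent T (c₂ x)‖ ∂m with hV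
  have v1 : 0 ≤ ∫ x, ‖g₁ x • resolvent T (c₁ x)‖ ∂m := integral_nonneg fun _ => norm_nonneg _
  have v2 : 0 ≤ ∫ x, ‖g₂ x • resolvent T (c₂ x)‖ ∂m := integral_nonneg fun _ => norm_nonneg _
  have step : ∀ j : ℕ, ∃ f₁ f₂ : ℂ → ℂ, Differentiable ℂ f₁ ∧ Differentiable ℂ f₂ ∧
      (∀ z ∈ γ₁ '' Set.Icc 0 1, ‖f₁ z‖ ≤ 1) ∧ (∀ z ∈ γ₂ '' Set.Icc 0 1, ‖f₂ z‖ ≤ 1) ∧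
      ‖f₁ a₁ - 1‖ ≤ 1 / ((j:ℝ) + 1) ∧ ‖f₂ a₂ - 1‖ ≤ 1 / ((j:ℝ) + 1) ∧
      ‖(∫ x, f₂ (c₂ x) • g₂ x • resolvent T (c₂ x) ∂m) * ∫ x, f₁ (c₁ x) • g₁ x • resolvent T (c₁ x) ∂m‖ ≤ 1 / ((j:ℝ) + 1) := by
    intro j
    have hc1 := hC₁ j
    have hc2 := hC₂ j
    set M := C₁ j + C₂ j with hM
    have hM0 : 0 ≤ M := by positivity
    have hQ : 0 < 2 * (C * M * V ^ 2 + 1) := by positivity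
    set ε := 1 / ((j:ℝ) + 1) / (2 * (C * M * V ^ 2 + 1)) with hε
    have hε0 : 0 < ε := by positivity
    obtain ⟨r, hr, t, ht, hcov, hcard⟩ := cover ε hε0
    set η := ε / (t.card + 1) with hη
    have hη0 : 0 < η := by positivity
    obtain ⟨f₁, d1, e1, b1, k1⟩ := P1 j η hη0
    obtain ⟨f₂, d2, e2, b2, k2⟩ := P2 j η hη0
    obtain ⟨i1, mo1, ii1, n1⟩ := pt_umom (T := T) J₁ hc₁ hg₁ hΓ₁ hm₁ hν₁ d1 e1
    obtain ⟨i2, mo2, ii2, n2⟩ := pt_umom (T := T) J₂ hc₂ hg₂ hΓ₂ hm₂ hν₂ d2 e2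
    refine ⟨f₁, f₂, d1, d2, e1, e2, k1, k2, ?_⟩
    have bd : ∀ {γ : ℝ → ℂ} {c g : α → ℂ} {f : ℂ → ℂ} {D : ℝ}, D ≤ M → (∀ᵐ x ∂m, c x ∈ γ '' Set.Icc 0 1) →
        (∀ z ∈ γ '' Set.Icc 0 1, ‖f z‖ ≤ D * (Metric.infDist z S + η)) →
        ∀ᵐ x ∂m, ‖(f (c x) * g x) • resolvent T (c x)‖ ≤ M * (Metric.infDist (c x) S + η) * ‖g x • resolvent T (c x)‖ := by
      intro γ c g f D hD hΓ hb
      filter_upwards [hΓ] with x hx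
      rw [mul_smul, norm_smul]
      have h0 : 0 ≤ Metric.infDist (c x) S + η := add_nonneg Metric.infDist_nonneg hη0.le
      exact mul_le_mul_of_nonneg_right ((hb _ hx).trans (mul_le_mul_of_nonneg_right hD h0)) (norm_nonneg _)
    have main := est J₁ J₂ hd hc₁ hc₂ i1 i2 hΓ₁ hΓ₂ mo1 mo2 hS₁ hS₂ ii1 ii2 hν₁.norm hν₂.norm hp hp
      hM0 hη0.le hr ht hcov (bd (by linarith) hΓ₁ b1) (bd (by linarith) hΓ₂ b2) (V := V) (by linarith) (by linarith) (by linarith) (by linarith)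
    simp only [mul_smul] at main
    refine main.trans ?_
    have hη1 : t.card * η ≤ ε := by
      rw [hη, ← mul_div_assoc, div_le_iff₀ (by positivity)]; nlinarith
    have hX : 0 ≤ C * M * V ^ 2 := by positivity
    calc C * M * V ^ 2 * (t.card * r + t.card * η) ≤ (C * M * V ^ 2 + 1) * (2 * ε) := by
          apply mul_le_mul (by linarith) (by linarith) (by positivity) (by linarith)
      _ = ε * (2 * (C * M * V ^ 2 + 1)) := by ring
      _ = 1 / ((j:ℝ) + 1) := by rw [hε]; exact div_mul_cancel₀ _ hQ.ne'
  choose f₁ f₂ d1 d2 e1 e2 k1 k2 hprod using step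
  have L1 := pt_W J₁ hc₁ hg₁ hΓ₁ hm₁ d1 e1 (fun b hb => by
    simpa using (pt_lim J₁ ha₁ d1 e1 k1 b hb).mul_const (∫ x, (c₁ x - b)⁻¹ * g₁ x ∂m)) (pt_res_sm T) hν₁
  have L2 := pt_W J₂ hc₂ hg₂ hΓ₂ hm₂ d2 e2 (fun b hb => by
    simpa using (pt_lim J₂ ha₂ d2 e2 k2 b hb).mul_const (∫ x, (c₂ x - b)⁻¹ * g₂ x ∂m)) (pt_res_sm T) hν₂
  exact tendsto_nhds_unique (L2.mul L1) (squeeze_zero_norm hprod tendsto_one_div_add_atTop_nhds_zero_nat)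

/-- commutation -/
lemma pt_comm {α : Type} [MeasurableSpace α] {m : Measure α} {c g : α → ℂ} {B : 𝔸} (hB : B * T = T * B) (hS : ∀ᵐ x ∂m, c x ∉ spectrum ℂ T) :
    (∫ x, g x • resolvent T (c x) ∂m) * B = B * ∫ x, g x • resolvent T (c x) ∂m := by
  by_cases hi : Integrable (fun x => g x • resolvent T (c x)) m
  · rw [← integral_mul_const_of_integrable hi, ← integral_const_mul_of_integrable hi]
    refine integral_congr_ae ?_
    filter_upwards [hS] with x hx
    rw [smul_mul_assoc, mul_smul_comm]
    congr 1
    have h : B * (algebraMap ℂ 𝔸 (c x) - T) = (algebraMap ℂ 𝔸 (c x) - T) * B := by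
      rw [mul_sub, sub_mul, hB, Algebra.commutes]
    calc resolvent T (c x) * B = resolvent T (c x) * (B * (algebraMap ℂ 𝔸 (c x) - T)) * resolvent T (c x) := by
          rw [mul_assoc, mul_assoc, pt_res_r hx, mul_one]
      _ = B * resolvent T (c x) := by rw [h, ← mul_assoc, pt_res_l hx, one_mul]
  · rw [integral_undef hi, zero_mul, mul_zero]

lemma pt_g_int {α : Type} [MeasurableSpace α] {m : Measure α} {c g : α → ℂ} [Nontrivial 𝔸] {R : ℝ} (hc : AEStronglyMeasurable c m) (hR : ∀ᵐ x ∂m, ‖c x‖ ≤ R)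
    (hS : ∀ᵐ x ∂m, c x ∉ spectrum ℂ T) (hi : Integrable (fun x => g x • resolvent T (c x)) m) : Integrable g m := by
  have h1 : Integrable (fun x => g x • (1:𝔸)) m := by
    have h2 : Integrable (fun x => c x • (g x • resolvent T (c x)) - T * (g x • resolvent T (c x))) m :=
      (hi.bdd_smul R hc hR).sub (hi.const_mul T)
    refine h2.congr ?_
    filter_upwards [hS] with x hx
    rw [← pt_res_r hx, Algebra.algebraMap_eq_smul_one, sub_mul, smul_mul_assoc, one_mul, smul_sub, mul_smul_comm, smul_comm]
  obtain ⟨l, hl⟩ := SeparatingDual.exists_eq_one (R := ℂ) (one_ne_zero : (1:𝔸) ≠ 0)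
  refine (l.integrable_comp h1).congr (Eventually.of_forall fun x => ?_)
  simp [hl]
end asm

/-- Two contour-integral operators built over rectifiable Jordan curves bounding
disjoint Jordan domains annihilate each other. Arc-length negligibility of
`Γ₁ ∩ Γ₂` and of `σ(T) ∩ Γ_k` is encoded via the parametrizations. -/
theorem stmt9 (T : H →L[ℂ] H) (γ₁ γ₂ : ℝ → ℂ) (Ω₁ Ω₂ : Set ℂ) (h₁ h₂ : ℂ → ℂ)
    (hγ1c : ContinuousOn γ₁ (Set.Icc 0 1)) (hγ1cl : γ₁ 0 = γ₁ 1)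
    (hγ1inj : Set.InjOn γ₁ (Set.Ico 0 1))
    (hγ1rect : eVariationOn γ₁ (Set.Icc 0 1) ≠ ⊤)
    (hγ2c : ContinuousOn γ₂ (Set.Icc 0 1)) (hγ2cl : γ₂ 0 = γ₂ 1)
    (hγ2inj : Set.InjOn γ₂ (Set.Ico 0 1))
    (hγ2rect : eVariationOn γ₂ (Set.Icc 0 1) ≠ ⊤)
    (hΩ1o : IsOpen Ω₁) (hΩ1b : Bornology.IsBounded Ω₁)
    (hΩ1fr : frontier Ω₁ = γ₁ '' Set.Icc 0 1)
    (hΩ2o : IsOpen Ω₂) (hΩ2b : Bornology.IsBounded Ω₂)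
    (hΩ2fr : frontier Ω₂ = γ₂ '' Set.Icc 0 1)
    (hdisj : Ω₁ ∩ Ω₂ = ∅)
    (hΓdisj : (∀ᵐ t ∂(volume.restrict (Set.Ioc (0:ℝ) 1)), γ₁ t ∉ γ₂ '' Set.Icc 0 1) ∧
      (∀ᵐ t ∂(volume.restrict (Set.Ioc (0:ℝ) 1)), γ₂ t ∉ γ₁ '' Set.Icc 0 1))
    (hspec : (∀ᵐ t ∂(volume.restrict (Set.Ioc (0:ℝ) 1)), γ₁ t ∉ spectrum ℂ T) ∧
      (∀ᵐ t ∂(volume.restrict (Set.Ioc (0:ℝ) 1)), γ₂ t ∉ spectrum ℂ T))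
    (hh1 : DifferentiableOn ℂ h₁ Ω₁) (hh2 : DifferentiableOn ℂ h₂ Ω₂)
    (hmom1 : ∀ n : ℕ, ∫ t in (0:ℝ)..1, (γ₁ t) ^ n * h₁ (γ₁ t) * deriv γ₁ t = 0)
    (hmom2 : ∀ n : ℕ, ∫ t in (0:ℝ)..1, (γ₂ t) ^ n * h₂ (γ₂ t) * deriv γ₂ t = 0)
    (hbd1 : ∃ C : ℝ, ∀ᵐ t ∂(volume.restrict (Set.Ioc (0:ℝ) 1)),
      ‖h₁ (γ₁ t)‖ * ‖resolvent T (γ₁ t)‖ ≤ C)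
    (hbd2 : ∃ C : ℝ, ∀ᵐ t ∂(volume.restrict (Set.Ioc (0:ℝ) 1)),
      ‖h₂ (γ₂ t)‖ * ‖resolvent T (γ₂ t)‖ ≤ C)
    (A₁ A₂ : H →L[ℂ] H)
    (hA1 : A₁ = (2 * π * Complex.I)⁻¹ •
      ∫ t in (0:ℝ)..1, (h₁ (γ₁ t) * deriv γ₁ t) • resolvent T (γ₁ t))
    (hA2 : A₂ = (2 * π * Complex.I)⁻¹ •
      ∫ t in (0:ℝ)..1, (h₂ (γ₂ t) * deriv γ₂ t) • resolvent T (γ₂ t)) :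
    A₁ ∈ bicommutant T ∧ A₂ ∈ bicommutant T ∧ A₁ * A₂ = 0 ∧ A₂ * A₁ = 0 := by
  classical
  have J₁ : JDom γ₁ Ω₁ := ⟨hγ1c, hγ1cl, hγ1inj, hγ1rect, hΩ1o, hΩ1b, hΩ1fr⟩
  have J₂ : JDom γ₂ Ω₂ := ⟨hγ2c, hγ2cl, hγ2inj, hγ2rect, hΩ2o, hΩ2b, hΩ2fr⟩
  rw [intervalIntegral.integral_of_le zero_le_one] at hA1 hA2
  have b1 : A₁ ∈ bicommutant T := by
    intro B hB
    rw [hA1, smul_mul_assoc, mul_smul_comm, pt_comm (T := T) (B := B) hB hspec.1]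
  have b2 : A₂ ∈ bicommutant T := by
    intro B hB
    rw [hA2, smul_mul_assoc, mul_smul_comm, pt_comm (T := T) (B := B) hB hspec.2]
  have cT : A₁ ∈ commutant T := b1 T rfl
  have hcomm : A₂ * A₁ = A₁ * A₂ := b2 A₁ cT
  suffices h : A₂ * A₁ = 0 from ⟨b1, b2, hcomm ▸ h, h⟩
  rcases subsingleton_or_nontrivial (H →L[ℂ] H) with hsub | hnt
  · exact Subsingleton.elim _ _
  rw [hA1, hA2, smul_mul_assoc, mul_smul_comm]
  by_cases i1 : Integrable (fun t => (h₁ (γ₁ t) * deriv γ₁ t) • resolvent T (γ₁ t)) (volume.restrict (Set.Ioc (0:ℝ) 1))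
  swap
  · rw [integral_undef i1]; simp
  by_cases i2 : Integrable (fun t => (h₂ (γ₂ t) * deriv γ₂ t) • resolvent T (γ₂ t)) (volume.restrict (Set.Ioc (0:ℝ) 1))
  swap
  · rw [integral_undef i2]; simp
  have c1 : AEStronglyMeasurable γ₁ (volume.restrict (Set.Ioc (0:ℝ) 1)) :=
    (hγ1c.mono Set.Ioc_subset_Icc_self).aestronglyMeasurable measurableSet_Ioc
  have c2 : AEStronglyMeasurable γ₂ (volume.restrict (Set.Ioc (0:ℝ) 1)) :=
    (hγ2c.mono Set.Ioc_subset_Icc_self).aestronglyMeasurable measurableSet_Ioc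
  have m1 : ∀ᵐ t ∂(volume.restrict (Set.Ioc (0:ℝ) 1)), γ₁ t ∈ γ₁ '' Set.Icc 0 1 :=
    (ae_restrict_mem measurableSet_Ioc).mono fun t ht => Set.mem_image_of_mem _ (Set.Ioc_subset_Icc_self ht)
  have m2 : ∀ᵐ t ∂(volume.restrict (Set.Ioc (0:ℝ) 1)), γ₂ t ∈ γ₂ '' Set.Icc 0 1 :=
    (ae_restrict_mem measurableSet_Ioc).mono fun t ht => Set.mem_image_of_mem _ (Set.Ioc_subset_Icc_self ht)
  obtain ⟨R₁, hR₁⟩ := J₁.isCompact_Γ.isBounded.exists_norm_le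
  obtain ⟨R₂, hR₂⟩ := J₂.isCompact_Γ.isBounded.exists_norm_le
  have g1 := pt_g_int c1 (m1.mono fun t ht => hR₁ _ ht) hspec.1 i1
  have g2 := pt_g_int c2 (m2.mono fun t ht => hR₂ _ ht) hspec.2 i2
  have mo1 : ∀ n : ℕ, ∫ t in Set.Ioc (0:ℝ) 1, γ₁ t ^ n * (h₁ (γ₁ t) * deriv γ₁ t) = 0 := by
    intro n
    rw [← hmom1 n, intervalIntegral.integral_of_le zero_le_one]
    simp only [mul_assoc]
  have mo2 : ∀ n : ℕ, ∫ t in Set.Ioc (0:ℝ) 1, γ₂ t ^ n * (h₂ (γ₂ t) * deriv γ₂ t) = 0 := by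
    intro n
    rw [← hmom2 n, intervalIntegral.integral_of_le zero_le_one]
    simp only [mul_assoc]
  rw [pt_main J₁ J₂ hdisj c1 c2 g1 g2 m1 m2 mo1 mo2 hspec.1 hspec.2 i1 i2, smul_zero, smul_zero]
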